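/- Let R_k → ∞ and δ_k → 0⁺, and let u_k be classical solutions of the one-phase free boundary problem in the annuli B_{R_k} ∖ closure(B_{δ_k}) ⊆ ℝ² satisfying condition (A) (with radii δ_k and R_k). Then there is a subsequence of (u_k) converging uniformly on compact subsets of ℝ² ∖ {0} to a function which, after composition with a rotation of ℝ², is either the one-plane solution P, a two-plane solution TP_a for some a > 0, or the wedge W₁. -/

import Mathlib

open Complex Metric Set Filter MeasureTheory
open scoped Topology Classical NNReal

noncomputable section

/-- The positive phase of `u` in `Ω`. -/
def posSet (Ω : Set ℂ) (u : ℂ → ℝ) : Set ℂ := {z ∈ Ω | 0 < u z}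

/-- The free boundary of `u` in `Ω`. -/
def FB (Ω : Set ℂ) (u : ℂ → ℝ) : Set ℂ := Ω ∩ frontier (posSet Ω u)

/-- The gradient of `u : ℂ → ℝ`, viewed as a complex number `∂ₓu + i ∂ᵧu`. -/
def grad2 (u : ℂ → ℝ) (z : ℂ) : ℂ :=
  ((fderiv ℝ u z 1 : ℝ) : ℂ) + ((fderiv ℝ u z Complex.I : ℝ) : ℂ) * Complex.I

/-- Second derivative (Hessian) of `u : ℂ → ℝ` at `z` in directions `v, w`. -/
def hess (u : ℂ → ℝ) (z v w : ℂ) : ℝ := fderiv ℝ (fun x => fderiv ℝ u x v) z w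

/-- `u` is harmonic on `s`: twice continuously differentiable with vanishing Laplacian. -/
def HarmonicOn2 (u : ℂ → ℝ) (s : Set ℂ) : Prop :=
  ContDiffOn ℝ 2 u s ∧ ∀ z ∈ s, hess u z 1 1 + hess u z Complex.I Complex.I = 0

/-- A classical solution of the one-phase free boundary problem `Δu = 0` in `{u>0}`,
`|∇u| = 1` on the free boundary, in the open set `Ω ⊆ ℝ² ≅ ℂ`. -/
structure IsClassicalSolution (Ω : Set ℂ) (u : ℂ → ℝ) : Prop where
  contOn : ContinuousOn u Ω
  nonneg : ∀ z ∈ Ω, 0 ≤ u z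
  harm : HarmonicOn2 u (posSet Ω u)
  smooth_ext : ∃ v : ℂ → ℝ, ContDiffOn ℝ (⊤ : ℕ∞) v (Ω ∩ closure (posSet Ω u)) ∧
    Set.EqOn u v (Ω ∩ closure (posSet Ω u))
  fb_manifold : ∀ z ∈ FB Ω u, ∃ V : Set ℂ, IsOpen V ∧ z ∈ V ∧ V ⊆ Ω ∧
    ∃ φ : ℂ → ℝ, ContDiffOn ℝ (⊤ : ℕ∞) φ V ∧ (∀ w ∈ V, fderiv ℝ φ w ≠ 0) ∧
      V ∩ posSet Ω u = {w ∈ V | 0 < φ w} ∧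
      V ∩ {w | u w = 0} = {w ∈ V | φ w ≤ 0} ∧
      V ∩ FB Ω u = {w ∈ V | φ w = 0}
  grad_one : ∀ z ∈ FB Ω u,
    Filter.Tendsto (fun w => ‖grad2 u w‖) (nhdsWithin z (posSet Ω u)) (nhds 1)

/-- One-plane solution `P(z) = max (Re z) 0`. -/
def Pfun (z : ℂ) : ℝ := max z.re 0

/-- Wedge solution `W_s(z) = s |Re z|`. -/
def Wfun (s : ℝ) (z : ℂ) : ℝ := s * |z.re|

/-- Two-plane solution `TP_a`. -/
def TPfun (a : ℝ) (z : ℂ) : ℝ := max z.re 0 + max (-z.re - a) 0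

/-- Rotation of the plane by angle `θ`. -/
def rot (θ : ℝ) (z : ℂ) : ℂ := Complex.exp (θ * Complex.I) * z

/-- The strip `S = {|Im ζ| < π/2}`. -/
def Sstrip : Set ℂ := {ζ : ℂ | |ζ.im| < Real.pi / 2}

/-- The hairpin domain `Ω₁ = {|x₂| < π/2 + cosh x₁}`. -/
def Omega1 : Set ℂ := {z : ℂ | |z.im| < Real.pi / 2 + Real.cosh z.re}

/-- Dilated hairpin domain `Ω_a = aΩ₁`. -/
def OmegaA (a : ℝ) : Set ℂ := {z : ℂ | z / (a : ℂ) ∈ Omega1}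

/-- The Hauswirth–Hélein–Pacard double hairpin solution `H = H₁`:
`H(z) = Re (cosh w)` where `w` is the unique point of the strip `S` with `w + sinh w = z`,
and `H(z) = 0` if there is no such point. -/
def hairpinH (z : ℂ) : ℝ :=
  if h : ∃ w : ℂ, w ∈ Sstrip ∧ w + Complex.sinh w = z then (Complex.cosh h.choose).re else 0

/-- The double hairpin solution `H_a(z) = a H(z/a)`. -/
def hairpin (a : ℝ) (z : ℂ) : ℝ := a * hairpinH (z / (a : ℂ))

/-- Euclidean dot product of two complex numbers viewed as vectors in ℝ². -/
def dot2 (a b : ℂ) : ℝ := a.re * b.re + a.im * b.im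

/-- Divergence of a vector field `ψ : ℂ → ℂ` on ℝ². -/
def div2 (ψ : ℂ → ℂ) (z : ℂ) : ℝ := (fderiv ℝ ψ z 1).re + (fderiv ℝ ψ z Complex.I).im

/-- A variational (weak) solution of the one-phase free boundary problem in `Ω`:
`u ∈ H¹_loc(Ω) ∩ C(Ω)`, `u ≥ 0`, `u ∈ C²({u>0})`, and the domain-variation
Euler–Lagrange identity holds for all compactly supported smooth vector fields. -/
def VariationalSolution (Ω : Set ℂ) (u : ℂ → ℝ) : Prop :=
  ContinuousOn u Ω ∧ (∀ z ∈ Ω, 0 ≤ u z) ∧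
  (∀ K : Set ℂ, K ⊆ Ω → IsCompact K →
    MeasureTheory.IntegrableOn (fun z => (u z) ^ 2 + ‖grad2 u z‖ ^ 2) K) ∧
  ContDiffOn ℝ 2 u (posSet Ω u) ∧
  ∀ ψ : ℂ → ℂ, ContDiff ℝ (⊤ : ℕ∞) ψ → HasCompactSupport ψ → tsupport ψ ⊆ Ω →
    ∫ z in Ω, ((‖grad2 u z‖ ^ 2 + Set.indicator {w | 0 < u w} (fun _ => (1 : ℝ)) z) * div2 ψ z
      - 2 * dot2 (grad2 u z) (fderiv ℝ ψ z (grad2 u z))) = 0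

/-- Average of `w` over the circle of radius `r` around `z`. -/
def circleAvg (w : ℂ → ℝ) (z : ℂ) (r : ℝ) : ℝ :=
  (1 / (2 * Real.pi)) * ∫ θ in (0 : ℝ)..(2 * Real.pi), w (z + r * Complex.exp (θ * Complex.I))

/-- Superharmonicity on `s` via the super-mean-value property. -/
def SuperharmonicOn2 (w : ℂ → ℝ) (s : Set ℂ) : Prop :=
  ∀ z ∈ s, ∀ r : ℝ, 0 < r → Metric.closedBall z r ⊆ s → circleAvg w z r ≤ w z

/-- Subharmonicity on `s` via the sub-mean-value property. -/
def SubharmonicOn2 (w : ℂ → ℝ) (s : Set ℂ) : Prop :=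
  ∀ z ∈ s, ∀ r : ℝ, 0 < r → Metric.closedBall z r ⊆ s → w z ≤ circleAvg w z r

/-- Non-tangential approach region in `B` at `x₀` with aperture `C`. -/
def NontangentialIn (B : Set ℂ) (x₀ : ℂ) (C : ℝ) : Set ℂ :=
  {x ∈ B | ‖x - x₀‖ ≤ C * Metric.infDist x Bᶜ}

/-- `w(x) = α ⟨x − x₀, ν⟩⁺ + o(|x − x₀|)` as `x → x₀` within the region `R`. -/
def HasSlopeAt (w : ℂ → ℝ) (x₀ ν : ℂ) (α : ℝ) (R : Set ℂ) : Prop :=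
  Filter.Tendsto (fun x => (w x - α * max (dot2 (x - x₀) ν) 0) / ‖x - x₀‖)
    (nhdsWithin x₀ R) (nhds 0)

/-- Viscosity supersolution of the one-phase free boundary problem in `Ω`. -/
structure ViscositySupersolution (Ω : Set ℂ) (w : ℂ → ℝ) : Prop where
  contOn : ContinuousOn w Ω
  nonneg : ∀ z ∈ Ω, 0 ≤ w z
  superharm : SuperharmonicOn2 w (posSet Ω w)
  slope : ∀ x₀ ∈ FB Ω w, ∀ (y : ℂ) (ρ : ℝ), 0 < ρ → Metric.ball y ρ ⊆ posSet Ω w →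
    dist x₀ y = ρ → ∃ α : ℝ, α ≤ 1 ∧ ∀ C : ℝ, 1 < C →
      HasSlopeAt w x₀ ((y - x₀) / (ρ : ℂ)) α (NontangentialIn (Metric.ball y ρ) x₀ C)

/-- Viscosity subsolution of the one-phase free boundary problem in `Ω`. -/
structure ViscositySubsolution (Ω : Set ℂ) (w : ℂ → ℝ) : Prop where
  contOn : ContinuousOn w Ω
  nonneg : ∀ z ∈ Ω, 0 ≤ w z
  subharm : SubharmonicOn2 w (posSet Ω w)
  slope : ∀ x₀ ∈ FB Ω w, ∀ (y : ℂ) (ρ : ℝ), 0 < ρ →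
    Metric.ball y ρ ⊆ {z ∈ Ω | w z = 0} → dist x₀ y = ρ →
    ∃ α : ℝ, 1 ≤ α ∧ ∀ C : ℝ, 1 < C →
      HasSlopeAt w x₀ ((x₀ - y) / (ρ : ℂ)) α
        (NontangentialIn (closure (Metric.ball y ρ))ᶜ x₀ C)

/-- Viscosity solution: both a supersolution and a subsolution. -/
def ViscositySolution (Ω : Set ℂ) (w : ℂ → ℝ) : Prop :=
  ViscositySupersolution Ω w ∧ ViscositySubsolution Ω w

/-- Non-degeneracy with constant `c`: linear growth away from the free boundary. -/
def Nondegenerate (Ω : Set ℂ) (w : ℂ → ℝ) (c : ℝ) : Prop :=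
  ∀ x ∈ FB Ω w, ∀ r : ℝ, 0 < r → Metric.ball x r ⊆ Ω → c * r ≤ sSup (w '' Metric.ball x r)

/-- The open annulus `{δ < |z| < R}`. -/
def ann (δ R : ℝ) : Set ℂ := {z : ℂ | δ < ‖z‖ ∧ ‖z‖ < R}

/-- Condition (A): the free boundary of `u` in the annulus `{δ < |z| < R}` consists of
exactly two connected components, each non-compact with closure meeting both boundary
circles. -/
def ConditionA (δ R : ℝ) (u : ℂ → ℝ) : Prop :=
  ∃ F₁ F₂ : Set ℂ,
    F₁.Nonempty ∧ F₂.Nonempty ∧ Disjoint F₁ F₂ ∧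
    F₁ ∪ F₂ = FB (ann δ R) u ∧
    (∀ z ∈ F₁, connectedComponentIn (FB (ann δ R) u) z = F₁) ∧
    (∀ z ∈ F₂, connectedComponentIn (FB (ann δ R) u) z = F₂) ∧
    ¬ IsCompact F₁ ∧ ¬ IsCompact F₂ ∧
    (closure F₁ ∩ Metric.sphere 0 δ).Nonempty ∧
    (closure F₁ ∩ Metric.sphere 0 R).Nonempty ∧
    (closure F₂ ∩ Metric.sphere 0 δ).Nonempty ∧
    (closure F₂ ∩ Metric.sphere 0 R).Nonempty

/-- `k` is the curvature of the set `S` at the point `p`, computed via an arc-length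
parametrization. -/
def IsCurvatureAt (S : Set ℂ) (p : ℂ) (k : ℝ) : Prop :=
  ∃ γ : ℝ → ℂ, ContDiff ℝ 2 γ ∧ γ 0 = p ∧ (∀ s : ℝ, ‖deriv γ s‖ = 1) ∧
    (∃ ε > 0, ∀ s ∈ Set.Ioo (-ε) ε, γ s ∈ S) ∧ ‖deriv (deriv γ) 0‖ = k

/-- A set has exactly two connected components. -/
def HasExactlyTwoComponents (S : Set ℂ) : Prop :=
  ∃ z₁ ∈ S, ∃ z₂ ∈ S, connectedComponentIn S z₁ ≠ connectedComponentIn S z₂ ∧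
    ∀ z ∈ S, connectedComponentIn S z = connectedComponentIn S z₁ ∨
      connectedComponentIn S z = connectedComponentIn S z₂

end

open scoped ComplexConjugate

noncomputable def reL (q : ℂ) : ℂ →L[ℝ] ℝ := reCLM.comp (ContinuousLinearMap.mul ℝ ℂ q)
noncomputable def phL (q : ℂ) : ℂ →L[ℝ] ℂ := ContinuousLinearMap.mul ℝ ℂ (q ^ 2) + (conjCLE : ℂ →L[ℝ] ℂ)

@[simp] lemma reL_apply (q h : ℂ) : reL q h = (q * h).re := rfl
@[simp] lemma phL_apply (q h : ℂ) : phL q h = q ^ 2 * h + conj h := rfl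

lemma HasDerivAt.reF {f : ℂ → ℂ} {q z : ℂ} (h : HasDerivAt f q z) :
    HasFDerivAt (fun z => (f z).re) (reL q) z := by
  have h1 := reCLM.hasFDerivAt.comp z (h.hasFDerivAt.restrictScalars ℝ)
  refine h1.congr_fderiv ?_
  ext x; simp [mul_comm]

lemma eq_of_fd {E : Type*} [NormedAddCommGroup E] [NormedSpace ℝ E] {f g : ℂ → E} {s : Set ℂ}
    {f' : ℂ → ℂ →L[ℝ] E}
    (hs : Convex ℝ s) (ho : IsOpen s) (hf : ∀ z ∈ s, HasFDerivAt f (f' z) z) (hg : ∀ z ∈ s, HasFDerivAt g (f' z) z)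
    {c : ℂ} (hc : c ∈ s) (he : f c = g c) : ∀ z ∈ s, f z = g z := by
  intro z hz
  have := hs.is_const_of_fderivWithin_eq_zero (𝕜 := ℝ) (f := fun z => f z - g z)
    (fun x hx => ((hf x hx).sub (hg x hx)).differentiableAt.differentiableWithinAt) ?_ hz hc
  · simp only [he, sub_self] at this; exact sub_eq_zero.1 this
  · intro x hx
    have h1 := ((hf x hx).sub (hg x hx))
    rw [sub_self] at h1
    exact h1.hasFDerivWithinAt.fderivWithin (ho.uniqueDiffWithinAt hx)

lemma prim_ex {u : ℂ → ℝ} {q : ℂ → ℂ} {c : ℂ} {R : ℝ} (hR : 0 < R)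
    (hq : DifferentiableOn ℂ q (ball c R)) (hu : ∀ z ∈ ball c R, HasFDerivAt u (reL (q z)) z) :
    ∃ f : ℂ → ℂ, f c = u c ∧ (∀ z ∈ ball c R, HasDerivAt f (q z) z) ∧
      ∀ z ∈ ball c R, (f z).re = u z := by
  obtain ⟨f, h0, hf⟩ := hq.isExactOn_ball.with_val_at c (u c)
  exact ⟨f, h0, hf, eq_of_fd (convex_ball _ _) isOpen_ball (fun z hz => (hf z hz).reF) hu (mem_ball_self hR)
    (by simp [h0])⟩

lemma schw_aux {f : ℂ → ℂ} {c : ℂ} {R m : ℝ} (hR : 0 < R) (hm : 0 < m)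
    (hf : DifferentiableOn ℂ f (ball c R)) (h0 : f c = m) (hp : ∀ z ∈ ball c R, 0 ≤ (f z).re)
    {z : ℂ} (hz : z ∈ ball c R) : ‖f z - m‖ * R ≤ ‖z - c‖ * ‖f z + m‖ := by
  have hne : ∀ z ∈ ball c R, f z + m ≠ 0 := fun z hz h => by
    have := congrArg re h; simp at this; linarith [hp z hz]
  have hle : ∀ z ∈ ball c R, ‖f z - m‖ ≤ ‖f z + m‖ := fun z hz => by
    rw [← sq_le_sq₀ (norm_nonneg _) (norm_nonneg _), Complex.sq_norm, Complex.sq_norm,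
      normSq_apply, normSq_apply]
    simp; nlinarith [hp z hz]
  have := Complex.dist_le_div_mul_dist_of_mapsTo_ball (f := fun z => (f z - m) / (f z + m))
    (c := c) (R₁ := R) (R₂ := 1)
    ((hf.sub_const _).div (hf.add_const _) hne) ?_ hz
  · simp only [h0, sub_self, zero_div, sub_zero, norm_div, dist_eq_norm] at this
    rw [div_le_iff₀ (norm_pos_iff.2 (hne z hz))] at this
    have h3 : 1 / R * ‖z - c‖ * ‖f z + m‖ * R = ‖z - c‖ * ‖f z + m‖ := by field_simp
    rw [← h3]; exact mul_le_mul_of_nonneg_right this hR.le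
  · intro w hw
    simp only [h0, sub_self, zero_div, mem_closedBall, dist_zero_right, norm_div]
    exact div_le_one_of_le₀ (hle w hw) (norm_nonneg _)

lemma schw {f : ℂ → ℂ} {c : ℂ} {R m : ℝ} (hR : 0 < R) (hm : 0 ≤ m)
    (hf : DifferentiableOn ℂ f (ball c R)) (h0 : f c = m) (hp : ∀ z ∈ ball c R, 0 ≤ (f z).re)
    {z : ℂ} (hz : z ∈ ball c R) : ‖f z - m‖ * R ≤ ‖z - c‖ * ‖f z + m‖ := by
  have key : ∀ᶠ e : ℝ in 𝓝[>] 0, ‖f z - m‖ * R ≤ ‖z - c‖ * ‖f z + m + 2 * e‖ := by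
    filter_upwards [self_mem_nhdsWithin] with e (he : 0 < e)
    have := schw_aux (f := fun z => f z + e) (m := m + e) hR (by linarith) (hf.add_const _)
      (by simp [h0]) (fun z hz => by simp; linarith [hp z hz]) hz
    push_cast at this
    convert this using 3 <;> ring_nf
  refine ge_of_tendsto ?_ key
  have : Continuous fun e : ℝ => ‖z - c‖ * ‖f z + m + 2 * e‖ := by fun_prop
  simpa using (this.tendsto 0).mono_left nhdsWithin_le_nhds

lemma harnack {u : ℂ → ℝ} {q : ℂ → ℂ} {c : ℂ} {R : ℝ} (hR : 0 < R)
    (hq : DifferentiableOn ℂ q (ball c R)) (hu : ∀ z ∈ ball c R, HasFDerivAt u (reL (q z)) z)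
    (hp : ∀ z ∈ ball c R, 0 ≤ u z) :
    (∀ z ∈ ball c R, (R - ‖z - c‖) * u c ≤ (R + ‖z - c‖) * u z ∧
      (R - ‖z - c‖) * u z ≤ (R + ‖z - c‖) * u c) ∧ ‖q c‖ * R ≤ 2 * u c := by
  obtain ⟨f, h0, hf, hre⟩ := prim_ex hR hq hu
  have hc := mem_ball_self (x := c) hR
  have S : ∀ z ∈ ball c R, ‖f z - u c‖ * R ≤ ‖z - c‖ * ‖f z + u c‖ := fun z hz =>
    schw hR (hp c hc) (fun z hz => (hf z hz).differentiableAt.differentiableWithinAt) h0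
      (fun z hz => by rw [hre z hz]; exact hp z hz) hz
  constructor
  · intro z hz
    have h1 := S z hz
    clear S
    have h2 := hre z hz
    have hzc : ‖z - c‖ < R := by simpa [dist_eq_norm] using hz
    have ht := norm_nonneg (z - c)
    generalize ‖z - c‖ = t at *
    have hm := hp c hc
    have hu := hp z hz
    have h3 : (‖f z - u c‖ * R) ^ 2 ≤ (t * ‖f z + u c‖) ^ 2 := by gcongr
    rw [mul_pow, mul_pow, Complex.sq_norm, Complex.sq_norm, normSq_apply, normSq_apply] at h3
    simp only [sub_re, sub_im, add_re, add_im, ofReal_re, ofReal_im, h2] at h3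
    generalize u c = m at *
    generalize u z = a at *
    generalize (f z).im = b at *
    have h4 : ((R + t) * a - (R - t) * m) * ((R - t) * a - (R + t) * m) ≤ 0 := by
      nlinarith [mul_nonneg (sq_nonneg b) (by nlinarith : 0 ≤ R ^ 2 - t ^ 2)]
    have hA : 0 ≤ (R - t) := by linarith
    have h5 : (R - t) * a - (R + t) * m ≤ (R + t) * a - (R - t) * m := by nlinarith
    constructor <;> by_contra! h <;> nlinarith
  · have h1 := (hasDerivAt_iff_tendsto_slope.1 (hf c hc)).norm.mul_const R
    have h2 : Tendsto (fun z => ‖f z + u c‖) (𝓝[≠] c) (𝓝 (2 * u c)) := by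
      have := ((hf c hc).continuousAt.add_const (u c : ℂ)).norm
      have h3 : ‖f c + u c‖ = 2 * u c := by
        rw [h0, ← two_mul]; simp [abs_of_nonneg (hp c hc)]
      unfold ContinuousAt at this
      beta_reduce at this
      rw [h3] at this
      exact this.mono_left nhdsWithin_le_nhds
    refine le_of_tendsto_of_tendsto h1 h2 ?_
    filter_upwards [self_mem_nhdsWithin, nhdsWithin_le_nhds (ball_mem_nhds c hR)] with z hz hz2
    have hz' : 0 < ‖z - c‖ := norm_pos_iff.2 (sub_ne_zero.2 hz)
    rw [slope_def_module, norm_smul, norm_inv, mul_assoc, inv_mul_le_iff₀ hz', h0]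
    exact S z hz2

lemma grad_bd {u : ℂ → ℝ} {q : ℂ → ℂ} {c : ℂ} {R M : ℝ} (hR : 0 < R)
    (hq : DifferentiableOn ℂ q (ball c R)) (hu : ∀ z ∈ ball c R, HasFDerivAt u (reL (q z)) z)
    (hp : ∀ z ∈ ball c R, |u z| ≤ M) : ‖q c‖ * R ≤ 4 * M := by
  have := (harnack (u := fun z => u z + M) hR hq (fun z hz => (hu z hz).add_const M)
    (fun z hz => by linarith [abs_le.1 (hp z hz)])).2
  linarith [abs_le.1 (hp c (mem_ball_self hR))]

structure AE (L ε ρ : ℝ) (u : ℂ → ℝ) (Φ q : ℂ → ℂ) (Z : Set ℂ) : Prop where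
  cl : IsClosed Z
  ne : Z.Nonempty
  circ : ∀ z ∈ Z, ∀ r > 0, ‖z‖ + r < ρ → ∃ w ∈ Z, ‖w - z‖ = r
  nn : ∀ z ∈ ball (0 : ℂ) ρ, 0 ≤ u z
  zu : ∀ z ∈ Z, z ∈ ball (0 : ℂ) ρ → u z = 0
  zΦ : ∀ z ∈ Z, z ∈ ball (0 : ℂ) ρ → Φ z = 0
  lu : ∀ z ∈ ball (0 : ℂ) ρ, ∀ w ∈ ball (0 : ℂ) ρ, dist (u z) (u w) ≤ L * dist z w + ε
  lΦ : ∀ z ∈ ball (0 : ℂ) ρ, ∀ w ∈ ball (0 : ℂ) ρ, dist (Φ z) (Φ w) ≤ L * dist z w + ε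
  hq : DifferentiableOn ℂ q (ball (0 : ℂ) ρ \ Z)
  du : ∀ z ∈ ball (0 : ℂ) ρ, z ∉ Z → HasFDerivAt u (reL (q z)) z
  dΦ : ∀ z ∈ ball (0 : ℂ) ρ, z ∉ Z → HasFDerivAt Φ (phL (q z)) z

lemma arz {E : Type*} [MetricSpace E] [ProperSpace E] {L M : ℝ} {ε ρ : ℕ → ℝ} (e0 : E)
    (hL : 0 ≤ L) (hε : Tendsto ε atTop (𝓝 0)) (hρ : Tendsto ρ atTop atTop) (f : ℕ → ℂ → E)
    (hf : ∀ k, ∀ z ∈ ball (0 : ℂ) (ρ k), ∀ w ∈ ball (0 : ℂ) (ρ k),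
      dist (f k z) (f k w) ≤ L * dist z w + ε k)
    (h0 : ∀ k, dist (f k 0) e0 ≤ M) :
    ∃ φ : ℕ → ℕ, StrictMono φ ∧ ∃ g : ℂ → E, TendstoLocallyUniformly (fun k => f (φ k)) g atTop := by
  have ev : ∀ z : ℂ, ∀ᶠ k in atTop, z ∈ ball (0 : ℂ) (ρ k) := fun z => by
    filter_upwards [hρ.eventually_gt_atTop ‖z‖] with k hk using by simpa using hk
  obtain ⟨B, hB⟩ := hε.bddAbove_range
  have hB' : ∀ k, ε k ≤ B := fun k => hB ⟨k, rfl⟩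
  let d : ℕ → ℂ := TopologicalSpace.denseSeq ℂ
  let x : ℕ → ℕ → E := fun k n => if d n ∈ ball (0 : ℂ) (ρ k) then f k (d n) else f k 0
  obtain ⟨xi, -, φ, hφ, hx⟩ := (isCompact_univ_pi (fun n =>
    isCompact_closedBall e0 (M + L * dist (d n) 0 + |B|))).tendsto_subseq (x := x) (fun k => by
      intro n _
      simp only [mem_closedBall, x]
      have h1 : 0 ≤ L * dist (d n) 0 := by positivity
      split_ifs with h
      · have h2 := hf k _ h 0 (by simp only [mem_ball, dist_self] at h ⊢; exact dist_nonneg.trans_lt h)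
        linarith [dist_triangle (f k (d n)) (f k 0) e0, h0 k, hB' k, le_abs_self B]
      · linarith [h0 k, abs_nonneg B])
  have hεφ := hε.comp hφ.tendsto_atTop
  rw [tendsto_pi_nhds] at hx
  have hd : ∀ n, Tendsto (fun k => f (φ k) (d n)) atTop (𝓝 (xi n)) := fun n =>
    (hx n).congr' <| by
      filter_upwards [hφ.tendsto_atTop.eventually (ev (d n))] with k hk
      simp only [Function.comp, x, if_pos hk]
  have hc : ∀ z, ∃ y, Tendsto (fun k => f (φ k) z) atTop (𝓝 y) := by
    intro z
    refine cauchySeq_tendsto_of_complete (Metric.cauchySeq_iff'.2 fun e he => ?_)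
    obtain ⟨n, hn⟩ : ∃ n, L * dist z (d n) < e / 8 := by
      obtain ⟨y, hy⟩ := (TopologicalSpace.denseRange_denseSeq ℂ).exists_mem_open
        (isOpen_ball (x := z) (ε := e / 8 / (L + 1))) (nonempty_ball.2 (by positivity))
      refine ⟨y, ?_⟩
      rw [mem_ball', lt_div_iff₀ (by positivity)] at hy
      nlinarith [dist_nonneg (x := z) (y := TopologicalSpace.denseSeq ℂ y)]
    have h1 : ∀ᶠ k in atTop, dist (f (φ k) z) (xi n) < e / 2 := by
      filter_upwards [hφ.tendsto_atTop.eventually (ev (d n)), hφ.tendsto_atTop.eventually (ev z),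
        Metric.tendsto_nhds.1 (hd n) (e / 8) (by positivity),
        hεφ.eventually_lt_const (show (0 : ℝ) < e / 8 by positivity)] with k h1 h2 h3 h4
      have := hf _ _ h2 _ h1
      simp only [Function.comp] at h4
      linarith [dist_triangle (f (φ k) z) (f (φ k) (d n)) (xi n)]
    obtain ⟨N, hN⟩ := eventually_atTop.1 h1
    refine ⟨N, fun k hk => ?_⟩
    linarith [dist_triangle_right (f (φ k) z) (f (φ N) z) (xi n), hN k hk, hN N le_rfl]
  choose g hg using hc
  have hgL : ∀ z w, dist (g z) (g w) ≤ L * dist z w := fun z w => by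
    refine le_of_tendsto_of_tendsto ((hg z).dist (hg w))
      (g := fun k => L * dist z w + ε (φ k)) (by simpa using hεφ.const_add (L * dist z w)) ?_
    filter_upwards [hφ.tendsto_atTop.eventually (ev z), hφ.tendsto_atTop.eventually (ev w)]
      with k h1 h2 using hf _ _ h1 _ h2
  refine ⟨φ, hφ, g, ?_⟩
  rw [Metric.tendstoLocallyUniformly_iff]
  intro e he z
  refine ⟨ball z (e / 8 / (L + 1)), ball_mem_nhds _ (by positivity), ?_⟩
  filter_upwards [hφ.tendsto_atTop.eventually (hρ.eventually_gt_atTop (‖z‖ + e / 8 / (L + 1))),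
    Metric.tendsto_nhds.1 (hg z) (e / 8) (by positivity),
    hεφ.eventually_lt_const (show (0 : ℝ) < e / 8 by positivity)] with k h1 h2 h3 w hw
  have hL1 : L * dist z w ≤ e / 8 := by
    rw [mem_ball', lt_div_iff₀ (by positivity)] at hw
    nlinarith [dist_nonneg (x := z) (y := w)]
  have hz' : z ∈ ball (0 : ℂ) (ρ (φ k)) := by
    have : 0 < e / 8 / (L + 1) := by positivity
    simp; linarith
  have hw' : w ∈ ball (0 : ℂ) (ρ (φ k)) := by
    rw [mem_ball'] at hw
    have := dist_triangle_left w 0 z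
    simp only [dist_zero_right, mem_ball] at this ⊢
    linarith
  have := hf _ _ hz' _ hw'
  have h4 := hgL z w
  simp only [Function.comp] at h3
  have h5 := dist_triangle (g w) (g z) (f (φ k) w)
  have h6 := dist_triangle (g z) (f (φ k) z) (f (φ k) w)
  rw [dist_comm] at h2 h4
  linarith

lemma continuous_reL : Continuous reL := by
  unfold reL; fun_prop
lemma continuous_phL : Continuous phL := by
  unfold phL; fun_prop

lemma lim_q {u : ℕ → ℂ → ℝ} {Φ q : ℕ → ℂ → ℂ} {ui : ℂ → ℝ} {Φi : ℂ → ℂ} {c : ℂ} {r C : ℝ}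
    (hr : 0 < r)
    (hq : ∀ k, DifferentiableOn ℂ (q k) (ball c (2 * r)))
    (hu : ∀ k, ∀ z ∈ ball c (2 * r), HasFDerivAt (u k) (reL (q k z)) z)
    (hΦ : ∀ k, ∀ z ∈ ball c (2 * r), HasFDerivAt (Φ k) (phL (q k z)) z)
    (hC : ∀ k, ∀ z ∈ ball c (2 * r), |u k z| ≤ C)
    (hui : TendstoUniformlyOn u ui atTop (ball c (2 * r)))
    (hΦi : ∀ z, Tendsto (fun k => Φ k z) atTop (𝓝 (Φi z))) :
    ∃ qi : ℂ → ℂ, (∀ z ∈ ball c r, Tendsto (fun k => q k z) atTop (𝓝 (qi z))) ∧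
      DifferentiableOn ℂ qi (ball c r) ∧ (∀ z ∈ ball c r, HasFDerivAt ui (reL (qi z)) z) ∧
      (∀ z ∈ ball c r, HasFDerivAt Φi (phL (qi z)) z) := by
  have hsub : ∀ z ∈ ball c r, ball z r ⊆ ball c (2 * r) := fun z hz =>
    ball_subset_ball' (by rw [mem_ball] at hz; linarith)
  have hcau : UniformCauchySeqOn q atTop (ball c r) := by
    rw [Metric.uniformCauchySeqOn_iff]
    intro e he
    have h1 := Metric.uniformCauchySeqOn_iff.1 hui.uniformCauchySeqOn (e * r / 8) (by positivity)
    obtain ⟨N, hN⟩ := h1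
    refine ⟨N, fun m hm n hn x hx => ?_⟩
    have := grad_bd (u := fun z => u m z - u n z) (q := fun z => q m z - q n z) (c := x) (R := r)
      (M := e * r / 8) hr (((hq m).sub (hq n)).mono (hsub x hx)) (fun z hz => by
        refine ((hu m z (hsub x hx hz)).sub (hu n z (hsub x hx hz))).congr_fderiv ?_
        ext x; simp [sub_mul]) (fun z hz => (hN m hm n hn z (hsub x hx hz)).le)
    rw [dist_eq_norm]
    have h3 : ‖q m x - q n x‖ * r < e * r := by nlinarith
    exact lt_of_mul_lt_mul_right h3 hr.le
  have hpt : ∀ z : ℂ, ∃ y, z ∈ ball c r → Tendsto (fun k => q k z) atTop (𝓝 y) := fun z => by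
    by_cases hz : z ∈ ball c r
    · obtain ⟨y, hy⟩ := cauchySeq_tendsto_of_complete (hcau.cauchySeq hz)
      exact ⟨y, fun _ => hy⟩
    · exact ⟨0, fun h => absurd h hz⟩
  choose qi hqi using hpt
  have hun := hcau.tendstoUniformlyOn_of_tendsto (fun z hz => hqi z hz)
  have hbd : ∀ k, ∀ z ∈ ball c r, q k z ∈ closedBall (0 : ℂ) (4 * C / r) := by
    intro k z hz
    have h1 := hq k
    have h2 := hu k
    have h3 := hC k
    rw [mem_closedBall, dist_zero_right, le_div_iff₀ hr]
    exact grad_bd hr (h1.mono (hsub z hz)) (fun w hw => h2 w (hsub z hz hw))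
      (fun w hw => h3 w (hsub z hz hw))
  have hbdi : ∀ z ∈ ball c r, qi z ∈ closedBall (0 : ℂ) (4 * C / r) := fun z hz =>
    isClosed_closedBall.mem_of_tendsto (hqi z hz) (.of_forall fun k => hbd k z hz)
  have sb : ball c r ⊆ ball c (2 * r) := ball_subset_ball (by linarith)
  refine ⟨qi, hqi, hun.tendstoLocallyUniformlyOn.differentiableOn (.of_forall fun k => (hq k).mono sb)
    isOpen_ball, fun z hz => ?_, fun z hz => ?_⟩
  · have hU := ((isCompact_closedBall (0 : ℂ) (4 * C / r)).uniformContinuousOn_of_continuous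
      continuous_reL.continuousOn).comp_tendstoUniformlyOn_eventually (.of_forall hbd) hbdi hun
    exact hasFDerivAt_of_tendstoUniformlyOn isOpen_ball hU (fun k x hx => hu k x (sb hx))
      (fun x hx => hui.tendsto_at (sb hx)) hz
  · have hU := ((isCompact_closedBall (0 : ℂ) (4 * C / r)).uniformContinuousOn_of_continuous
      continuous_phL.continuousOn).comp_tendstoUniformlyOn_eventually (.of_forall hbd) hbdi hun
    exact hasFDerivAt_of_tendstoUniformlyOn isOpen_ball hU (fun k x hx => hΦ k x (sb hx))
      (fun x hx => hΦi x) hz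

theorem cpt {L M : ℝ} (hL : 0 ≤ L) {ε ρ : ℕ → ℝ} (hε : Tendsto ε atTop (𝓝 0))
    (hρ : Tendsto ρ atTop atTop) {u : ℕ → ℂ → ℝ} {Φ q : ℕ → ℂ → ℂ} {Z : ℕ → Set ℂ}
    (h : ∀ k, AE L (ε k) (ρ k) (u k) (Φ k) (q k) (Z k)) (hM : ∀ k, infDist 0 (Z k) ≤ M)
    (hMρ : ∀ k, M < ρ k) :
    ∃ φ : ℕ → ℕ, StrictMono φ ∧ ∃ (ui : ℂ → ℝ) (Φi qi : ℂ → ℂ) (Zi : Set ℂ),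
      (∀ r, AE L 0 r ui Φi qi Zi) ∧ TendstoLocallyUniformly (fun k => u (φ k)) ui atTop ∧
      (∀ z, Tendsto (fun k => Φ (φ k) z) atTop (𝓝 (Φi z))) ∧
      ∀ z, Tendsto (fun k => infDist z (Z (φ k))) atTop (𝓝 (infDist z Zi)) := by
  have near : ∀ k z, ∃ p ∈ Z k, infDist z (Z k) = dist z p := fun k z =>
    (h k).cl.exists_infDist_eq_dist (h k).ne z
  have hM0 : 0 ≤ M := infDist_nonneg.trans (hM 0)
  obtain ⟨B, hB⟩ := hε.bddAbove_range
  have hB' : ∀ k, ε k ≤ B := fun k => hB ⟨k, rfl⟩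
  have h0ρ : ∀ k, (0 : ℂ) ∈ ball (0 : ℂ) (ρ k) := fun k => by simpa using hM0.trans_lt (hMρ k)
  have hε0 : ∀ k, 0 ≤ ε k := fun k => by simpa using (h k).lu 0 (h0ρ k) 0 (h0ρ k)
  obtain ⟨φ, hφ, g, hg⟩ := arz (M := L * M + |B| + M) (L := max L 1) ((0, 0, 0) : ℝ × ℂ × ℝ)
    (hL.trans (le_max_left _ _)) hε hρ (fun k z => (u k z, Φ k z, infDist z (Z k)))
    (fun k z hz w hw => by
      have d0 := dist_nonneg (x := z) (y := w)
      have e0 := hε0 k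
      rw [Prod.dist_eq, Prod.dist_eq]
      refine max_le (((h k).lu z hz w hw).trans ?_) (max_le (((h k).lΦ z hz w hw).trans ?_)
        (((lipschitz_infDist_pt (Z k)).dist_le_mul z w).trans ?_))
      · gcongr; exact le_max_left _ _
      · gcongr; exact le_max_left _ _
      · have : (1 : ℝ) * dist z w ≤ max L 1 * dist z w := by gcongr; exact le_max_right _ _
        simp; linarith)
    (fun k => by
      obtain ⟨p, hp, hd⟩ := near k 0
      have hpM : dist 0 p ≤ M := hd ▸ hM k
      have hpb : p ∈ ball (0 : ℂ) (ρ k) := by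
        rw [mem_ball, dist_comm]; exact hpM.trans_lt (hMρ k)
      have h1 := (h k).lu 0 (h0ρ k) p hpb
      have h2 := (h k).lΦ 0 (h0ρ k) p hpb
      rw [(h k).zu p hp hpb] at h1
      rw [(h k).zΦ p hp hpb] at h2
      have h3 : L * dist 0 p + ε k ≤ L * M + |B| := by
        have := hB' k
        have := le_abs_self B
        gcongr; linarith
      rw [Prod.dist_eq, Prod.dist_eq]
      refine max_le (by dsimp only; linarith) (max_le (by dsimp only; linarith) ?_)
      have : 0 ≤ L * M := by positivity
      simp only [dist_zero_right, Real.norm_eq_abs, abs_of_nonneg infDist_nonneg]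
      linarith [hM k, abs_nonneg B])
  set ui : ℂ → ℝ := fun z => (g z).1
  set Φi : ℂ → ℂ := fun z => (g z).2.1
  set d : ℂ → ℝ := fun z => (g z).2.2
  have hgp : ∀ z, Tendsto (fun k => (u (φ k) z, Φ (φ k) z, infDist z (Z (φ k)))) atTop (𝓝 (g z)) :=
    fun z => (tendstoLocallyUniformlyOn_univ.2 hg).tendsto_at (mem_univ z)
  have tΦ : ∀ z, Tendsto (fun k => Φ (φ k) z) atTop (𝓝 (Φi z)) := fun z => (hgp z).snd_nhds.fst_nhds
  have td : ∀ z, Tendsto (fun k => infDist z (Z (φ k))) atTop (𝓝 (d z)) :=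
    fun z => (hgp z).snd_nhds.snd_nhds
  have tu : ∀ z, Tendsto (fun k => u (φ k) z) atTop (𝓝 (ui z)) := fun z => (hgp z).fst_nhds
  have tul : TendstoLocallyUniformly (fun k => u (φ k)) ui atTop := by
    rw [Metric.tendstoLocallyUniformly_iff] at hg ⊢
    intro e he z
    obtain ⟨t, ht, h1⟩ := hg e he z
    refine ⟨t, ht, h1.mono fun k hk y hy => lt_of_le_of_lt ?_ (hk y hy)⟩
    rw [Prod.dist_eq]; exact le_max_left _ _
  have hεφ := hε.comp hφ.tendsto_atTop
  have hρφ := hρ.comp hφ.tendsto_atTop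
  have ev : ∀ z : ℂ, ∀ᶠ k in atTop, z ∈ ball (0 : ℂ) (ρ (φ k)) := fun z => by
    filter_upwards [hρφ.eventually_gt_atTop ‖z‖] with k hk using by simpa using hk
  have dL : ∀ z w, d z ≤ d w + dist z w := fun z w =>
    le_of_tendsto_of_tendsto' (td z) ((td w).add_const _) fun k => infDist_le_infDist_add_dist
  -- convergent points of Z k
  have clus : ∀ p : ℕ → ℂ, ∀ C, (∀ k, p k ∈ Z (φ k)) → (∀ k, dist (p k) 0 ≤ C) →
      ∃ ψ : ℕ → ℕ, StrictMono ψ ∧ ∃ a, d a = 0 ∧ Tendsto (p ∘ ψ) atTop (𝓝 a) := by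
    intro p C hp hC
    obtain ⟨a, -, ψ, hψ, ha⟩ := (isCompact_closedBall (0 : ℂ) C).tendsto_subseq hC
    refine ⟨ψ, hψ, a, tendsto_nhds_unique ((td a).comp hψ.tendsto_atTop) ?_, ha⟩
    refine squeeze_zero (fun k => infDist_nonneg) (fun k => infDist_le_dist_of_mem (hp (ψ k))) ?_
    simpa using (tendsto_const_nhds (x := a)).dist ha
  choose np hnp hnd using near
  have npb : ∀ z, ∃ C, ∀ k, dist (np (φ k) z) 0 ≤ C := fun z => by
    obtain ⟨C, hC⟩ := (td z).bddAbove_range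
    refine ⟨C + dist z 0, fun k => ?_⟩
    have := hC ⟨k, rfl⟩
    simp only [hnd] at this
    linarith [dist_triangle_left (np (φ k) z) 0 z]
  have nearest : ∀ z, ∃ a, d a = 0 ∧ dist z a = d z := fun z => by
    obtain ⟨C, hC⟩ := npb z
    obtain ⟨ψ, hψ, a, ha, hla⟩ := clus (fun k => np (φ k) z) C (fun k => hnp _ _) hC
    refine ⟨a, ha, tendsto_nhds_unique (tendsto_const_nhds.dist hla) ?_⟩
    exact ((td z).comp hψ.tendsto_atTop).congr fun k => hnd _ _
  set Zi : Set ℂ := {z | d z = 0}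
  have dc : Continuous d := by
    refine LipschitzWith.continuous (K := 1) (LipschitzWith.of_le_add fun z w => dL z w)
  have hdi : ∀ z, infDist z Zi = d z := fun z => by
    obtain ⟨a, ha, hza⟩ := nearest z
    refine le_antisymm (hza ▸ infDist_le_dist_of_mem ha) ((le_infDist ⟨a, ha⟩).2 fun w hw => ?_)
    have := dL z w
    rw [show d w = 0 from hw] at this; simpa using this
  -- approximating points
  have app : ∀ z ∈ Zi, Tendsto (fun k => np (φ k) z) atTop (𝓝 z) := fun z hz => by
    rw [tendsto_iff_dist_tendsto_zero]
    have := td z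
    rw [show d z = 0 from hz] at this
    exact this.congr fun k => by rw [hnd, dist_comm]
  have zer : ∀ {E : Type} [NormedAddCommGroup E] (f : ℕ → ℂ → E) (fi : ℂ → E),
      (∀ z, Tendsto (fun k => f (φ k) z) atTop (𝓝 (fi z))) →
      (∀ k, ∀ z ∈ Z k, z ∈ ball (0 : ℂ) (ρ k) → f k z = 0) →
      (∀ k, ∀ z ∈ ball (0 : ℂ) (ρ k), ∀ w ∈ ball (0 : ℂ) (ρ k),
        dist (f k z) (f k w) ≤ L * dist z w + ε k) → ∀ z ∈ Zi, fi z = 0 := by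
    intro E _ f fi hf hz hl z hzi
    refine tendsto_nhds_unique (hf z) (squeeze_zero_norm'
      (a := fun k => L * dist z (np (φ k) z) + ε (φ k)) ?_ ?_)
    · filter_upwards [ev z, hρφ.eventually_gt_atTop (‖z‖ + 1),
        (app z hzi).eventually (ball_mem_nhds z one_pos)] with k h1 h2 h3
      have hb : np (φ k) z ∈ ball (0 : ℂ) (ρ (φ k)) := by
        rw [mem_ball]
        simp only [Function.comp] at h2
        have := dist_triangle (np (φ k) z) z 0
        rw [dist_zero_right z] at this
        linarith
      have := hl _ z h1 _ hb
      rwa [hz _ _ (hnp _ _) hb, dist_zero_right] at this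
    · simpa using ((tendsto_const_nhds (x := z).dist (app z hzi)).const_mul L).add hεφ
  have lipL : ∀ {E : Type} [NormedAddCommGroup E] (f : ℕ → ℂ → E) (fi : ℂ → E),
      (∀ z, Tendsto (fun k => f (φ k) z) atTop (𝓝 (fi z))) →
      (∀ k, ∀ z ∈ ball (0 : ℂ) (ρ k), ∀ w ∈ ball (0 : ℂ) (ρ k),
        dist (f k z) (f k w) ≤ L * dist z w + ε k) → ∀ z w, dist (fi z) (fi w) ≤ L * dist z w + 0 := by
    intro E _ f fi hf hl z w
    refine le_of_tendsto_of_tendsto ((hf z).dist (hf w)) (hεφ.const_add _) ?_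
    filter_upwards [ev z, ev w] with k h1 h2 using hl _ z h1 w h2
  -- derivative part
  have der : ∀ z, ∃ y : ℂ, z ∉ Zi → ∃ r > 0, ∃ qi : ℂ → ℂ, qi z = y ∧
      (∀ w ∈ ball z r, Tendsto (fun k => q (φ k) w) atTop (𝓝 (qi w))) ∧
      DifferentiableOn ℂ qi (ball z r) ∧ HasFDerivAt ui (reL y) z ∧ HasFDerivAt Φi (phL y) z := by
    intro z
    by_cases hz : z ∈ Zi
    · exact ⟨0, fun h => absurd hz h⟩
    have hdz : 0 < d z := lt_of_le_of_ne (hdi z ▸ infDist_nonneg) (Ne.symm hz)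
    set r := d z / 8
    have hr : 0 < r := by positivity
    obtain ⟨C, hC⟩ := (tu z).abs.bddAbove_range
    have good : ∀ᶠ k in atTop, ∀ w ∈ ball z (2 * r), w ∈ ball (0 : ℂ) (ρ (φ k)) ∧ w ∉ Z (φ k) := by
      filter_upwards [hρφ.eventually_gt_atTop (‖z‖ + 2 * r),
        (td z).eventually_const_lt (show 2 * r < d z by simp only [r]; linarith)] with k h1 h2 w hw
      rw [mem_ball] at hw
      refine ⟨?_, fun hwZ => ?_⟩
      · have := dist_triangle w z 0
        rw [dist_zero_right z] at this
        simp only [Function.comp] at h1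
        rw [mem_ball]; linarith
      · have := infDist_le_dist_of_mem (x := z) hwZ
        rw [dist_comm] at this; linarith
    obtain ⟨N, good⟩ := eventually_atTop.1 good
    have hunif : TendstoUniformlyOn (fun k => u (φ k)) ui atTop (ball z (2 * r)) :=
      ((tendstoLocallyUniformlyOn_iff_forall_isCompact isOpen_univ).1
        (tendstoLocallyUniformlyOn_univ.2 tul) _ (subset_univ _)
        (isCompact_closedBall z (2 * r))).mono ball_subset_closedBall
    obtain ⟨qi, h1, h2, h3, h4⟩ := lim_q (q := fun k => q (φ (k + N))) (Φ := fun k => Φ (φ (k + N)))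
      (u := fun k => u (φ (k + N)))
      (C := C + L * (2 * r) + |B|) hr
      (fun k => (h _).hq.mono fun w hw => good (k + N) (by omega) w hw)
      (fun k w hw => have hk := good (k + N) (by omega) w hw; (h _).du w hk.1 hk.2)
      (fun k w hw => have hk := good (k + N) (by omega) w hw; (h _).dΦ w hk.1 hk.2)
      (fun k w hw => by
        have hk := good (k + N) (by omega)
        have h1 := (h (φ (k + N))).lu w (hk w hw).1 z (hk z (mem_ball_self (by positivity))).1
        have h2 : |u (φ (k + N)) z| ≤ C := hC ⟨k + N, rfl⟩
        have h3 : L * dist w z ≤ L * (2 * r) := by gcongr; exact (mem_ball.1 hw).le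
        have := abs_sub_abs_le_abs_sub (u (φ (k + N)) w) (u (φ (k + N)) z)
        rw [Real.dist_eq] at h1
        linarith [hB' (φ (k + N)), le_abs_self B])
      (fun v hv => (tendsto_add_atTop_nat N).eventually (hunif v hv))
      (fun z => (tΦ z).comp (tendsto_add_atTop_nat N))
    exact ⟨qi z, fun _ => ⟨r, hr, qi, rfl,
      fun w hw => (tendsto_add_atTop_iff_nat N).1 (h1 w hw), h2, h3 z (mem_ball_self hr), h4 z (mem_ball_self hr)⟩⟩
  choose qi hqi using der
  refine ⟨φ, hφ, ui, Φi, qi, Zi, fun R => ?_, tul, tΦ, fun z => by rw [hdi]; exact td z⟩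
  have hop : IsOpen Ziᶜ := by
    have : IsClosed Zi := isClosed_eq dc continuous_const
    exact this.isOpen_compl
  refine ⟨isClosed_eq dc continuous_const, ?_, ?_, fun z _ => ?_, fun z hz _ => zer u ui tu
    (fun k => (h k).zu) (fun k => (h k).lu) z hz, fun z hz _ => zer Φ Φi tΦ
    (fun k => (h k).zΦ) (fun k => (h k).lΦ) z hz, fun z _ w _ => lipL u ui tu (fun k => (h k).lu) z w,
    fun z _ w _ => lipL Φ Φi tΦ (fun k => (h k).lΦ) z w, ?_, fun z _ hz => ?_, fun z _ hz => ?_⟩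
  · obtain ⟨a, ha, -⟩ := nearest 0; exact ⟨a, ha⟩
  · intro z hz r hr _
    obtain ⟨C, hC⟩ := npb z
    have hw : ∀ k, ∃ w ∈ Z (φ k), dist w 0 ≤ C + r ∧ (‖np (φ k) z‖ + r < ρ (φ k) →
        ‖w - np (φ k) z‖ = r) := fun k => by
      by_cases hk : ‖np (φ k) z‖ + r < ρ (φ k)
      · obtain ⟨w, hw, hwr⟩ := (h (φ k)).circ _ (hnp _ _) r hr hk
        refine ⟨w, hw, ?_, fun _ => hwr⟩
        rw [← dist_eq_norm] at hwr
        linarith [dist_triangle w (np (φ k) z) 0, hC k]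
      · exact ⟨_, hnp _ z, by linarith [hC k], fun h => absurd h hk⟩
    choose w hw1 hw2 hw3 using hw
    obtain ⟨ψ, hψ, a, ha, hla⟩ := clus w _ hw1 hw2
    refine ⟨a, ha, ?_⟩
    refine tendsto_nhds_unique (hla.sub ((app z hz).comp hψ.tendsto_atTop)).norm
      (tendsto_const_nhds.congr' ?_)
    have h5 : ∀ᶠ k in atTop, ‖np (φ k) z‖ + r < ρ (φ k) := by
      filter_upwards [hρφ.eventually_gt_atTop (C + r)] with k hk
      have := hC k
      rw [dist_zero_right] at this
      simp only [Function.comp] at hk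
      linarith
    filter_upwards [hψ.tendsto_atTop.eventually h5] with k hk using (hw3 _ hk).symm
  · refine ge_of_tendsto (tu z) ?_
    filter_upwards [ev z] with k hk using (h (φ k)).nn z hk
  · intro z hz
    obtain ⟨r, hr, q', h1, h2, h3, -⟩ := hqi z hz.2
    refine ((h3.differentiableAt (ball_mem_nhds z hr)).congr_of_eventuallyEq ?_).differentiableWithinAt
    filter_upwards [ball_mem_nhds z hr, hop.mem_nhds hz.2] with w hw hw2
    obtain ⟨r', hr', q'', h1', h2', -⟩ := hqi w hw2
    rw [← h1']
    exact tendsto_nhds_unique (h2' w (mem_ball_self hr')) (h2 w hw)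
  · obtain ⟨r, hr, q', h1, h2, h3, h4, -⟩ := hqi z hz
    exact h4
  · obtain ⟨r, hr, q', h1, h2, h3, -, h4⟩ := hqi z hz
    exact h4

def Cl (L : ℝ) (u : ℂ → ℝ) (Φ q : ℂ → ℂ) (Z : Set ℂ) : Prop := ∀ ρ, AE L 0 ρ u Φ q Z

section
variable {L : ℝ} {u : ℂ → ℝ} {Φ q : ℂ → ℂ} {Z : Set ℂ}

lemma mb (z : ℂ) : z ∈ ball (0 : ℂ) (‖z‖ + 1) := by simp

namespace Cl
lemma cl (h : Cl L u Φ q Z) : IsClosed Z := (h 0).cl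
lemma op (h : Cl L u Φ q Z) : IsOpen Zᶜ := h.cl.isOpen_compl
lemma ne (h : Cl L u Φ q Z) : Z.Nonempty := (h 0).ne
lemma nn (h : Cl L u Φ q Z) (z) : 0 ≤ u z := (h _).nn z (mb z)
lemma zu (h : Cl L u Φ q Z) {z} (hz : z ∈ Z) : u z = 0 := (h _).zu z hz (mb z)
lemma zΦ (h : Cl L u Φ q Z) {z} (hz : z ∈ Z) : Φ z = 0 := (h _).zΦ z hz (mb z)
lemma du (h : Cl L u Φ q Z) {z} (hz : z ∉ Z) : HasFDerivAt u (reL (q z)) z := (h _).du z (mb z) hz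
lemma dΦ (h : Cl L u Φ q Z) {z} (hz : z ∉ Z) : HasFDerivAt Φ (phL (q z)) z := (h _).dΦ z (mb z) hz
lemma hq (h : Cl L u Φ q Z) : DifferentiableOn ℂ q Zᶜ := fun z hz => by
  exact ((h (‖z‖ + 1)).hq.differentiableAt
    ((isOpen_ball.sdiff h.cl).mem_nhds ⟨mb z, hz⟩)).differentiableWithinAt
lemma circ (h : Cl L u Φ q Z) {z} (hz : z ∈ Z) {r} (hr : 0 < r) : ∃ w ∈ Z, ‖w - z‖ = r :=
  (h (‖z‖ + r + 1)).circ z hz r hr (by linarith)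
lemma lu (h : Cl L u Φ q Z) (z w) : dist (u z) (u w) ≤ L * dist z w := by
  have := (h (max ‖z‖ ‖w‖ + 1)).lu z (by simp [Int.lt_add_one_iff, lt_add_of_le_of_pos])
    w (by simp [lt_add_of_le_of_pos])
  linarith
lemma lΦ (h : Cl L u Φ q Z) (z w) : dist (Φ z) (Φ w) ≤ L * dist z w := by
  have := (h (max ‖z‖ ‖w‖ + 1)).lΦ z (by simp [lt_add_of_le_of_pos])
    w (by simp [lt_add_of_le_of_pos])
  linarith
lemma cu (h : Cl L u Φ q Z) : Continuous u :=
  LipschitzWith.continuous (K := L.toNNReal) (LipschitzWith.of_dist_le_mul fun z w =>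
    (h.lu z w).trans (by gcongr; exact Real.le_coe_toNNReal L))
lemma cΦ (h : Cl L u Φ q Z) : Continuous Φ :=
  LipschitzWith.continuous (K := L.toNNReal) (LipschitzWith.of_dist_le_mul fun z w =>
    (h.lΦ z w).trans (by gcongr; exact Real.le_coe_toNNReal L))
lemma pos (h : Cl L u Φ q Z) {z} (hz : z ∉ Z) : 0 < infDist z Z :=
  (h.cl.notMem_iff_infDist_pos h.ne).1 hz
lemma ball_sub (h : Cl L u Φ q Z) (z) : ball z (infDist z Z) ⊆ Zᶜ := fun w hw hwZ => by
  have := infDist_le_dist_of_mem (x := z) hwZ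
  rw [mem_ball'] at hw; linarith
lemma ud (h : Cl L u Φ q Z) (z) : u z ≤ L * infDist z Z := by
  obtain ⟨p, hp, hd⟩ := h.cl.exists_infDist_eq_dist h.ne z
  have := h.lu z p
  rw [h.zu hp, Real.dist_eq, sub_zero] at this
  rw [hd]; exact (le_abs_self _).trans this
lemma Φd (h : Cl L u Φ q Z) (z) : ‖Φ z‖ ≤ L * infDist z Z := by
  obtain ⟨p, hp, hd⟩ := h.cl.exists_infDist_eq_dist h.ne z
  have := h.lΦ z p
  rw [h.zΦ hp, dist_zero_right] at this
  rw [hd]; exact this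

lemma scale (h : Cl L u Φ q Z) (z0 : ℂ) {s : ℝ} (hs : 0 < s) :
    Cl L (fun z => u (z0 + s * z) / s) (fun z => Φ (z0 + s * z) / s) (fun z => q (z0 + s * z))
      {z | z0 + s * z ∈ Z} := by
  have hsc : (s : ℂ) ≠ 0 := by exact_mod_cast hs.ne'
  have hl : ∀ z : ℂ, HasFDerivAt (fun z : ℂ => z0 + s * z) (s • ContinuousLinearMap.id ℝ ℂ) z :=
    fun z => by
      refine (((hasFDerivAt_id (𝕜 := ℝ) z).const_smul s).const_add z0).congr_of_eventuallyEq
        (.of_forall fun z => by simp)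
  have hdist : ∀ z w : ℂ, dist (z0 + s * z) (z0 + s * w) = s * dist z w := fun z w => by
    rw [dist_add_left, dist_eq_norm, ← mul_sub, norm_mul, dist_eq_norm]; simp [abs_of_pos hs]
  intro ρ
  refine ⟨h.cl.preimage (by fun_prop), ?_, fun z hz r hr _ => ?_, fun z _ => div_nonneg (h.nn _) hs.le,
    fun z hz _ => by simp [h.zu hz], fun z hz _ => by simp [h.zΦ hz], fun z _ w _ => ?_,
    fun z _ w _ => ?_, ?_, fun z _ hz => ?_, fun z _ hz => ?_⟩
  · obtain ⟨p, hp⟩ := h.ne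
    exact ⟨(p - z0) / s, by simp only [mem_setOf_eq]; rwa [mul_div_cancel₀ _ hsc, add_sub_cancel]⟩
  · obtain ⟨w, hw, hwr⟩ := h.circ hz (mul_pos hs hr)
    refine ⟨(w - z0) / s, by simp only [mem_setOf_eq]; rwa [mul_div_cancel₀ _ hsc, add_sub_cancel], ?_⟩
    have : (w - z0) / s - z = (w - (z0 + s * z)) / s := by field_simp; ring
    rw [this, norm_div, hwr]; simp [abs_of_pos hs]; field_simp
  · have := h.lu (z0 + s * z) (z0 + s * w)
    rw [hdist, Real.dist_eq] at this
    rw [Real.dist_eq, ← sub_div, abs_div, abs_of_pos hs, div_le_iff₀ hs]; linarith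
  · have := h.lΦ (z0 + s * z) (z0 + s * w)
    rw [hdist, dist_eq_norm] at this
    rw [dist_eq_norm, ← sub_div, norm_div, norm_real, Real.norm_eq_abs, abs_of_pos hs, div_le_iff₀ hs]
    linarith
  · refine h.hq.comp (fun z _ => by fun_prop) (fun z hz => hz.2)
  · have := ((h.du hz).comp z (hl z)).const_smul s⁻¹
    refine (this.congr_fderiv ?_).congr_of_eventuallyEq (.of_forall fun z => by
      simp [div_eq_inv_mul])
    ext x; simp; field_simp
  · have := ((h.dΦ hz).comp z (hl z)).const_smul s⁻¹
    refine (this.congr_fderiv ?_).congr_of_eventuallyEq (.of_forall fun z => by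
      simp [div_eq_inv_mul])
    ext x; simp; field_simp

lemma scale_d (h : Cl L u Φ q Z) {z0 : ℂ} (hz : z0 ∉ Z) :
    infDist 0 {z | z0 + (infDist z0 Z : ℝ) * z ∈ Z} = 1 := by
  have hs := h.pos hz
  have h' := h.scale z0 hs
  set s := infDist z0 Z with hsd
  have hsc : (s : ℂ) ≠ 0 := by exact_mod_cast hs.ne'
  obtain ⟨p, hp, hd⟩ := h.cl.exists_infDist_eq_dist h.ne z0
  refine le_antisymm ?_ ((le_infDist h'.ne).2 fun w hw => ?_)
  · have : (p - z0) / s ∈ {z : ℂ | z0 + s * z ∈ Z} := by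
      simp only [mem_setOf_eq]; rwa [mul_div_cancel₀ _ hsc, add_sub_cancel]
    refine (infDist_le_dist_of_mem this).trans ?_
    rw [dist_zero_left, norm_div, ← dist_eq_norm, dist_comm, ← hd, ← hsd]
    simp [abs_of_pos hs, hs.ne']
  · have := infDist_le_dist_of_mem (x := z0) (s := Z) (y := z0 + s * w) hw
    rw [dist_self_add_right, norm_mul, ← hsd, norm_real, Real.norm_eq_abs, abs_of_pos hs] at this
    rw [dist_zero_left]
    by_contra! hlt
    nlinarith

end Cl

lemma extr (hL : 0 ≤ L) {u : ℕ → ℂ → ℝ} {Φ q : ℕ → ℂ → ℂ} {Z : ℕ → Set ℂ}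
    (h : ∀ k, Cl L (u k) (Φ k) (q k) (Z k)) (z : ℕ → ℂ) (hz : ∀ k, z k ∉ Z k) :
    ∃ φ : ℕ → ℕ, StrictMono φ ∧ ∃ (ui : ℂ → ℝ) (Φi qi : ℂ → ℂ) (Zi : Set ℂ), Cl L ui Φi qi Zi ∧
      infDist 0 Zi = 1 ∧
      Tendsto (fun k => u (φ k) (z (φ k)) / infDist (z (φ k)) (Z (φ k))) atTop (𝓝 (ui 0)) ∧
      Tendsto (fun k => Φ (φ k) (z (φ k)) / (infDist (z (φ k)) (Z (φ k)) : ℝ)) atTop (𝓝 (Φi 0)) := by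
  have hsc := fun k => (h k).scale (z k) ((h k).pos (hz k))
  obtain ⟨φ, hφ, ui, Φi, qi, Zi, h1, h2, h3, h4⟩ := cpt (M := 1) hL tendsto_const_nhds
    (ρ := fun k => (k : ℝ) + 2) (tendsto_natCast_atTop_atTop.atTop_add tendsto_const_nhds)
    (fun k => hsc k ((k : ℝ) + 2)) (fun k => ((h k).scale_d (hz k)).le) (fun k => by
      have : (0 : ℝ) ≤ k := k.cast_nonneg
      linarith)
  refine ⟨φ, hφ, ui, Φi, qi, Zi, h1, tendsto_nhds_unique (h4 0) ?_, ?_, ?_⟩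
  · exact tendsto_const_nhds.congr fun k => ((h _).scale_d (hz _)).symm
  · simpa using (tendstoLocallyUniformlyOn_univ.2 h2).tendsto_at (mem_univ 0)
  · simpa using h3 0

lemma comp_front {U : Set ℂ} (hU : IsOpen U) {z x : ℂ} (hx : x ∈ frontier (connectedComponentIn U z)) :
    x ∉ U := by
  intro hxU
  obtain ⟨r, hr, hb⟩ := Metric.isOpen_iff.1 hU x hxU
  have hop := hU.connectedComponentIn (x := z)
  rw [hop.frontier_eq] at hx
  obtain ⟨y, hy, hyb⟩ := Metric.mem_closure_iff.1 hx.1 r hr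
  refine hx.2 ?_
  have h1 : y ∈ ball x r := by rwa [mem_ball']
  rw [connectedComponentIn_eq hy]
  exact (convex_ball x r).isPreconnected.subset_connectedComponentIn h1 hb (mem_ball_self hr)
end

section
variable {L : ℝ} {u : ℂ → ℝ} {Φ q : ℂ → ℂ} {Z : Set ℂ}

lemma sub_of_front {V S : Set ℂ} (hV : IsOpen V) (hS : IsPreconnected S) (hne : (S ∩ V).Nonempty)
    (hf : ∀ x ∈ frontier V, x ∉ S) : S ⊆ V := by
  refine hS.subset_left_of_subset_union hV isClosed_closure.isOpen_compl
    (disjoint_left.2 fun x hx hx' => hx' (subset_closure hx)) (fun x hx => ?_) hne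
  by_contra hc
  simp only [mem_union, mem_compl_iff, not_or, not_not] at hc
  exact hf x (by rw [hV.frontier_eq]; exact ⟨hc.2, hc.1⟩) hx

lemma Cl.id (h : Cl L u Φ q Z) {z0 : ℂ} (hz : z0 ∉ Z) {a : ℂ} (ha : ∀ᶠ z in 𝓝 z0, q z = a) :
    ∀ z ∈ connectedComponentIn Zᶜ z0, q z = a := by
  have hV := h.op.connectedComponentIn (x := z0)
  have hs := connectedComponentIn_subset Zᶜ z0
  have := (((h.hq.mono hs).analyticOnNhd hV)).eqOn_of_preconnected_of_eventuallyEq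
    (g := fun _ => a) analyticOnNhd_const isPreconnected_connectedComponentIn
    (mem_connectedComponentIn hz) ha
  exact this

lemma Cl.zero_case (h : Cl L u Φ q Z) {z0 : ℂ} (hz : z0 ∉ Z) (hu : u z0 = 0) : False := by
  have hd := h.pos hz
  have hb := h.ball_sub z0
  have h1 : ∀ z ∈ ball z0 (infDist z0 Z), u z = 0 := fun z hzb => by
    have := ((harnack hd (h.hq.mono hb) (fun z hz => h.du (hb hz)) (fun z _ => h.nn z)).1 z hzb).2
    rw [hu, mul_zero] at this
    rw [mem_ball, dist_eq_norm] at hzb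
    have h3 := h.nn z
    nlinarith
  have h2 : ∀ᶠ z in 𝓝 z0, q z = 0 := by
    filter_upwards [ball_mem_nhds z0 hd] with z hzb
    have hzZ := hb hzb
    have hb' := h.ball_sub z
    have := (harnack (h.pos hzZ) (h.hq.mono hb') (fun z hz => h.du (hb' hz)) (fun z _ => h.nn z)).2
    rw [h1 z hzb] at this
    have h4 := h.pos hzZ
    have : ‖q z‖ ≤ 0 := by nlinarith [norm_nonneg (q z)]
    simpa using this
  have h3 := h.id hz h2
  set V := connectedComponentIn Zᶜ z0
  have hV : IsOpen V := h.op.connectedComponentIn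
  have hs : V ⊆ Zᶜ := connectedComponentIn_subset Zᶜ z0
  have hzV : z0 ∈ V := mem_connectedComponentIn hz
  have hd4 : ∀ z ∈ V, HasFDerivAt (fun z => Φ z - conj z) (0 : ℂ →L[ℝ] ℂ) z := fun z hzv => by
    have := (h.dΦ (hs hzv)).sub (conjCLE : ℂ →L[ℝ] ℂ).hasFDerivAt
    refine this.congr_fderiv ?_
    ext x; simp [h3 z hzv]
  have h5 : ∀ z ∈ V, Φ z - conj z = Φ z0 - conj z0 := fun z hzv =>
    hV.is_const_of_fderiv_eq_zero (𝕜 := ℝ) isPreconnected_connectedComponentIn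
      (fun z hzv => (hd4 z hzv).differentiableAt.differentiableWithinAt)
      (fun z hzv => (hd4 z hzv).fderiv) hzv hzV
  have h6 : ∀ x ∈ frontier V, x ∈ Z ∧ - conj x = Φ z0 - conj z0 := fun x hx => by
    have hxZ : x ∈ Z := not_not.1 (comp_front h.op hx)
    refine ⟨hxZ, ?_⟩
    have hc : IsClosed {z | Φ z - conj z = Φ z0 - conj z0} :=
      isClosed_eq (h.cΦ.sub continuous_conj) continuous_const
    have : x ∈ {z | Φ z - conj z = Φ z0 - conj z0} :=
      hc.closure_subset_iff.2 h5 (frontier_subset_closure hx)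
    have h7 : Φ x - conj x = Φ z0 - conj z0 := this
    rwa [h.zΦ hxZ, zero_sub] at h7
  obtain ⟨p, hp⟩ : (frontier V).Nonempty := nonempty_frontier_iff.2 ⟨⟨z0, hzV⟩, fun hh => by
    obtain ⟨x, hx⟩ := h.ne
    exact hs (hh ▸ mem_univ x) hx⟩
  have hpZ := (h6 p hp).1
  have hsub := sub_of_front hV (isConnected_compl_singleton_of_one_lt_rank
    (by simp) p).isPreconnected
    ⟨z0, fun (hh : z0 = p) => hz (hh ▸ hpZ), hzV⟩ (fun x hx => by
      have h7 := (h6 x hx).2.trans (h6 p hp).2.symm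
      simp only [neg_inj] at h7
      simpa using (starRingEnd ℂ).injective h7)
  obtain ⟨w, hw, hwp⟩ := h.circ hpZ one_pos
  exact hs (hsub (show w ≠ p by rintro rfl; simp at hwp)) hw

lemma c3 (hL : 0 ≤ L) : ∃ c > 0, ∀ (u : ℂ → ℝ) (Φ q : ℂ → ℂ) (Z : Set ℂ), Cl L u Φ q Z →
    ∀ z, c * infDist z Z ≤ u z := by
  by_contra! hc
  choose u Φ q Z h z hlt using fun n : ℕ => hc (1 / ((n : ℝ) + 1)) (by positivity)
  have hz : ∀ n, z n ∉ Z n := fun n hn => by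
    have := hlt n
    rw [(h n).zu hn, infDist_zero_of_mem hn, mul_zero] at this
    exact lt_irrefl _ this
  obtain ⟨φ, hφ, ui, Φi, qi, Zi, hi, hd, hu, -⟩ := extr hL h z hz
  refine hi.zero_case (z0 := 0) (fun h0 => by simp [infDist_zero_of_mem h0] at hd) ?_
  refine le_antisymm ?_ (hi.nn 0)
  refine le_of_tendsto_of_tendsto hu
    (tendsto_one_div_add_atTop_nhds_zero_nat.comp hφ.tendsto_atTop) (.of_forall fun n => ?_)
  have := (h (φ n)).pos (hz (φ n))
  simp only [Function.comp]
  rw [div_le_iff₀ this]; exact (hlt _).le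

lemma Cl.eqq (h : Cl L u Φ q Z) {S : ℝ} (hS : 0 < S) (hle : ∀ z, ‖Φ z‖ ≤ 2 * S * u z) {z1 : ℂ}
    (hz : z1 ∉ Z) (heq : ‖Φ z1‖ = 2 * S * u z1) :
    S = 1 ∧ ∃ a : ℂ, ‖a‖ = 1 ∧ ∀ z ∈ ball z1 (infDist z1 Z), q z = a := by
  have hu1 : 0 < u z1 := lt_of_le_of_ne (h.nn z1) fun h0 => h.zero_case hz h0.symm
  have hΦ : 0 < ‖Φ z1‖ := by rw [heq]; positivity
  have hd := h.pos hz
  have hb := h.ball_sub z1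
  set c : ℂ := Φ z1 / ‖Φ z1‖ with hc
  have hcn : ‖c‖ = 1 := by rw [hc, norm_div]; simp [hΦ.ne']
  have hcc : conj c * c = 1 := by
    rw [← Complex.normSq_eq_conj_mul_self, Complex.normSq_eq_norm_sq, hcn]; simp
  have hc1 : conj c * Φ z1 = ‖Φ z1‖ := by
    have : Φ z1 = c * ‖Φ z1‖ := by
      rw [hc, div_mul_cancel₀]; exact_mod_cast hΦ.ne'
    rw [this, ← mul_assoc, hcc, one_mul]; simp [hcn]
  have hw : ∀ z ∉ Z, HasFDerivAt (fun z => 2 * S * u z - (conj c * Φ z).re)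
      (reL (2 * S * q z - conj c * q z ^ 2 - c)) z := fun z hz => by
    have h1 := (h.du hz).const_mul (2 * S)
    have h2 := Complex.reCLM.hasFDerivAt.comp z ((h.dΦ hz).const_mul (conj c))
    refine (h1.sub h2).congr_fderiv ?_
    ext x; simp [pow_two]; ring
  have hwn : ∀ z, (conj c * Φ z).re ≤ ‖Φ z‖ := fun z => by
    refine (Complex.re_le_norm _).trans ?_
    rw [norm_mul, Complex.norm_conj, hcn, one_mul]
  have hdq := h.hq.mono hb
  have hw0 : ∀ z ∈ ball z1 (infDist z1 Z), 2 * S * u z - (conj c * Φ z).re = 0 := fun z hzb => by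
    have := ((harnack hd (q := fun z => 2 * S * q z - conj c * q z ^ 2 - c) (by fun_prop)
      (fun z hz => hw z (hb hz)) (fun z _ => by linarith [hle z, hwn z])).1 z hzb).2
    rw [hc1, heq, ofReal_re, sub_self, mul_zero] at this
    rw [mem_ball, dist_eq_norm] at hzb
    have h3 : 0 ≤ 2 * S * u z - (conj c * Φ z).re := by linarith [hle z, hwn z]
    nlinarith
  have hΦu : ∀ z ∈ ball z1 (infDist z1 Z), Φ z = 2 * S * c * u z := fun z hzb => by
    have h1 := hw0 z hzb
    have h2 : (conj c * Φ z).re = ‖conj c * Φ z‖ := by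
      rw [norm_mul, Complex.norm_conj, hcn, one_mul]; linarith [hle z, hwn z]
    have h3 : conj c * Φ z = ((2 * S * u z : ℝ) : ℂ) := by
      have := (Complex.re_eq_norm).1 h2
      rw [Complex.le_def] at this
      apply Complex.ext
      · rw [ofReal_re]; linarith
      · rw [ofReal_im, ← this.2]; simp
    calc Φ z = c * (conj c * Φ z) := by rw [← mul_assoc, mul_comm c, hcc, one_mul]
      _ = _ := by rw [h3]; push_cast; ring
  have key : ∀ z ∈ ball z1 (infDist z1 Z), S = 1 ∧ q z = c := fun z hzb => by
    have h1 : HasFDerivAt Φ (phL (q z)) z := h.dΦ (hb hzb)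
    have h2 : HasFDerivAt (fun z => 2 * S * c * (u z : ℂ))
        ((2 * S * c) • (ofRealCLM.comp (reL (q z)))) z :=
      (ofRealCLM.hasFDerivAt.comp z (h.du (hb hzb))).const_mul _
    have h3 : HasFDerivAt Φ ((2 * S * c) • (ofRealCLM.comp (reL (q z)))) z :=
      h2.congr_of_eventuallyEq (by
        filter_upwards [isOpen_ball.mem_nhds hzb] with w hwb using hΦu w hwb)
    have h4 := h1.unique h3
    have e1 := DFunLike.congr_fun h4 1
    have eI := DFunLike.congr_fun h4 I
    simp at e1 eI
    have hre : (((q z).re : ℂ)) + (q z).im * I = q z := re_add_im _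
    have hcj : (((q z).re : ℂ)) - (q z).im * I = conj (q z) := by
      apply Complex.ext <;> simp
    have e3 : 1 = S * c * conj (q z) := by
      rw [← hcj]
      linear_combination e1 / 2 + I / 2 * eI + (-q z ^ 2 / 2 + 1 / 2) * I_sq
    have e2 : q z ^ 2 = S * c * q z := by
      nth_rewrite 2 [← hre]
      linear_combination e1 / 2 - I / 2 * eI - (-q z ^ 2 / 2 + 1 / 2) * I_sq
    have hq0 : q z ≠ 0 := by
      intro h0; rw [h0] at e3; simp at e3
    have e4 : q z = S * c := by
      apply mul_right_cancel₀ hq0; rw [← e2]; ring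
    have e5 : (1 : ℂ) = ((S ^ 2 : ℝ) : ℂ) := by
      rw [e4] at e3; simp at e3; push_cast
      linear_combination e3 + S ^ 2 * hcc
    have e6 : S = 1 := by
      have : 1 = S ^ 2 := by exact_mod_cast e5
      nlinarith
    exact ⟨e6, by rw [e4, e6]; simp⟩
  exact ⟨(key z1 (mem_ball_self hd)).1, c, hcn, fun z hz => (key z hz).2⟩

lemma c4 (hL : 0 ≤ L) (h : Cl L u Φ q Z) : ∀ z, ‖Φ z‖ ≤ 2 * u z := by
  obtain ⟨c, hc, hc3⟩ := c3 hL
  let T : Set ℝ := {t | ∃ (u : ℂ → ℝ) (Φ q : ℂ → ℂ) (Z : Set ℂ) (z : ℂ), Cl L u Φ q Z ∧ z ∉ Z ∧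
    t = ‖Φ z‖ / (2 * u z)}
  have up : ∀ {u : ℂ → ℝ} {Φ q : ℂ → ℂ} {Z : Set ℂ} {z : ℂ}, Cl L u Φ q Z → z ∉ Z → 0 < u z :=
    fun {u Φ q Z z} h hz => lt_of_lt_of_le (mul_pos hc (h.pos hz)) (hc3 u Φ q Z h z)
  have hT : BddAbove T := ⟨L / (2 * c), by
    rintro t ⟨u, Φ, q, Z, z, h, hz, rfl⟩
    have h1 := hc3 u Φ q Z h z
    have h2 := h.Φd z
    rw [div_le_div_iff₀ (by linarith [up h hz]) (by positivity)]
    nlinarith⟩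
  intro z
  by_cases hz : z ∈ Z
  · simp [h.zu hz, h.zΦ hz]
  have hne : T.Nonempty := ⟨_, u, Φ, q, Z, z, h, hz, rfl⟩
  have hall : ∀ {u : ℂ → ℝ} {Φ q : ℂ → ℂ} {Z : Set ℂ}, Cl L u Φ q Z → ∀ z,
      ‖Φ z‖ ≤ 2 * sSup T * u z := fun {u Φ q Z} h z => by
    by_cases hz : z ∈ Z
    · simp [h.zu hz, h.zΦ hz]
    have : ‖Φ z‖ / (2 * u z) ≤ sSup T := le_csSup hT ⟨u, Φ, q, Z, z, h, hz, rfl⟩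
    rw [div_le_iff₀ (by linarith [up h hz])] at this
    linarith
  rcases le_or_gt (sSup T) 0 with hS | hS
  · have := hall h z
    nlinarith [h.nn z]
  obtain ⟨t, -, ht, htT⟩ := exists_seq_tendsto_sSup hne hT
  choose us Φs qs Zs zs hs hzs hts using htT
  obtain ⟨φ, hφ, ui, Φi, qi, Zi, hi, hd, hu, hΦ⟩ := extr hL hs zs hzs
  have h0 : (0 : ℂ) ∉ Zi := fun h0 => by simp [infDist_zero_of_mem h0] at hd
  have h1 := hΦ.norm.div (hu.const_mul 2) (by linarith [up hi h0])
  have h2 : sSup T = ‖Φi 0‖ / (2 * ui 0) := tendsto_nhds_unique (ht.comp hφ.tendsto_atTop)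
    (h1.congr fun n => by
      have hp := (hs (φ n)).pos (hzs (φ n))
      simp only [Function.comp, hts, norm_div, norm_real, Real.norm_eq_abs]
      have := up (hs (φ n)) (hzs (φ n))
      simp only [Pi.div_apply]
      rw [abs_of_pos hp]
      field_simp)
  have h3 := hi.eqq hS (hall hi) h0 (by
    rw [h2]; have := up hi h0; field_simp)
  have := hall h z
  rw [h3.1] at this; linarith
end

section
variable {L : ℝ} {u : ℂ → ℝ} {Φ q : ℂ → ℂ} {Z : Set ℂ}

lemma secmin {f g : ℝ → ℝ} {c : ℝ} (hf : ∀ᶠ t in 𝓝 0, HasDerivAt f (g t) t) (hg : HasDerivAt g c 0)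
    (hm : IsLocalMin f 0) : 0 ≤ c := by
  by_contra! hc
  have h1 : deriv f =ᶠ[𝓝 0] g := hf.mono fun t ht => ht.deriv
  have h2 : deriv (deriv f) 0 = c := by rw [h1.deriv_eq, hg.deriv]
  have h3 := isLocalMax_of_deriv_deriv_neg (by rw [h2]; exact hc) hm.deriv_eq_zero
    hf.self_of_nhds.continuousAt
  have h4 : f =ᶠ[𝓝 0] fun _ => f 0 := by
    filter_upwards [hm, h3] with t ht1 ht2 using le_antisymm ht2 ht1
  have h5 : deriv f =ᶠ[𝓝 0] fun _ => 0 := by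
    filter_upwards [h4.eventuallyEq_nhds] with t ht
    rw [ht.deriv_eq]; simp
  have : deriv (deriv f) 0 = 0 := by rw [h5.deriv_eq]; simp
  linarith

lemma Cl.sd (h : Cl L u Φ q Z) (κ : ℝ) {z : ℂ} (hz : z ∉ Z)
    (hm : IsLocalMin (fun z => 4 * u z ^ 2 - ‖Φ z‖ ^ 2 - κ * ((1 - ‖z‖ ^ 2) + 2 * (1 - ‖z‖ ^ 2) ^ 2)) z) :
    κ * (32 * ‖z‖ ^ 2 - 20) ≤ -4 * (1 - ‖q z‖ ^ 2) ^ 2 := by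
  have hn : ∀ z : ℂ, ‖z‖ ^ 2 = (z * conj z).re := fun z => by
    rw [Complex.mul_conj, Complex.normSq_eq_norm_sq, ofReal_re]
  have hq' := (h.hq.differentiableAt (h.op.mem_nhds hz)).hasDerivAt
  set Q := deriv q z
  have line : ∀ (e : ℂ) (t : ℝ), HasDerivAt (fun t : ℝ => z + t * e) e t := fun e t => by
    simpa using ((hasDerivAt_id t).ofReal_comp.mul_const e).const_add z
  have key : ∀ e : ℂ, 0 ≤ 8 * (q z * e).re ^ 2 + 8 * u z * (Q * e ^ 2).re
      - 2 * ‖q z ^ 2 * e + conj e‖ ^ 2 - 2 * (conj (Φ z) * (2 * q z * Q * e ^ 2)).re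
      - κ * (-2 * ‖e‖ ^ 2 * (1 + 4 * (1 - ‖z‖ ^ 2)) + 16 * (z * conj e).re ^ 2) := fun e => by
    refine secmin (f := fun t : ℝ => 4 * u (z + t * e) ^ 2 - ‖Φ (z + t * e)‖ ^ 2
      - κ * ((1 - ‖z + t * e‖ ^ 2) + 2 * (1 - ‖z + t * e‖ ^ 2) ^ 2))
      (g := fun t : ℝ => 8 * u (z + t * e) * (q (z + t * e) * e).re
        - 2 * (conj (Φ (z + t * e)) * (q (z + t * e) ^ 2 * e + conj e)).re
        - κ * (-2 * ((z + t * e) * conj e).re * (1 + 4 * (1 - ‖z + t * e‖ ^ 2)))) ?_ ?_ ?_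
    · have : ∀ᶠ t : ℝ in 𝓝 0, z + t * e ∉ Z := by
        have hc : ContinuousAt (fun t : ℝ => z + t * e) 0 := by fun_prop
        exact hc.eventually_mem (h.op.mem_nhds (by simpa using hz))
      filter_upwards [this] with t ht
      have h1 : HasDerivAt (fun t : ℝ => u (z + t * e)) ((q (z + t * e) * e).re) t := by
        simpa [Function.comp_def] using (h.du ht).comp_hasDerivAt t (line e t)
      have h2 : HasDerivAt (fun t : ℝ => Φ (z + t * e)) (q (z + t * e) ^ 2 * e + conj e) t := by
        simpa [Function.comp_def] using (h.dΦ ht).comp_hasDerivAt t (line e t)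
      have nsq : ∀ {f : ℝ → ℂ} {f' : ℂ}, HasDerivAt f f' t →
          HasDerivAt (fun t => ‖f t‖ ^ 2) (2 * (conj (f t) * f').re) t := fun {f f'} hf => by
        have := (hf.mul (((conjCLE : ℂ →L[ℝ] ℂ).hasFDerivAt.comp_hasDerivAt t hf)))
        have := reCLM.hasFDerivAt.comp_hasDerivAt t this
        simp only [hn]
        refine this.congr_deriv ?_
        simp; ring
      have h3 := nsq h2
      have h4 := nsq (line e t)
      refine (((h1.pow 2).const_mul 4).sub h3 |>.sub ((((h4.const_sub 1).add
        (((h4.const_sub 1).pow 2).const_mul 2))).const_mul κ)).congr_deriv ?_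
      simp; ring
    · have hz0 : z + ((0 : ℝ) : ℂ) * e = z := by simp
      have h1 : HasDerivAt (fun t : ℝ => u (z + t * e)) ((q z * e).re) 0 := by
        have := (show HasFDerivAt u (reL (q z)) (z + ((0 : ℝ) : ℂ) * e) by rw [hz0]; exact h.du hz).comp_hasDerivAt 0 (line e 0)
        simpa [Function.comp_def] using this
      have h2 : HasDerivAt (fun t : ℝ => Φ (z + t * e)) (q z ^ 2 * e + conj e) 0 := by
        have := (show HasFDerivAt Φ (phL (q z)) (z + ((0 : ℝ) : ℂ) * e) by rw [hz0]; exact h.dΦ hz).comp_hasDerivAt 0 (line e 0)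
        simpa [Function.comp_def] using this
      have h3 : HasDerivAt (fun t : ℝ => q (z + t * e)) (Q * e) 0 := by
        have := (show HasDerivAt q Q (z + ((0 : ℝ) : ℂ) * e) by rw [hz0]; exact hq').comp (0 : ℝ) (line e 0)
        simpa [Function.comp_def] using this
      have h4 := line e 0
      have nsq : HasDerivAt (fun t : ℝ => ‖z + t * e‖ ^ 2) (2 * (conj z * e).re) 0 := by
        have := (h4.mul (((conjCLE : ℂ →L[ℝ] ℂ).hasFDerivAt.comp_hasDerivAt 0 h4)))
        have := reCLM.hasFDerivAt.comp_hasDerivAt 0 this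
        simp only [hn]
        refine this.congr_deriv ?_
        simp; ring
      have a1 := (h1.const_mul 8).mul (reCLM.hasFDerivAt.comp_hasDerivAt 0 (h3.mul_const e))
      have a2 := (reCLM.hasFDerivAt.comp_hasDerivAt 0
        (((conjCLE : ℂ →L[ℝ] ℂ).hasFDerivAt.comp_hasDerivAt 0 h2).mul
        (((h3.pow 2).mul_const e).add_const (conj e)))).const_mul 2
      have a3 := ((((reCLM.hasFDerivAt.comp_hasDerivAt 0 (h4.mul_const (conj e))).const_mul (-2)).mul
        (((nsq.const_sub 1).const_mul 4).const_add 1))).const_mul κ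
      refine ((a1.sub a2).sub a3).congr_deriv ?_
      simp only [hn]
      simp [pow_two]; ring
    · have hc : Tendsto (fun t : ℝ => z + t * e) (𝓝 0) (𝓝 z) := by
        have : ContinuousAt (fun t : ℝ => z + t * e) 0 := by fun_prop
        simpa [ContinuousAt] using this
      have := hc.eventually hm
      simpa [IsLocalMin, IsMinFilter] using this
  have k1 := key 1
  have kI := key I
  simp only [hn] at k1 kI ⊢
  simp [pow_two] at k1 kI ⊢
  nlinarith

lemma Cl.hopf0 (h : Cl L u Φ q Z) (hle : ∀ z, ‖Φ z‖ ≤ 2 * u z) (hd : infDist 0 Z = 1) :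
    ∃ z1 ∈ ball (0 : ℂ) 1, ‖Φ z1‖ = 2 * u z1 := by
  by_contra! hc
  let v : ℂ → ℝ := fun z => 4 * u z ^ 2 - ‖Φ z‖ ^ 2
  have hvc : Continuous v := by
    have := h.cu; have := h.cΦ; fun_prop
  have hb : ball (0 : ℂ) 1 ⊆ Zᶜ := by rw [← hd]; exact h.ball_sub 0
  have hv0 : ∀ z, 0 ≤ v z := fun z => by
    have := hle z; simp only [v]; nlinarith [norm_nonneg (Φ z)]
  have hvp : ∀ z ∈ ball (0 : ℂ) 1, 0 < v z := fun z hz => by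
    have := lt_of_le_of_ne (hle z) (hc z hz); simp only [v]; nlinarith [norm_nonneg (Φ z)]
  obtain ⟨m, hm, hmv⟩ : ∃ m > 0, ∀ z : ℂ, ‖z‖ ^ 2 ≤ 3 / 4 → m ≤ v z := by
    have hK : IsCompact {z : ℂ | ‖z‖ ^ 2 ≤ 3 / 4} := by
      refine (isCompact_closedBall (0 : ℂ) 1).of_isClosed_subset
        (isClosed_le (by fun_prop) continuous_const) fun z hz => ?_
      rw [mem_closedBall_zero_iff]
      have : ‖z‖ ^ 2 ≤ 3 / 4 := hz
      nlinarith [norm_nonneg z]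
    obtain ⟨z, hz, hzm⟩ := hK.exists_isMinOn ⟨0, by norm_num⟩ hvc.continuousOn
    refine ⟨v z, hvp z ?_, fun w hw => hzm hw⟩
    have : ‖z‖ ^ 2 ≤ 3 / 4 := hz
    rw [mem_ball_zero_iff]
    nlinarith [norm_nonneg z]
  let f : ℂ → ℝ := fun z => 4 * u z ^ 2 - ‖Φ z‖ ^ 2 - m * ((1 - ‖z‖ ^ 2) + 2 * (1 - ‖z‖ ^ 2) ^ 2)
  have hfc : Continuous f := by
    have := h.cu; have := h.cΦ; fun_prop
  have hpos : ∀ z : ℂ, 3 / 4 ≤ ‖z‖ ^ 2 → ‖z‖ ≤ 1 → 0 ≤ f z := by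
    have hK : IsCompact {z : ℂ | 3 / 4 ≤ ‖z‖ ^ 2 ∧ ‖z‖ ≤ 1} := by
      refine (isCompact_closedBall (0 : ℂ) 1).of_isClosed_subset
        ((isClosed_le (α := ℝ) (f := fun _ : ℂ => 3 / 4) (g := fun z : ℂ => ‖z‖ ^ 2) (by fun_prop) (by fun_prop)).inter
          (isClosed_le (f := fun z : ℂ => ‖z‖) (g := fun _ => 1) (by fun_prop) (by fun_prop))) fun z hz => ?_
      rw [mem_closedBall_zero_iff]
      exact hz.2
    obtain ⟨z, hz, hzm⟩ := hK.exists_isMinOn ⟨1, by norm_num⟩ hfc.continuousOn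
    suffices 0 ≤ f z from fun w h1 h2 => this.trans (hzm ⟨h1, h2⟩)
    by_contra! hneg
    obtain ⟨hz1, hz2⟩ := hz
    have h1 : 3 / 4 < ‖z‖ ^ 2 := by
      refine lt_of_le_of_ne hz1 fun he => ?_
      have := hmv z he.symm.le
      simp only [f, v, ← he] at this hneg
      linarith
    have h2 : ‖z‖ < 1 := by
      refine lt_of_le_of_ne hz2 fun he => ?_
      have := hv0 z
      simp only [f, v, he] at this hneg
      linarith
    have hop : IsOpen {z : ℂ | 3 / 4 < ‖z‖ ^ 2 ∧ ‖z‖ < 1} :=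
      (isOpen_lt (α := ℝ) (f := fun _ : ℂ => 3 / 4) (g := fun z : ℂ => ‖z‖ ^ 2) (by fun_prop) (by fun_prop)).inter
          (isOpen_lt (f := fun z : ℂ => ‖z‖) (g := fun _ => 1) (by fun_prop) (by fun_prop))
    have hlm : IsLocalMin f z := by
      filter_upwards [hop.mem_nhds ⟨h1, h2⟩] with w hw using hzm ⟨hw.1.le, hw.2.le⟩
    have := h.sd m (hb (by simpa using h2)) hlm
    nlinarith [sq_nonneg (1 - ‖q z‖ ^ 2)]
  obtain ⟨p, hp, hpd⟩ := h.cl.exists_infDist_eq_dist h.ne 0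
  rw [hd, dist_zero_left] at hpd
  have hL : ∀ t : ℝ, 9 / 10 ≤ t → t < 1 → m ≤ 4 * L ^ 2 * (1 - t) := fun t h1 h2 => by
    have hn : ‖(t : ℂ) * p‖ = t := by
      rw [norm_mul, ← hpd, norm_real, Real.norm_eq_abs, abs_of_pos (by linarith), mul_one]
    have h3 := hpos (t * p) (by rw [hn]; nlinarith) (by rw [hn]; exact h2.le)
    have h4 := h.lu (t * p) p
    have h5 : dist ((t : ℂ) * p) p = 1 - t := by
      rw [dist_eq_norm, show (t : ℂ) * p - p = ((t - 1 : ℝ) : ℂ) * p by push_cast; ring, norm_mul, ← hpd,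
        norm_real, Real.norm_eq_abs, abs_of_neg (by linarith)]; ring
    rw [h.zu hp, Real.dist_eq, sub_zero, abs_of_nonneg (h.nn _), h5] at h4
    simp only [f, hn] at h3
    have h6 := h.nn (t * p)
    have h7 : u (t * p) ^ 2 ≤ (L * (1 - t)) ^ 2 := by gcongr
    have h8 : m * (1 - t) ≤ 4 * L ^ 2 * (1 - t) * (1 - t) := by
      have : m * (1 - t) ≤ m * ((1 - t ^ 2) + 2 * (1 - t ^ 2) ^ 2) := by
        gcongr; nlinarith [sq_nonneg (1 - t ^ 2)]
      nlinarith [norm_nonneg (Φ (t * p))]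
    exact le_of_mul_le_mul_right h8 (by linarith)
  have hlim : Tendsto (fun t : ℝ => 4 * L ^ 2 * (1 - t)) (𝓝[<] 1) (𝓝 0) := by
    have : ContinuousAt (fun t : ℝ => 4 * L ^ 2 * (1 - t)) 1 := by fun_prop
    simpa [ContinuousAt] using this.tendsto.mono_left nhdsWithin_le_nhds
  have := ge_of_tendsto hlim (by
    filter_upwards [Ioo_mem_nhdsLT (show (9 / 10 : ℝ) < 1 by norm_num)] with t ht using hL t ht.1.le ht.2)
  linarith

lemma Cl.hopf (hL : 0 ≤ L) (h : Cl L u Φ q Z) {z0 : ℂ} (hz : z0 ∉ Z) :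
    ∃ z1 ∈ ball z0 (infDist z0 Z), ‖Φ z1‖ = 2 * u z1 := by
  have hs := h.pos hz
  have h' := h.scale z0 hs
  obtain ⟨w, hw, he⟩ := h'.hopf0 (c4 hL h') (h.scale_d hz)
  refine ⟨z0 + (infDist z0 Z : ℝ) * w, ?_, ?_⟩
  · rw [mem_ball_zero_iff] at hw
    rw [mem_ball, dist_self_add_left, norm_mul, norm_real, Real.norm_eq_abs, abs_of_pos hs]
    nlinarith
  · simp only [norm_div, norm_real, Real.norm_eq_abs, abs_of_pos hs] at he
    field_simp at he; exact he

def HP (u : ℂ → ℝ) (q : ℂ → ℂ) (Z : Set ℂ) (a : ℂ) (b : ℝ) : Prop :=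
  ‖a‖ = 1 ∧ ∀ z, b < (a * z).re → z ∉ Z ∧ u z = (a * z).re - b ∧ q z = a

lemma c6 (hL : 0 ≤ L) (h : Cl L u Φ q Z) {z0 : ℂ} (hz : z0 ∉ Z) :
    ∃ a b, HP u q Z a b ∧ b < (a * z0).re := by
  obtain ⟨z1, hz1, he⟩ := h.hopf hL hz
  have hb := h.ball_sub z0
  have hz1Z := hb hz1
  obtain ⟨-, a, ha, hqa⟩ := h.eqq one_pos (by simpa using c4 hL h) hz1Z (by simpa using he)
  have h1 := h.id hz1Z (a := a) (by
    filter_upwards [ball_mem_nhds z1 (h.pos hz1Z)] with z hz using hqa z hz)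
  have hcomp : connectedComponentIn Zᶜ z1 = connectedComponentIn Zᶜ z0 :=
    (connectedComponentIn_eq ((convex_ball z0 _).isPreconnected.subset_connectedComponentIn
      (mem_ball_self (h.pos hz)) hb hz1)).symm
  rw [hcomp] at h1
  set V := connectedComponentIn Zᶜ z0
  have hV : IsOpen V := h.op.connectedComponentIn
  have hs : V ⊆ Zᶜ := connectedComponentIn_subset Zᶜ z0
  have hzV : z0 ∈ V := mem_connectedComponentIn hz
  have hd4 : ∀ z ∈ V, HasFDerivAt (fun z => u z - (reL a) z) (0 : ℂ →L[ℝ] ℝ) z := fun z hzv => by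
    have := (h.du (hs hzv)).sub (reL a).hasFDerivAt
    refine this.congr_fderiv ?_
    ext x; simp [h1 z hzv]
  have h5 : ∀ z ∈ V, u z - (reL a) z = u z0 - (reL a) z0 := fun z hzv =>
    hV.is_const_of_fderiv_eq_zero (𝕜 := ℝ) isPreconnected_connectedComponentIn
      (fun z hzv => (hd4 z hzv).differentiableAt.differentiableWithinAt)
      (fun z hzv => (hd4 z hzv).fderiv) hzv hzV
  have hu0 : 0 < u z0 := lt_of_le_of_ne (h.nn z0) fun h0 => h.zero_case hz h0.symm
  have hH : {z | (a * z0).re - u z0 < reL a z} ⊆ V := by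
    refine sub_of_front hV (Convex.isPreconnected (convex_halfSpace_gt (reL a).isLinear _))
      ⟨z0, by simp [hu0], hzV⟩ fun x hx hxH => ?_
    have hxZ : x ∈ Z := not_not.1 (comp_front h.op hx)
    have hc : IsClosed {z | u z - reL a z = u z0 - reL a z0} :=
      isClosed_eq (h.cu.sub (reL a).continuous) continuous_const
    have h7 : u x - reL a x = u z0 - reL a z0 :=
      hc.closure_subset_iff.2 h5 (frontier_subset_closure hx)
    rw [h.zu hxZ] at h7
    have h8 : (a * z0).re - u z0 < reL a x := hxH
    rw [reL_apply a z0] at h7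
    linarith
  refine ⟨a, (a * z0).re - u z0, ⟨ha, fun z hz => ?_⟩, by linarith⟩
  have hzV : z ∈ V := hH hz
  have := h5 z hzV
  simp only [reL_apply] at this
  exact ⟨hs hzV, by linarith, h1 z hzV⟩

lemma HP.unique {a1 a2 : ℂ} {b1 b2 : ℝ} (h1 : HP u q Z a1 b1) (h2 : HP u q Z a2 b2) :
    (a1 = a2 ∧ b1 = b2) ∨ (a2 = -a1 ∧ 0 ≤ b1 + b2) := by
  have hint : ∀ z, b1 < (a1 * z).re → b2 < (a2 * z).re → a1 = a2 ∧ b1 = b2 := fun z hz1 hz2 => by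
    have e1 := h1.2 z hz1
    have e2 := h2.2 z hz2
    have : a1 = a2 := e1.2.2.symm.trans e2.2.2
    refine ⟨this, ?_⟩
    have := e1.2.1.symm.trans e2.2.1
    subst a1; linarith
  have n : ∀ {a : ℂ}, ‖a‖ = 1 → a.re ^ 2 + a.im ^ 2 = 1 := fun {a} h => by
    rw [Complex.norm_eq_sqrt_sq_add_sq] at h
    simpa using (Real.sqrt_eq_one).1 h
  have n1 := n h1.1
  have n2 := n h2.1
  by_cases ha : a2 = -a1
  · right
    refine ⟨ha, ?_⟩
    by_contra! hlt
    let x : ℝ := (b1 - b2) / 2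
    have hx : (a1 * (x * conj a1)).re = x := by
      simp; linear_combination x * n1
    have := (hint (x * conj a1) (by rw [hx]; simp only [x]; linarith)
      (by rw [ha, neg_mul, neg_re, hx]; simp only [x]; linarith)).1
    rw [ha] at this
    have h0 : a1 = 0 := self_eq_neg.1 this
    have := h1.1
    simp [h0] at this
  · left
    have hpos : 0 < 1 + (a1.re * a2.re + a1.im * a2.im) := by
      by_contra! hle
      apply ha
      have : (a1.re + a2.re) ^ 2 + (a1.im + a2.im) ^ 2 ≤ 0 := by nlinarith
      have e1 : a1.re + a2.re = 0 := by nlinarith [sq_nonneg (a1.im + a2.im), sq_nonneg (a1.re + a2.re)]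
      have e2 : a1.im + a2.im = 0 := by nlinarith [sq_nonneg (a1.im + a2.im), sq_nonneg (a1.re + a2.re)]
      apply Complex.ext <;> simp <;> linarith
    set s := 1 + (a1.re * a2.re + a1.im * a2.im) with hs
    let x : ℝ := (|b1| + |b2| + 1) / s
    have hx1 : (a1 * (x * conj (a1 + a2))).re = |b1| + |b2| + 1 := by
      have : (a1 * (x * conj (a1 + a2))).re = x * s := by simp [hs]; linear_combination x * n1
      rw [this]; simp only [x]; field_simp
    have hx2 : (a2 * (x * conj (a1 + a2))).re = |b1| + |b2| + 1 := by
      have : (a2 * (x * conj (a1 + a2))).re = x * s := by simp [hs]; linear_combination x * n2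
      rw [this]; simp only [x]; field_simp
    exact hint (x * conj (a1 + a2)) (by rw [hx1]; linarith [le_abs_self b1, abs_nonneg b2])
      (by rw [hx2]; linarith [le_abs_self b2, abs_nonneg b1])

theorem classify (hL : 0 ≤ L) (h : Cl L u Φ q Z) (h0 : (0 : ℂ) ∈ Z) (hc : (0 : ℂ) ∈ closure Zᶜ) :
    ∃ θ : ℝ, u ∘ rot θ = Pfun ∨ (∃ a > 0, u ∘ rot θ = TPfun a) ∨ u ∘ rot θ = Wfun 1 := by
  have hne : ∀ {a : ℂ}, ‖a‖ = 1 → a ≠ -a := fun {a} ha he => by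
    rw [self_eq_neg.1 he] at ha; simp at ha
  have hnn : ∀ {a b}, HP u q Z a b → 0 ≤ b := fun {a b} hp => by
    by_contra! hlt
    exact (hp.2 0 (by simpa using hlt)).1 h0
  have near : ∀ r > 0, ∃ z ∉ Z, ‖z‖ < r := fun r hr => by
    obtain ⟨z, hz, hd⟩ := Metric.mem_closure_iff.1 hc r hr
    exact ⟨z, hz, by simpa using hd⟩
  have out : ∀ {a : ℂ} {b : ℝ} {z : ℂ}, ‖a‖ = 1 → ‖z‖ < b → ¬ b < (a * z).re := fun {a b z} ha hz hlt => by
    have := re_le_norm (a * z)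
    rw [norm_mul, ha, one_mul] at this; linarith
  obtain ⟨a, hHP⟩ : ∃ a, HP u q Z a 0 := by
    by_contra! hno
    have hpos : ∀ {a b}, HP u q Z a b → 0 < b := fun {a b} hp =>
      lt_of_le_of_ne (hnn hp) fun he => hno a (he ▸ hp)
    obtain ⟨z, hz, -⟩ := near 1 one_pos
    obtain ⟨a1, b1, h1, -⟩ := c6 hL h hz
    obtain ⟨z2, hz2, hn2⟩ := near b1 (hpos h1)
    obtain ⟨a2, b2, h2, hz2'⟩ := c6 hL h hz2
    obtain ⟨z3, hz3, hn3⟩ := near (min b1 b2) (lt_min (hpos h1) (hpos h2))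
    obtain ⟨a3, b3, h3, hz3'⟩ := c6 hL h hz3
    rw [lt_min_iff] at hn3
    rcases h1.unique h2 with ⟨rfl, rfl⟩ | ⟨e2, -⟩
    · exact out h1.1 hn2 hz2'
    rcases h1.unique h3 with ⟨rfl, rfl⟩ | ⟨e3, -⟩
    · exact out h1.1 hn3.1 hz3'
    rcases h2.unique h3 with ⟨rfl, rfl⟩ | ⟨e4, -⟩
    · exact out h2.1 hn3.2 hz3'
    · rw [e2, neg_neg] at e4
      exact hne h1.1 (e4.symm.trans e3)
  have hrot : ∀ z, (a * rot (-a.arg) z).re = z.re := fun z => by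
    have h1 : a = exp (a.arg * I) := by
      conv_lhs => rw [← norm_mul_exp_arg_mul_I a]
      rw [hHP.1]; simp
    have : a * rot (-a.arg) z = z := by
      unfold rot
      nth_rewrite 1 [h1]
      rw [← mul_assoc, ← Complex.exp_add]; simp
    rw [this]
  have key : ∀ f : ℝ → ℝ, (∀ z, u z = f (a * z).re) → ∀ z, (u ∘ rot (-a.arg)) z = f z.re :=
    fun f hf z => by rw [Function.comp, hf, hrot]
  refine ⟨-a.arg, ?_⟩
  by_cases hall : ∀ z ∉ Z, 0 < (a * z).re
  · left
    funext z
    refine key (fun x => max x 0) (fun z => ?_) z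
    by_cases hz : 0 < (a * z).re
    · rw [(hHP.2 z hz).2.1, max_eq_left hz.le, sub_zero]
    · rw [max_eq_right (not_lt.1 hz)]
      by_contra hu
      exact hz (hall z fun hzZ => hu (h.zu hzZ))
  · push Not at hall
    obtain ⟨z2, hz2, hn2⟩ := hall
    obtain ⟨a2, b2, h2, hz2'⟩ := c6 hL h hz2
    obtain ⟨rfl, hb2⟩ : a2 = -a ∧ 0 ≤ b2 := by
      rcases hHP.unique h2 with ⟨rfl, rfl⟩ | ⟨e, he⟩
      · linarith
      · exact ⟨e, by linarith⟩
    have hform : ∀ z, u z = (fun x => max x 0 + max (-x - b2) 0) (a * z).re := fun z => by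
      simp only
      by_cases hz : 0 < (a * z).re
      · rw [(hHP.2 z hz).2.1, max_eq_left hz.le, max_eq_right (by linarith)]; ring
      by_cases hz' : b2 < -(a * z).re
      · have := (h2.2 z (by rw [neg_mul, neg_re]; exact hz')).2.1
        rw [neg_mul, neg_re] at this
        rw [this, max_eq_right (by linarith), max_eq_left (by linarith)]; ring
      rw [max_eq_right (by linarith), max_eq_right (by linarith), add_zero]
      refine h.zu ?_
      by_contra hzZ
      obtain ⟨a3, b3, h3, hz3⟩ := c6 hL h hzZ
      rcases hHP.unique h3 with ⟨rfl, rfl⟩ | ⟨e3, -⟩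
      · exact hz hz3
      rcases h2.unique h3 with ⟨rfl, rfl⟩ | ⟨e4, -⟩
      · rw [neg_mul, neg_re] at hz3; exact hz' hz3
      · rw [neg_neg] at e4
        exact hne hHP.1 (e4.symm.trans e3)
    right
    rcases hb2.eq_or_lt with rfl | hb2
    · right
      funext z
      rw [key (fun x => max x 0 + max (-x - 0) 0) hform z]
      simp only [Wfun, one_mul, sub_zero]
      rcases le_total z.re 0 with hz | hz
      · rw [max_eq_right hz, max_eq_left (by linarith), abs_of_nonpos hz, zero_add]
      · rw [max_eq_left hz, max_eq_right (by linarith), abs_of_nonneg hz, add_zero]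
    · left
      exact ⟨b2, hb2, funext fun z => key (fun x => max x 0 + max (-x - b2) 0) hform z⟩
end

section
variable {Ω : Set ℂ} {u : ℂ → ℝ}

lemma posSet_open (hΩ : IsOpen Ω) (h : IsClassicalSolution Ω u) : IsOpen (posSet Ω u) :=
  h.contOn.isOpen_inter_preimage hΩ isOpen_Ioi

lemma u_zero (h : IsClassicalSolution Ω u) {z} (hz : z ∈ Ω) (hzD : z ∉ posSet Ω u) : u z = 0 :=
  le_antisymm (not_lt.1 fun h' => hzD ⟨hz, h'⟩) (h.nonneg z hz)

lemma FB_iff (hΩ : IsOpen Ω) (h : IsClassicalSolution Ω u) {z} :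
    z ∈ FB Ω u ↔ z ∈ Ω ∧ z ∈ closure (posSet Ω u) ∧ z ∉ posSet Ω u := by
  rw [FB, (posSet_open hΩ h).frontier_eq]; rfl

noncomputable def qq (u : ℂ → ℝ) (z : ℂ) : ℂ := conj (grad2 u z)

lemma qq_norm (u : ℂ → ℝ) (z : ℂ) : ‖qq u z‖ = ‖grad2 u z‖ := by simp [qq]

lemma qq_du (hΩ : IsOpen Ω) (h : IsClassicalSolution Ω u) {z} (hz : z ∈ posSet Ω u) :
    HasFDerivAt u (reL (qq u z)) z := by
  have h1 : DifferentiableAt ℝ u z :=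
    (h.harm.1.contDiffAt ((posSet_open hΩ h).mem_nhds hz)).differentiableAt (by norm_num)
  refine h1.hasFDerivAt.congr_fderiv ?_
  ext x
  have : x = x.re • (1 : ℂ) + x.im • I := by simp
  conv_lhs => rw [this, map_add, map_smul, map_smul]
  simp [qq, grad2]; ring

lemma qq_hol (hΩ : IsOpen Ω) (h : IsClassicalSolution Ω u) :
    DifferentiableOn ℂ (qq u) (posSet Ω u) := by
  intro z hz
  have hD := posSet_open hΩ h
  have hc : ∀ w ∈ posSet Ω u, ContDiffAt ℝ 2 u w := fun w hw => h.harm.1.contDiffAt (hD.mem_nhds hw)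
  have hh : InnerProductSpace.HarmonicAt u z := by
    refine ⟨hc z hz, ?_⟩
    filter_upwards [hD.mem_nhds hz] with w hw
    rw [InnerProductSpace.laplacian_eq_iteratedFDeriv_complexPlane]
    simp only [iteratedFDeriv_two_apply]
    have hd : DifferentiableAt ℝ (fderiv ℝ u) w :=
      ((hc w hw).fderiv_right (m := 1) (by norm_num)).differentiableAt (by norm_num)
    have e : ∀ v : ℂ, hess u w v v = fderiv ℝ (fderiv ℝ u) w v v := fun v => by
      unfold hess
      have := (hd.hasFDerivAt.clm_apply (hasFDerivAt_const v w)).fderiv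
      rw [this]; simp
    have := h.harm.2 w hw
    rw [e, e] at this
    simpa using this
  have := HarmonicAt.differentiableAt_complex_partial hh
  refine (this.congr_of_eventuallyEq (.of_forall fun w => ?_)).differentiableWithinAt
  simp [qq, grad2]; ring

lemma loc (hΩ : IsOpen Ω) (h : IsClassicalSolution Ω u) {p : ℂ} (hp : p ∈ FB Ω u) {W : Set ℂ}
    (hW : W ∈ 𝓝 p) : ∃ N, IsOpen N ∧ p ∈ N ∧ N ⊆ W ∧ N ⊆ Ω ∧ IsPreconnected (N ∩ FB Ω u) ∧
      IsPreconnected (N ∩ posSet Ω u) ∧ IsPreconnected (N \ closure (posSet Ω u)) ∧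
      N ∩ FB Ω u ⊆ closure (N \ closure (posSet Ω u)) := by
  obtain ⟨V, hVo, hpV, hVΩ, φ, hφ, hφ0, h1, -, h3⟩ := h.fb_manifold p hp
  have h4 : ∀ w ∈ V, w ∉ closure (posSet Ω u) ↔ φ w < 0 := fun w hw => by
    have e1 : w ∈ posSet Ω u ↔ 0 < φ w := by
      have := Set.ext_iff.1 h1 w; simp [hw] at this; exact this
    have e2 : w ∈ FB Ω u ↔ φ w = 0 := by
      have := Set.ext_iff.1 h3 w; simp [hw] at this; exact this
    rw [FB_iff hΩ h] at e2
    constructor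
    · intro hc
      by_contra! hlt
      rcases hlt.eq_or_lt with he | hlt
      · exact hc (e2.2 he.symm).2.1
      · exact hc (subset_closure (e1.2 hlt))
    · intro hlt hc
      have : w ∉ posSet Ω u := fun hh => by linarith [e1.1 hh]
      linarith [e2.1 ⟨hVΩ hw, hc, this⟩]
  have hp0 : φ p = 0 := by
    have := Set.ext_iff.1 h3 p; simp [hpV, hp] at this; exact this
  set A := fderiv ℝ φ p with hA
  have hst : HasStrictFDerivAt φ A p :=
    (hφ.contDiffAt (hVo.mem_nhds hpV)).hasStrictFDerivAt (by simp)
  let c : ℂ := A 1 - A I * I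
  have hAc : ∀ x, A x = (c * x).re := fun x => by
    have : x = x.re • (1 : ℂ) + x.im • I := by simp
    conv_lhs => rw [this, map_add, map_smul, map_smul]
    simp [c]; ring
  have hc0 : c ≠ 0 := fun hc => hφ0 p hpV (by
    ext x; rw [← hA, hAc, hc]; simp)
  let E : ℂ ≃L[ℝ] ℂ := ContinuousLinearEquiv.unitsEquivAut ℂ (Units.mk0 c hc0) |>.restrictScalars ℝ
  have hE : ∀ x, E x = c * x := fun x => by simp [E, mul_comm]
  let Ψ : ℂ → ℂ := fun w => (φ w : ℂ) + ((c * (w - p)).im : ℂ) * I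
  have hΨ : HasStrictFDerivAt Ψ (E : ℂ →L[ℝ] ℂ) p := by
    have a1 := ofRealCLM.hasStrictFDerivAt.comp p hst
    have a2 : HasStrictFDerivAt (fun w : ℂ => c * (w - p)) (c • ContinuousLinearMap.id ℝ ℂ) p :=
      ((hasStrictFDerivAt_id (𝕜 := ℝ) p).sub_const p).const_mul c
    have a3 := ((ofRealCLM.comp imCLM).hasStrictFDerivAt.comp p a2).mul_const I
    refine (a1.add a3).congr_fderiv ?_
    ext x
    simp [hE, hAc]
    apply Complex.ext <;> simp
  let e := hΨ.toOpenPartialHomeomorph Ψ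
  have hps : p ∈ e.source := hΨ.mem_toOpenPartialHomeomorph_source
  have hecoe : (e : ℂ → ℂ) = Ψ := rfl
  have hep : e p = 0 := by simp [hecoe, Ψ, hp0]
  have hre : ∀ w, (e w).re = φ w := fun w => by simp [hecoe, Ψ]
  have hnb : e.target ∩ e.symm ⁻¹' (V ∩ W) ∈ 𝓝 (0 : ℂ) := by
    refine inter_mem (hep ▸ e.open_target.mem_nhds (e.map_source hps)) ?_
    have : Tendsto e.symm (𝓝 (0 : ℂ)) (𝓝 p) := by
      have := (e.continuousAt_symm (e.map_source hps)).tendsto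
      rwa [e.left_inv hps, hep] at this
    exact this (inter_mem (hVo.mem_nhds hpV) hW)
  obtain ⟨a, ha, hball⟩ := Metric.mem_nhds_iff.1 hnb
  have him : e.symm '' ball 0 a = e.source ∩ e ⁻¹' ball 0 a :=
    e.symm_image_eq_source_inter_preimage fun x hx => (hball hx).1
  have hcont : ContinuousOn e.symm (ball 0 a) := e.continuousOn_symm.mono fun x hx => (hball hx).1
  have hNV : ∀ w ∈ e.symm '' ball 0 a, w ∈ V ∧ w ∈ W := by
    rintro _ ⟨x, hx, rfl⟩; exact (hball hx).2
  have hsec : ∀ (S : Set ℂ) (T : Set ℝ), Convex ℝ T → (∀ w ∈ V, w ∈ S ↔ φ w ∈ T) →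
      IsPreconnected (e.symm '' ball 0 a ∩ S) := fun S T hT hST => by
    have : e.symm '' ball 0 a ∩ S = e.symm '' (ball 0 a ∩ {x | x.re ∈ T}) := by
      ext w
      constructor
      · rintro ⟨⟨x, hx, rfl⟩, hs⟩
        refine ⟨x, ⟨hx, ?_⟩, rfl⟩
        have := (hST _ (hball hx).2.1).1 hs
        rwa [← hre, e.right_inv (hball hx).1] at this
      · rintro ⟨x, ⟨hx, hs⟩, rfl⟩
        refine ⟨⟨x, hx, rfl⟩, (hST _ (hball hx).2.1).2 ?_⟩
        rwa [← hre, e.right_inv (hball hx).1]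
    rw [this]
    refine IsPreconnected.image ?_ _ (hcont.mono inter_subset_left)
    exact ((convex_ball _ _).inter (hT.is_linear_preimage reCLM.isLinear)).isPreconnected
  have e1 : ∀ w ∈ V, w ∈ posSet Ω u ↔ φ w ∈ Ioi (0 : ℝ) := fun w hw => by
      have := Set.ext_iff.1 h1 w; simp [hw] at this; exact this
  have e2 : ∀ w ∈ V, w ∈ FB Ω u ↔ φ w ∈ ({0} : Set ℝ) := fun w hw => by
      have := Set.ext_iff.1 h3 w; simp [hw] at this; exact this
  have e3 : ∀ w ∈ V, w ∈ (closure (posSet Ω u))ᶜ ↔ φ w ∈ Iio (0 : ℝ) := h4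
  refine ⟨e.symm '' ball 0 a, ?_, ?_, fun w hw => (hNV w hw).2, fun w hw => hVΩ (hNV w hw).1,
    hsec _ _ (convex_singleton 0) e2, hsec _ _ (convex_Ioi 0) e1, hsec _ _ (convex_Iio 0) e3, ?_⟩
  · rw [him]; exact e.isOpen_inter_preimage isOpen_ball
  · exact ⟨0, mem_ball_self ha, by rw [← hep, e.left_inv hps]⟩
  · rintro _ ⟨⟨x, hx, rfl⟩, hxF⟩
    have hx0 : x.re = 0 := by
      have := (e2 _ (hball hx).2.1).1 hxF
      rwa [← hre, e.right_inv (hball hx).1] at this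
    have ht : Tendsto (fun t : ℝ => x - t) (𝓝[>] 0) (𝓝 x) := by
      have : ContinuousAt (fun t : ℝ => x - t) 0 := by fun_prop
      simpa [ContinuousAt] using this.tendsto.mono_left nhdsWithin_le_nhds
    have ht2 := ((hcont x hx).continuousAt (isOpen_ball.mem_nhds hx)).tendsto.comp ht
    refine mem_closure_of_tendsto ht2 ?_
    filter_upwards [self_mem_nhdsWithin, ht (isOpen_ball.mem_nhds hx)] with t ht0 htb
    refine ⟨⟨_, htb, rfl⟩, (e3 _ (hball htb).2.1).2 ?_⟩
    rw [← hre]; simp only [Function.comp]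
    rw [e.right_inv (hball htb).1]
    simpa [hx0] using ht0
end

lemma ann_open (δ R : ℝ) : IsOpen (ann δ R) :=
  (isOpen_lt continuous_const continuous_norm).inter (isOpen_lt continuous_norm continuous_const)

lemma circ_of {δ R : ℝ} {F : Set ℂ} (hF : IsPreconnected F)
    (h1 : (closure F ∩ sphere 0 δ).Nonempty) (h2 : (closure F ∩ sphere 0 R).Nonempty) {r : ℝ}
    (hr : δ < r) (hr' : r < R) : ∃ z ∈ F, ‖z‖ = r := by
  obtain ⟨a, ha, ha'⟩ := h1
  obtain ⟨b, hb, hb'⟩ := h2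
  simp at ha' hb'
  obtain ⟨x, hx, hxF⟩ := mem_closure_iff.1 ha {z | ‖z‖ < r} (isOpen_lt continuous_norm continuous_const)
    (by simpa [ha'] using hr)
  obtain ⟨y, hy, hyF⟩ := mem_closure_iff.1 hb {z | r < ‖z‖} (isOpen_lt continuous_const continuous_norm)
    (by simpa [hb'] using hr')
  have := (hF.image _ continuous_norm.continuousOn).ordConnected.out (mem_image_of_mem _ hxF)
    (mem_image_of_mem _ hyF) ⟨le_of_lt hx, le_of_lt hy⟩
  obtain ⟨z, hz, hz'⟩ := this
  exact ⟨z, hz, hz'⟩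

structure Sol (δ R : ℝ) (u : ℂ → ℝ) (F G : Set ℂ) : Prop where
  hδ : 0 < δ
  h : IsClassicalSolution (ann δ R) u
  FG : F ∪ G = FB (ann δ R) u
  pF : IsPreconnected F
  pG : IsPreconnected G
  dj : Disjoint F G
  cF : ∀ p ∈ F, ∀ S ⊆ FB (ann δ R) u, IsPreconnected S → p ∈ S → S ⊆ F
  cG : ∀ p ∈ G, ∀ S ⊆ FB (ann δ R) u, IsPreconnected S → p ∈ S → S ⊆ G
  F1 : (closure F ∩ Metric.sphere 0 δ).Nonempty
  F2 : (closure F ∩ Metric.sphere 0 R).Nonempty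
  G1 : (closure G ∩ Metric.sphere 0 δ).Nonempty
  G2 : (closure G ∩ Metric.sphere 0 R).Nonempty

lemma Sol.mk' {δ R : ℝ} {u : ℂ → ℝ} (hδ : 0 < δ) (h : IsClassicalSolution (ann δ R) u)
    (hA : ConditionA δ R u) : ∃ F G, Sol δ R u F G := by
  obtain ⟨F, G, ⟨f, hf⟩, ⟨g, hg⟩, dj, FG, cF, cG, -, -, F1, F2, G1, G2⟩ := hA
  refine ⟨F, G, hδ, h, FG, ?_, ?_, dj, ?_, ?_, F1, F2, G1, G2⟩
  · rw [← cF f hf]; exact isPreconnected_connectedComponentIn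
  · rw [← cG g hg]; exact isPreconnected_connectedComponentIn
  · intro p hp S hS hSp hpS
    rw [← cF p hp]; exact hSp.subset_connectedComponentIn hpS hS
  · intro p hp S hS hSp hpS
    rw [← cG p hp]; exact hSp.subset_connectedComponentIn hpS hS

lemma touch {Ω : Set ℂ} {u : ℂ → ℝ} (hΩ : IsOpen Ω) (h : IsClassicalSolution Ω u) {x y : ℂ} {d : ℝ}
    (hd : 0 < d) (hb : ball x d ⊆ posSet Ω u) (hy : y ∈ FB Ω u) (hxy : ‖x - y‖ = d) :
    u x ≤ 4 * d := by
  have hD := posSet_open hΩ h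
  have hH := (harnack hd ((qq_hol hΩ h).mono hb) (fun z hz => qq_du hΩ h (hb hz))
    (fun z hz => (hb hz).2.le)).1
  obtain ⟨hyΩ, hyc, hyD⟩ := (FB_iff hΩ h).1 hy
  have hy0 := u_zero h hyΩ hyD
  have hev : ∀ᶠ w in 𝓝[posSet Ω u] y, ‖grad2 u w‖ < 2 :=
    (h.grad_one y hy).eventually_lt_const (by norm_num)
  rw [eventually_nhdsWithin_iff, Metric.eventually_nhds_iff] at hev
  obtain ⟨ε, hε, hev⟩ := hev
  let s : ℝ := min (1/2) (ε / (2 * d))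
  have hs : 0 < s := by positivity
  have hs1 : s ≤ 1/2 := min_le_left _ _
  have hs2 : s * d < ε := by
    have : s ≤ ε / (2 * d) := min_le_right _ _
    rw [le_div_iff₀ (by positivity)] at this
    nlinarith
  let γ : ℝ → ℂ := fun t => y + t * (x - y)
  have hγb : ∀ t, 0 < t → t ≤ s → γ t ∈ ball x d := fun t ht hts => by
    rw [mem_ball, dist_eq_norm, show γ t - x = ((t - 1 : ℝ) : ℂ) * (x - y) by simp [γ]; ring, norm_mul,
      hxy, norm_real, Real.norm_eq_abs, abs_of_neg (by linarith)]
    nlinarith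
  have hγ' : ∀ t, HasDerivAt γ (x - y) t := fun t => by
    simpa [γ] using ((ofRealCLM.hasDerivAt (x := t)).mul_const (x - y)).const_add y
  have hc : ContinuousOn (u ∘ γ) (Icc 0 s) := by
    refine h.contOn.comp (fun t _ => (hγ' t).continuousAt.continuousWithinAt) fun t ht => ?_
    rcases ht.1.eq_or_lt with h0 | h0
    · simpa [γ, ← h0] using hyΩ
    · exact (hb (hγb t h0 ht.2)).1
  obtain ⟨c, hc, hce⟩ := exists_hasDerivAt_eq_slope (u ∘ γ) (fun t => reL (qq u (γ t)) (x - y)) hs hc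
    fun t ht => (qq_du hΩ h (hb (hγb t ht.1 ht.2.le))).comp_hasDerivAt t (hγ' t)
  have hq : ‖qq u (γ c)‖ < 2 := by
    rw [qq_norm]
    refine hev ?_ (hb (hγb c hc.1 hc.2.le))
    rw [dist_eq_norm, show γ c - y = (c : ℂ) * (x - y) by simp [γ], norm_mul, hxy, norm_real,
      Real.norm_eq_abs, abs_of_pos hc.1]
    nlinarith [hc.2]
  have h3 : reL (qq u (γ c)) (x - y) ≤ 2 * d := by
    rw [reL_apply]
    refine (re_le_norm _).trans ?_
    rw [norm_mul, hxy]; gcongr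
  have h4 : u (γ s) ≤ 2 * d * s := by
    rw [hce] at h3
    simp only [Function.comp, sub_zero] at h3
    rw [show γ 0 = y by simp [γ], hy0, sub_zero, div_le_iff₀ hs] at h3
    exact h3
  have h5 := (hH (γ s) (hγb s hs le_rfl)).1
  rw [show γ s - x = ((s - 1 : ℝ) : ℂ) * (x - y) by simp [γ]; ring, norm_mul,
      hxy, norm_real, Real.norm_eq_abs, abs_of_neg (by linarith)] at h5
  have h6 : s * d * u x ≤ s * d * (4 * d) := by
    have : (d + -(s - 1) * d) * u (γ s) ≤ (2 * d) * (2 * d * s) := by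
      gcongr
      · have := (hb (hγb s hs le_rfl)).2; exact this.le
      · nlinarith
    nlinarith
  exact le_of_mul_le_mul_left h6 (by positivity)

noncomputable def CL : ℝ := 8 * 3 ^ 64

lemma CL_ge : 8 ≤ CL := by unfold CL; norm_num

section
variable {δ R : ℝ} {u : ℂ → ℝ} {F G : Set ℂ}

lemma Sol.o (h : Sol δ R u F G) : IsOpen (posSet (ann δ R) u) := posSet_open (ann_open _ _) h.h

lemma Sol.ex_touch (h : Sol δ R u F G) {x : ℂ} {d : ℝ} (hx : x ∈ posSet (ann δ R) u)
    (hd : ball x d ⊆ ann δ R) :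
    ball x d ⊆ posSet (ann δ R) u ∨ ∃ e > 0, e < d ∧ ball x e ⊆ posSet (ann δ R) u ∧
      u x ≤ 4 * e := by
  by_cases hc : ball x d ⊆ posSet (ann δ R) u
  · exact .inl hc
  right
  obtain ⟨w, hw, hwD⟩ := not_subset.1 hc
  have hcl : IsClosed (posSet (ann δ R) u)ᶜ := h.o.isClosed_compl
  obtain ⟨y, hy, hye⟩ := hcl.exists_infDist_eq_dist ⟨w, hwD⟩ x
  have hlt : infDist x (posSet (ann δ R) u)ᶜ < d :=
    (infDist_le_dist_of_mem hwD).trans_lt (by rwa [dist_comm])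
  have hpos : 0 < infDist x (posSet (ann δ R) u)ᶜ :=
    (hcl.notMem_iff_infDist_pos ⟨w, hwD⟩).1 (by simpa using hx)
  have hsub : ball x (infDist x (posSet (ann δ R) u)ᶜ) ⊆ posSet (ann δ R) u := fun z hz => by
    by_contra hz'
    have := infDist_le_dist_of_mem (x := x) (s := (posSet (ann δ R) u)ᶜ) hz'
    rw [mem_ball, dist_comm] at hz; linarith
  refine ⟨_, hpos, hlt, hsub, touch (ann_open _ _) h.h hpos hsub ((FB_iff (ann_open _ _) h.h).2
    ⟨hd ?_, ?_, hy⟩) ?_⟩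
  · rw [mem_ball, dist_comm, ← hye]; exact hlt
  · refine closure_mono hsub ?_
    rw [closure_ball _ hpos.ne', mem_closedBall, dist_comm, hye]
  · rw [hye, dist_eq_norm]

lemma ball_ann {x : ℂ} {d : ℝ} (h1 : δ + d ≤ ‖x‖) (h2 : ‖x‖ + d ≤ R) : ball x d ⊆ ann δ R := by
  intro z hz
  rw [mem_ball, dist_eq_norm] at hz
  have a := norm_sub_norm_le z x
  have b := norm_sub_norm_le x z
  rw [norm_sub_rev] at b
  exact ⟨by linarith, by linarith⟩

lemma Sol.step (h : Sol δ R u F G) {x w : ℂ} (h1 : 2 * δ ≤ ‖x‖) (h2 : ‖x‖ ≤ R / 2)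
    (hw : ‖w - x‖ ≤ ‖x‖ / 8) : u x ≤ max ‖x‖ (3 * u w) := by
  have hδ := h.hδ
  have hA : ball x (‖x‖ / 4) ⊆ ann δ R := ball_ann (by linarith) (by linarith)
  have hx : x ∈ ann δ R := ⟨by linarith, by linarith⟩
  by_cases hxD : x ∈ posSet (ann δ R) u
  swap
  · rw [u_zero h.h hx hxD]; exact le_max_of_le_left (norm_nonneg _)
  rcases h.ex_touch hxD hA with hb | ⟨e, he, hed, hb, hu⟩
  · have hH := (harnack (by linarith) ((qq_hol (ann_open _ _) h.h).mono hb)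
      (fun z hz => qq_du (ann_open _ _) h.h (hb hz)) (fun z hz => (hb hz).2.le)).1 w
      (by rw [mem_ball, dist_eq_norm]; linarith)
    have hwp : 0 < u w := (hb (show w ∈ _ by rw [mem_ball, dist_eq_norm]; linarith)).2
    refine le_max_of_le_right ?_
    have h3 := hH.1
    have hxp := hxD.2
    have h5 : ‖x‖ / 8 * u x ≤ ‖x‖ / 8 * (3 * u w) := by nlinarith
    exact le_of_mul_le_mul_left h5 (by linarith)
  · exact le_max_of_le_left (by linarith)

lemma Sol.ub (h : Sol δ R u F G) {x : ℂ} (h1 : 2 * δ ≤ ‖x‖) (h2 : ‖x‖ ≤ R / 2) :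
    u x ≤ 3 ^ 64 * ‖x‖ := by
  have hδ := h.hδ
  obtain ⟨y, hyF, hy⟩ := circ_of h.pF h.F1 h.F2 (r := ‖x‖) (by linarith) (by linarith)
  have hy0 : u y = 0 := by
    have := (FB_iff (ann_open _ _) h.h).1 (h.FG.subset (mem_union_left G hyF))
    exact u_zero h.h this.1 this.2.2
  let α : ℝ := (arg x - arg y) / 64
  have hα : |α| ≤ 1 / 8 := by
    simp only [α]
    rw [abs_div, abs_of_pos (by norm_num : (0:ℝ) < 64), div_le_iff₀ (by norm_num), abs_le]
    have := arg_le_pi x; have := neg_pi_lt_arg x; have := arg_le_pi y; have := neg_pi_lt_arg y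
    have := Real.pi_lt_d2
    constructor <;> linarith
  let p : ℕ → ℂ := fun j => y * exp (I * ((j * α : ℝ) : ℂ))
  have hpn : ∀ j, ‖p j‖ = ‖x‖ := fun j => by
    simp only [p]; rw [norm_mul, mul_comm I, norm_exp_ofReal_mul_I, hy, mul_one]
  have hst : ∀ j, ‖p j - p (j+1)‖ ≤ ‖x‖ / 8 := fun j => by
    have : p (j+1) = p j * exp (I * α) := by
      simp only [p]; rw [mul_assoc, ← Complex.exp_add]; push_cast; ring_nf
    rw [norm_sub_rev, this, ← mul_sub_one, norm_mul, hpn]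
    have := Real.norm_exp_I_mul_ofReal_sub_one_le (x := α)
    rw [Real.norm_eq_abs] at this
    nlinarith [norm_nonneg x]
  have hind : ∀ j, u (p j) ≤ 3 ^ j * ‖x‖ := by
    intro j
    induction j with
    | zero => simp [p, hy0]
    | succ j ih =>
      refine (h.step (w := p j) (by rwa [hpn]) (by rwa [hpn]) (by rw [hpn]; exact hst j)).trans ?_
      rw [hpn, max_le_iff]
      have : (1:ℝ) ≤ 3 ^ (j+1) := one_le_pow₀ (by norm_num)
      constructor
      · nlinarith [norm_nonneg x]
      · rw [pow_succ]; linarith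
  have hx : p 64 = x := by
    simp only [p, α]
    have hy' : y = ‖x‖ * exp (arg y * I) := by rw [← hy, norm_mul_exp_arg_mul_I]
    rw [hy', mul_assoc, ← Complex.exp_add]
    rw [← hy']
    conv_rhs => rw [← norm_mul_exp_arg_mul_I x]
    congr 2
    push_cast; ring
  rw [← hx]; simpa [hx] using hind 64

lemma Sol.qb (h : Sol δ R u F G) {x : ℂ} (h1 : 2 * δ ≤ ‖x‖) (h2 : ‖x‖ ≤ R / 2)
    (hxD : x ∈ posSet (ann δ R) u) : ‖qq u x‖ ≤ CL := by
  have hδ := h.hδ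
  have hA : ball x (‖x‖ / 4) ⊆ ann δ R := ball_ann (by linarith) (by linarith)
  have key : ∀ e > 0, ball x e ⊆ posSet (ann δ R) u → ‖qq u x‖ * e ≤ 2 * u x := fun e he hb =>
    (harnack he ((qq_hol (ann_open _ _) h.h).mono hb)
      (fun z hz => qq_du (ann_open _ _) h.h (hb hz)) (fun z hz => (hb hz).2.le)).2
  rcases h.ex_touch hxD hA with hb | ⟨e, he, hed, hb, hu⟩
  · have h3 := key _ (by linarith) hb
    have h4 := h.ub h1 h2
    have h5 : ‖qq u x‖ * (‖x‖ / 4) ≤ CL * (‖x‖ / 4) := by unfold CL; linarith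
    exact le_of_mul_le_mul_right h5 (by linarith)
  · have h3 := key _ he hb
    have : ‖qq u x‖ * e ≤ 8 * e := by linarith
    exact (le_of_mul_le_mul_right this he).trans CL_ge
end

noncomputable def bdI (f : ℂ → ℂ) (x0 x1 y0 y1 : ℝ) : ℂ :=
  (∫ x : ℝ in x0..x1, f (x + y0 * I)) - (∫ x : ℝ in x0..x1, f (x + y1 * I)) +
      I • (∫ y : ℝ in y0..y1, f (x1 + y * I)) - I • ∫ y : ℝ in y0..y1, f (x0 + y * I)

section
variable {S : Set ℂ} {U : ℂ → ℝ} {Q K : ℂ → ℂ} {g : ℝ → ℝ} {ε : ℝ}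

lemma cont_cut (hS : IsOpen S) (hU : ContinuousOn U S) (hK : ContinuousOn K {ζ ∈ S | 0 < U ζ})
    (hg : Continuous g) (hε : 0 < ε) (hg0 : ∀ t < ε, g t = 0) :
    ContinuousOn (fun ζ => (g (U ζ) : ℂ) * K ζ) S := by
  intro ζ hζ
  refine ContinuousAt.continuousWithinAt ?_
  have hUc : ContinuousAt U ζ := hU.continuousAt (hS.mem_nhds hζ)
  by_cases hp : 0 < U ζ
  · have : {ζ ∈ S | 0 < U ζ} ∈ 𝓝 ζ := inter_mem (hS.mem_nhds hζ) (hUc (Ioi_mem_nhds hp))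
    exact (continuous_ofReal.continuousAt.comp (hg.continuousAt.comp hUc)).mul (hK.continuousAt this)
  · refine (continuousAt_const (y := (0 : ℂ))).congr ?_
    filter_upwards [hUc (Iio_mem_nhds (show U ζ < ε by linarith))] with w hw
    rw [hg0 _ hw]; simp

lemma green (hS : IsOpen S) (hU : ContinuousOn U S)
    (hdU : ∀ ζ ∈ S, 0 < U ζ → HasFDerivAt U (reL (Q ζ)) ζ)
    (hQ : ContinuousOn Q {ζ ∈ S | 0 < U ζ}) (hK : DifferentiableOn ℂ K {ζ ∈ S | 0 < U ζ})
    (hg : ContDiff ℝ 1 g) (hε : 0 < ε) (hg0 : ∀ t < ε, g t = 0) {x0 x1 y0 y1 : ℝ}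
    (hR : uIcc x0 x1 ×ℂ uIcc y0 y1 ⊆ S) :
    bdI (fun ζ => g (U ζ) * K ζ) x0 x1 y0 y1 = ∫ x : ℝ in x0..x1, ∫ y : ℝ in y0..y1,
      I * (((deriv g (U (x + y * I)) : ℝ) : ℂ) * (K (x + y * I) * conj (Q (x + y * I)))) := by
  have hg' : ∀ t < ε, deriv g t = 0 := fun t ht => by
    have : g =ᶠ[𝓝 t] fun _ => (0 : ℝ) := by filter_upwards [Iio_mem_nhds ht] with s hs using hg0 s hs
    rw [this.deriv_eq]; simp
  let f' : ℂ → ℂ →L[ℝ] ℂ := fun ζ => if 0 < U ζ then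
    (g (U ζ) : ℂ) • (ContinuousLinearMap.toSpanSingleton ℂ (deriv K ζ)).restrictScalars ℝ +
      ((ofRealCLM.comp (deriv g (U ζ) • reL (Q ζ))).smulRight (K ζ)) else 0
  have hf' : ∀ ζ, I • f' ζ 1 - f' ζ I = I * (((deriv g (U ζ) : ℝ) : ℂ) * (K ζ * conj (Q ζ))) := fun ζ => by
    by_cases hp : 0 < U ζ
    · simp [f', hp]
      apply Complex.ext <;> simp <;> ring
    · simp [f', hp, hg' (U ζ) (by linarith)]
  have hcc : ContinuousOn (fun ζ => ((deriv g (U ζ) : ℝ) : ℂ) * (K ζ * conj (Q ζ))) S :=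
    cont_cut hS hU (hK.continuousOn.mul (continuous_conj.comp_continuousOn hQ))
      (hg.continuous_deriv le_rfl) hε hg'
  have key := Complex.integral_boundary_rect_of_hasFDerivAt_real_off_countable
    (fun ζ => (g (U ζ) : ℂ) * K ζ) f' ⟨x0, y0⟩ ⟨x1, y1⟩ ∅ countable_empty
    ((cont_cut hS hU hK.continuousOn hg.continuous hε hg0).mono hR) ?_ ?_
  · simp only [hf'] at key
    exact key
  · rintro ζ ⟨hζ, -⟩
    have hζS : ζ ∈ S := hR ⟨Ioo_subset_Icc_self hζ.1, Ioo_subset_Icc_self hζ.2⟩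
    have hUc : ContinuousAt U ζ := hU.continuousAt (hS.mem_nhds hζS)
    by_cases hp : 0 < U ζ
    · simp only [f', hp, if_true]
      have hn : {ζ ∈ S | 0 < U ζ} ∈ 𝓝 ζ := inter_mem (hS.mem_nhds hζS) (hUc (Ioi_mem_nhds hp))
      have h1 : HasFDerivAt (fun ζ => (g (U ζ) : ℂ)) (ofRealCLM.comp (deriv g (U ζ) • reL (Q ζ))) ζ := by
        have a := (hg.differentiable one_ne_zero (U ζ)).hasDerivAt.comp_hasFDerivAt ζ (hdU ζ hζS hp)
        exact ofRealCLM.hasFDerivAt.comp ζ a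
      have h2 : HasFDerivAt K ((ContinuousLinearMap.toSpanSingleton ℂ (deriv K ζ)).restrictScalars ℝ) ζ :=
        (hK.differentiableAt hn).hasDerivAt.hasFDerivAt.restrictScalars ℝ
      exact h1.mul' h2 |>.congr_fderiv (by ext x; simp; ring)
    · simp only [f', hp, if_false]
      refine (hasFDerivAt_const (0 : ℂ) ζ).congr_of_eventuallyEq ?_
      filter_upwards [hUc (Iio_mem_nhds (show U ζ < ε by linarith))] with w hw
      rw [hg0 _ hw]; simp
  · simp only [hf']
    refine ContinuousOn.integrableOn_compact ?_ ((continuousOn_const.mul hcc).mono hR)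
    exact isCompact_uIcc.reProdIm isCompact_uIcc

end

noncomputable def gt (ε t : ℝ) : ℝ := Real.smoothTransition (2 * t / ε - 1)

lemma gt_cd (ε : ℝ) : ContDiff ℝ 1 (gt ε) := by
  unfold gt
  exact (Real.smoothTransition.contDiff (n := 1)).comp (by fun_prop)

lemma gt_zero {ε : ℝ} (hε : 0 < ε) : ∀ t < ε / 2, gt ε t = 0 := fun t ht => by
  refine Real.smoothTransition.zero_of_nonpos ?_
  rw [sub_nonpos, div_le_one hε]; linarith

lemma gt_one {ε t : ℝ} (hε : 0 < ε) (ht : ε ≤ t) : gt ε t = 1 := by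
  refine Real.smoothTransition.one_of_one_le ?_
  rw [le_sub_iff_add_le, le_div_iff₀ hε]; linarith

lemma gt_mono {ε : ℝ} (hε : 0 < ε) : Monotone (gt ε) := fun s t hst => by
  refine Real.smoothTransition.monotone ?_
  gcongr

lemma gt_d {ε : ℝ} (hε : 0 < ε) (t : ℝ) : 0 ≤ deriv (gt ε) t := (gt_mono hε).deriv_nonneg

lemma gt_d0 {ε t : ℝ} (hε : 0 < ε) (ht : t < ε / 2 ∨ ε < t) : deriv (gt ε) t = 0 := by
  rcases ht with ht | ht
  · have : gt ε =ᶠ[𝓝 t] fun _ => (0 : ℝ) := by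
      filter_upwards [Iio_mem_nhds ht] with s hs using gt_zero hε s hs
    rw [this.deriv_eq]; simp
  · have : gt ε =ᶠ[𝓝 t] fun _ => (1 : ℝ) := by
      filter_upwards [Ioi_mem_nhds ht] with s hs using gt_one hε (le_of_lt hs)
    rw [this.deriv_eq]; simp

lemma gt_01 (ε t : ℝ) : 0 ≤ gt ε t ∧ gt ε t ≤ 1 :=
  ⟨Real.smoothTransition.nonneg _, Real.smoothTransition.le_one _⟩

lemma unif_one {Ω : Set ℂ} {u : ℂ → ℝ} (hΩ : IsOpen Ω) (h : IsClassicalSolution Ω u) {C : Set ℂ}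
    (hC : IsCompact C) (hCΩ : C ⊆ Ω) {η : ℝ} (hη : 0 < η) :
    ∃ ε0 > 0, ∀ z ∈ C, 0 < u z → u z ≤ ε0 → |‖qq u z‖ - 1| < η := by
  have := hC.induction_on (p := fun s => ∃ ε0 > 0, ∀ z ∈ s ∩ Ω, 0 < u z → u z ≤ ε0 → |‖qq u z‖ - 1| < η)
    ⟨1, one_pos, by simp⟩
    (fun s t hst ⟨e, he, h⟩ => ⟨e, he, fun z hz => h z ⟨hst hz.1, hz.2⟩⟩)
    (fun s t ⟨e, he, h⟩ ⟨e', he', h'⟩ => ⟨min e e', lt_min he he', fun z hz a b => by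
      rcases hz.1 with hh | hh
      · exact h z ⟨hh, hz.2⟩ a (b.trans (min_le_left _ _))
      · exact h' z ⟨hh, hz.2⟩ a (b.trans (min_le_right _ _))⟩) ?_
  · obtain ⟨e, he, h⟩ := this
    exact ⟨e, he, fun z hz => h z ⟨hz, hCΩ hz⟩⟩
  intro z hz
  have hzΩ := hCΩ hz
  by_cases hzD : z ∈ posSet Ω u
  · refine ⟨{w | u z / 2 < u w}, mem_nhdsWithin_of_mem_nhds
      ((h.contOn.continuousAt (hΩ.mem_nhds hzΩ)) (Ioi_mem_nhds (half_lt_self hzD.2))), u z / 2,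
      half_pos hzD.2, fun w hw _ hle => ?_⟩
    exact absurd hle (not_le.2 hw.1)
  by_cases hzc : z ∈ closure (posSet Ω u)
  · have h1 := h.grad_one z ((FB_iff hΩ h).2 ⟨hzΩ, hzc, hzD⟩)
    have h2 := h1.eventually (Metric.ball_mem_nhds 1 hη)
    rw [eventually_nhdsWithin_iff] at h2
    refine ⟨_, mem_nhdsWithin_of_mem_nhds h2, 1, one_pos, fun w hw hp _ => ?_⟩
    have := hw.1 ⟨hw.2, hp⟩
    rwa [Real.dist_eq, ← qq_norm] at this
  · refine ⟨_, mem_nhdsWithin_of_mem_nhds (isClosed_closure.isOpen_compl.mem_nhds hzc), 1, one_pos,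
      fun w hw hp _ => ?_⟩
    exact absurd (subset_closure (show w ∈ posSet Ω u from ⟨hw.2, hp⟩)) hw.1

noncomputable def int2 {E : Type*} [NormedAddCommGroup E] [NormedSpace ℝ E] (H : ℂ → E)
    (x0 x1 y0 y1 : ℝ) : E := ∫ x : ℝ in x0..x1, ∫ y : ℝ in y0..y1, H (x + y * I)

section
variable {E : Type*} [NormedAddCommGroup E] [NormedSpace ℝ E] {x0 x1 y0 y1 : ℝ}

lemma mem_rect {x y : ℝ} (hx : x ∈ Icc x0 x1) (hy : y ∈ Icc y0 y1) :
    (x + y * I : ℂ) ∈ Icc x0 x1 ×ℂ Icc y0 y1 := by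
  simp only [mem_reProdIm]; simpa using ⟨hx, hy⟩

lemma cont_in {H : ℂ → E} (hH : ContinuousOn H (Icc x0 x1 ×ℂ Icc y0 y1)) (hy : y0 ≤ y1) {x : ℝ}
    (hx : x ∈ Icc x0 x1) : IntervalIntegrable (fun y : ℝ => H (x + y * I)) volume y0 y1 := by
  refine ContinuousOn.intervalIntegrable_of_Icc hy (hH.comp (by fun_prop) fun y hy => mem_rect hx hy)

lemma cont_par [CompleteSpace E] {H : ℂ → E} (hH : ContinuousOn H (Icc x0 x1 ×ℂ Icc y0 y1)) (hx : x0 ≤ x1) (hy : y0 ≤ y1) :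
    IntervalIntegrable (fun x : ℝ => ∫ y : ℝ in y0..y1, H (x + y * I)) volume x0 x1 := by
  let p : ℝ × ℝ → ℂ := fun z => ((projIcc x0 x1 hx z.1 : ℝ) : ℂ) + ((projIcc y0 y1 hy z.2 : ℝ) : ℂ) * I
  have hp : Continuous p := by
    have := (continuous_projIcc (h := hx)).comp continuous_fst (X := ℝ × ℝ)
    have := (continuous_projIcc (h := hy)).comp continuous_snd (X := ℝ × ℝ)
    simp only [p]; fun_prop
  have hc : Continuous (H ∘ p) := hH.comp_continuous hp fun z => mem_rect (Subtype.mem _) (Subtype.mem _)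
  have := intervalIntegral.continuous_parametric_intervalIntegral_of_continuous' (μ := volume)
    (f := fun x y => (H ∘ p) (x, y)) hc y0 y1
  refine (this.continuousOn (s := Icc x0 x1)).congr (fun x hx' => ?_) |>.intervalIntegrable_of_Icc hx
  refine intervalIntegral.integral_congr fun y hy' => ?_
  rw [uIcc_of_le hy] at hy'
  simp [p, projIcc_of_mem hx hx', projIcc_of_mem hy hy']

lemma int2_le [CompleteSpace E] {f : ℂ → E} {h : ℂ → ℝ} (hx : x0 ≤ x1) (hy : y0 ≤ y1)
    (hh : ContinuousOn h (Icc x0 x1 ×ℂ Icc y0 y1)) (hf : ∀ ζ ∈ Icc x0 x1 ×ℂ Icc y0 y1, ‖f ζ‖ ≤ h ζ) :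
    ‖int2 f x0 x1 y0 y1‖ ≤ int2 h x0 x1 y0 y1 := by
  refine intervalIntegral.norm_integral_le_of_norm_le hx (.of_forall fun x hx' => ?_) (cont_par hh hx hy)
  refine intervalIntegral.norm_integral_le_of_norm_le hy (.of_forall fun y hy' => ?_)
    (cont_in hh hy (Ioc_subset_Icc_self hx'))
  exact hf _ (mem_rect (Ioc_subset_Icc_self hx') (Ioc_subset_Icc_self hy'))

lemma int2_add [CompleteSpace E] {f g : ℂ → E} (hx : x0 ≤ x1) (hy : y0 ≤ y1)
    (hf : ContinuousOn f (Icc x0 x1 ×ℂ Icc y0 y1)) (hg : ContinuousOn g (Icc x0 x1 ×ℂ Icc y0 y1)) :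
    int2 (fun ζ => f ζ + g ζ) x0 x1 y0 y1 = int2 f x0 x1 y0 y1 + int2 g x0 x1 y0 y1 := by
  unfold int2
  rw [← intervalIntegral.integral_add (cont_par hf hx hy) (cont_par hg hx hy)]
  refine intervalIntegral.integral_congr fun x hx' => ?_
  rw [uIcc_of_le hx] at hx'
  exact intervalIntegral.integral_add (cont_in hf hy hx') (cont_in hg hy hx')

lemma ii_conj (f : ℝ → ℂ) (a b : ℝ) : conj (∫ x in a..b, f x) = ∫ x in a..b, conj (f x) := by
  simp only [intervalIntegral, map_sub, integral_conj]

lemma int2_conj (f : ℂ → ℂ) : conj (int2 f x0 x1 y0 y1) = int2 (fun ζ => conj (f ζ)) x0 x1 y0 y1 := by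
  simp only [int2, ii_conj]

lemma int2_ofReal (f : ℂ → ℝ) :
    int2 (fun ζ => (f ζ : ℂ)) x0 x1 y0 y1 = (int2 f x0 x1 y0 y1 : ℝ) := by
  simp only [int2, intervalIntegral.integral_ofReal]

lemma int2_mul (c : ℂ) (f : ℂ → ℂ) :
    int2 (fun ζ => c * f ζ) x0 x1 y0 y1 = c * int2 f x0 x1 y0 y1 := by
  simp only [int2, intervalIntegral.integral_const_mul]

lemma int2_rmul (c : ℝ) (f : ℂ → ℝ) :
    int2 (fun ζ => c * f ζ) x0 x1 y0 y1 = c * int2 f x0 x1 y0 y1 := by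
  simp only [int2, intervalIntegral.integral_const_mul]

noncomputable def bd1 (A B : ℂ → ℂ) (x0 x1 y0 y1 : ℝ) : ℂ :=
  (∫ x : ℝ in x0..x1, A (x + y0 * I)) - (∫ x : ℝ in x0..x1, A (x + y1 * I)) +
      (∫ y : ℝ in y0..y1, B (x1 + y * I)) - ∫ y : ℝ in y0..y1, B (x0 + y * I)

lemma bd1_split {S : Set ℂ} {f g : ℂ → ℂ} (hf : ContinuousOn f S) (hg : ContinuousOn g S)
    (hx : x0 ≤ x1) (hy : y0 ≤ y1) (hS : Icc x0 x1 ×ℂ Icc y0 y1 ⊆ S) :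
    bd1 (fun ζ => f ζ + conj (g ζ)) (fun ζ => I * f ζ - I * conj (g ζ)) x0 x1 y0 y1 =
      bdI f x0 x1 y0 y1 + conj (bdI g x0 x1 y0 y1) := by
  have hf := hf.mono hS
  have hg : ContinuousOn (fun ζ => conj (g ζ)) _ := continuous_conj.comp_continuousOn (hg.mono hS)
  have hor : ∀ {k : ℂ → ℂ}, ContinuousOn k (Icc x0 x1 ×ℂ Icc y0 y1) → ∀ y ∈ Icc y0 y1,
      IntervalIntegrable (fun x : ℝ => k (x + y * I)) volume x0 x1 := fun hk y hy =>
    ContinuousOn.intervalIntegrable_of_Icc hx (hk.comp (by fun_prop) fun x hx => mem_rect hx hy)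
  have a1 : y0 ∈ Icc y0 y1 := left_mem_Icc.2 hy
  have a2 : y1 ∈ Icc y0 y1 := right_mem_Icc.2 hy
  have a3 : x0 ∈ Icc x0 x1 := left_mem_Icc.2 hx
  have a4 : x1 ∈ Icc x0 x1 := right_mem_Icc.2 hx
  unfold bd1 bdI
  rw [intervalIntegral.integral_add (hor hf _ a1) (hor hg _ a1),
    intervalIntegral.integral_add (hor hf _ a2) (hor hg _ a2),
    intervalIntegral.integral_sub ((cont_in hf hy a3).const_mul _) ((cont_in hg hy a3).const_mul _),
    intervalIntegral.integral_sub ((cont_in hf hy a4).const_mul _) ((cont_in hg hy a4).const_mul _)]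
  simp only [smul_eq_mul, map_add, map_sub, map_mul, ii_conj, conj_I,
    intervalIntegral.integral_const_mul]
  ring

lemma bdI_norm {f : ℂ → ℂ} {C : ℝ} (hx : x0 ≤ x1) (hy : y0 ≤ y1)
    (hf : ∀ ζ ∈ Icc x0 x1 ×ℂ Icc y0 y1, ‖f ζ‖ ≤ C) :
    ‖bdI f x0 x1 y0 y1‖ ≤ 2 * C * ((x1 - x0) + (y1 - y0)) := by
  have a1 : y0 ∈ Icc y0 y1 := left_mem_Icc.2 hy
  have a2 : y1 ∈ Icc y0 y1 := right_mem_Icc.2 hy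
  have a3 : x0 ∈ Icc x0 x1 := left_mem_Icc.2 hx
  have a4 : x1 ∈ Icc x0 x1 := right_mem_Icc.2 hx
  have h1 : ∀ y ∈ Icc y0 y1, ‖∫ x : ℝ in x0..x1, f (x + y * I)‖ ≤ C * (x1 - x0) := fun y hy => by
    have := intervalIntegral.norm_integral_le_of_norm_le_const (a := x0) (b := x1) (C := C)
      (f := fun x : ℝ => f (x + y * I)) fun x hx' => by
        rw [uIoc_of_le hx] at hx'; exact hf _ (mem_rect (Ioc_subset_Icc_self hx') hy)
    rwa [abs_of_nonneg (by linarith)] at this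
  have h2 : ∀ x ∈ Icc x0 x1, ‖I • ∫ y : ℝ in y0..y1, f (x + y * I)‖ ≤ C * (y1 - y0) := fun x hx => by
    have := intervalIntegral.norm_integral_le_of_norm_le_const (a := y0) (b := y1) (C := C)
      (f := fun y : ℝ => f (x + y * I)) fun y hy' => by
        rw [uIoc_of_le hy] at hy'; exact hf _ (mem_rect hx (Ioc_subset_Icc_self hy'))
    rwa [abs_of_nonneg (by linarith), ← one_mul ‖_‖, ← norm_I, ← norm_smul] at this
  unfold bdI
  refine (norm_sub_le _ _).trans ?_
  refine (add_le_add_left ((norm_add_le _ _).trans (add_le_add_left (norm_sub_le _ _) _)) _).trans ?_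
  linarith [h1 _ a1, h1 _ a2, h2 _ a3, h2 _ a4]
end

section
variable {δ R : ℝ} {u : ℂ → ℝ} {F G : Set ℂ}

def I0 (δ R : ℝ) : Set ℝ := {x | δ < Real.exp x ∧ Real.exp x < R}

lemma I0_ord {x0 x1 x : ℝ} (h0 : x0 ∈ I0 δ R) (h1 : x1 ∈ I0 δ R) (hx : x ∈ Icc x0 x1) : x ∈ I0 δ R :=
  ⟨h0.1.trans_le (Real.exp_le_exp.2 hx.1), (Real.exp_le_exp.2 hx.2).trans_lt h1.2⟩

noncomputable def tD (δ R : ℝ) (u : ℂ → ℝ) : Set ℂ := exp ⁻¹' posSet (ann δ R) u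

noncomputable def K1 (u : ℂ → ℝ) (ζ : ℂ) : ℂ := qq u (exp ζ) ^ 2 * exp ζ
noncomputable def tQ (u : ℂ → ℝ) (ζ : ℂ) : ℂ := qq u (exp ζ) * exp ζ

noncomputable def aA (δ R : ℝ) (u : ℂ → ℝ) (ζ : ℂ) : ℂ :=
  if ζ ∈ tD δ R u then K1 u ζ + conj (exp ζ) else 0
noncomputable def aB (δ R : ℝ) (u : ℂ → ℝ) (ζ : ℂ) : ℂ :=
  if ζ ∈ tD δ R u then I * K1 u ζ - I * conj (exp ζ) else 0

lemma tD_eq : tD δ R u = {ζ ∈ exp ⁻¹' ann δ R | 0 < u (exp ζ)} := rfl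

lemma Sol.tDo (h : Sol δ R u F G) : IsOpen (tD δ R u) := h.o.preimage continuous_exp

lemma Sol.tU (h : Sol δ R u F G) : ContinuousOn (fun ζ => u (exp ζ)) (exp ⁻¹' ann δ R) :=
  h.h.contOn.comp continuous_exp.continuousOn fun _ h => h

lemma So : IsOpen (exp ⁻¹' ann δ R) := (ann_open δ R).preimage continuous_exp

lemma Sol.tqd (h : Sol δ R u F G) : DifferentiableOn ℂ (fun ζ => qq u (exp ζ)) (tD δ R u) :=
  (qq_hol (ann_open _ _) h.h).comp differentiable_exp.differentiableOn fun _ h => h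

lemma Sol.tK1 (h : Sol δ R u F G) : DifferentiableOn ℂ (K1 u) (tD δ R u) :=
  (h.tqd.pow 2).mul differentiable_exp.differentiableOn

lemma Sol.ttQ (h : Sol δ R u F G) : DifferentiableOn ℂ (tQ u) (tD δ R u) :=
  h.tqd.mul differentiable_exp.differentiableOn

lemma Sol.tdU (h : Sol δ R u F G) {ζ : ℂ} (hζ : ζ ∈ tD δ R u) :
    HasFDerivAt (fun ζ => u (exp ζ)) (reL (tQ u ζ)) ζ := by
  have := (qq_du (ann_open _ _) h.h hζ).comp ζ ((hasDerivAt_exp ζ).hasFDerivAt.restrictScalars ℝ)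
  refine this.congr_fderiv ?_
  ext x; simp [tQ]; ring_nf

lemma I0_ann {ζ : ℂ} (hζ : ζ.re ∈ I0 δ R) : exp ζ ∈ ann δ R := by
  constructor <;> rw [norm_exp]
  exacts [hζ.1, hζ.2]

lemma loc_bd {Ω : Set ℂ} (hΩ : IsOpen Ω) (h : IsClassicalSolution Ω u) {C : Set ℂ}
    (hC : IsCompact C) (hCΩ : C ⊆ Ω) : ∃ M ≥ 0, ∀ z ∈ C, z ∈ posSet Ω u → ‖qq u z‖ ≤ M := by
  refine hC.induction_on (p := fun s => ∃ M ≥ 0, ∀ z ∈ s, z ∈ posSet Ω u → ‖qq u z‖ ≤ M)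
    ⟨0, le_rfl, by simp⟩
    (fun s t hst ⟨e, he, h⟩ => ⟨e, he, fun z hz => h z (hst hz)⟩)
    (fun s t ⟨e, he, h⟩ ⟨e', he', h'⟩ => ⟨max e e', he.trans (le_max_left _ _), fun z hz a => by
      rcases hz with hh | hh
      · exact (h z hh a).trans (le_max_left _ _)
      · exact (h' z hh a).trans (le_max_right _ _)⟩) fun z hz => ?_
  have hzΩ := hCΩ hz
  by_cases hzD : z ∈ posSet Ω u
  · have hc := ((qq_hol hΩ h).continuousOn.continuousAt ((posSet_open hΩ h).mem_nhds hzD)).norm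
    refine ⟨_, mem_nhdsWithin_of_mem_nhds (hc (Iio_mem_nhds (lt_add_one _))), ‖qq u z‖ + 1, by positivity,
      fun w hw _ => le_of_lt hw⟩
  by_cases hzc : z ∈ closure (posSet Ω u)
  · have h2 := (h.grad_one z ((FB_iff hΩ h).2 ⟨hzΩ, hzc, hzD⟩)).eventually (Iio_mem_nhds (one_lt_two))
    rw [eventually_nhdsWithin_iff] at h2
    refine ⟨_, mem_nhdsWithin_of_mem_nhds h2, 2, by norm_num, fun w hw hp => ?_⟩
    rw [qq_norm]; exact le_of_lt (hw hp)
  · refine ⟨_, mem_nhdsWithin_of_mem_nhds (isClosed_closure.isOpen_compl.mem_nhds hzc), 0, le_rfl,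
      fun w hw hp => ?_⟩
    exact absurd (subset_closure hp) hw

lemma Sol.tqc (h : Sol δ R u F G) {x0 x1 : ℝ} (hx0 : x0 ∈ I0 δ R) (hx1 : x1 ∈ I0 δ R) :
    ∃ C ≥ 0, ∀ ζ ∈ tD δ R u, ζ.re ∈ Icc x0 x1 → ‖qq u (exp ζ)‖ ≤ C := by
  obtain ⟨M, hM, hb⟩ := loc_bd (ann_open _ _) h.h (C := closedBall 0 (Real.exp x1) ∩ {z | Real.exp x0 ≤ ‖z‖})
    ((isCompact_closedBall _ _).inter_right (isClosed_le continuous_const continuous_norm))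
    (fun z hz => ⟨hx0.1.trans_le hz.2, lt_of_le_of_lt (by simpa using hz.1) hx1.2⟩)
  refine ⟨M, hM, fun ζ hD hI => hb _ ⟨?_, ?_⟩ hD⟩
  · simpa [norm_exp] using hI.2
  · simpa [norm_exp] using hI.1

lemma Sol.tqb (h : Sol δ R u F G) {ζ : ℂ} (h1 : 2 * δ ≤ Real.exp ζ.re) (h2 : Real.exp ζ.re ≤ R / 2)
    (hD : ζ ∈ tD δ R u) :
    ‖qq u (exp ζ)‖ ≤ CL := h.qb (by rw [norm_exp]; exact h1) (by rw [norm_exp]; exact h2) hD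

lemma Sol.green (h : Sol δ R u F G) {K : ℂ → ℂ} (hK : DifferentiableOn ℂ K (tD δ R u)) {ε : ℝ} (hε : 0 < ε)
    {x0 x1 y0 y1 : ℝ} (hx0 : x0 ∈ I0 δ R) (hx1 : x1 ∈ I0 δ R) (hx : x0 ≤ x1) (hy : y0 ≤ y1) :
    bdI (fun ζ => gt ε (u (exp ζ)) * K ζ) x0 x1 y0 y1 =
      int2 (fun ζ => I * (((deriv (gt ε) (u (exp ζ)) : ℝ) : ℂ) * (K ζ * conj (tQ u ζ)))) x0 x1 y0 y1 := by
  refine _root_.green (S := exp ⁻¹' ann δ R) So h.tU (fun ζ hζ hp => h.tdU ⟨hζ, hp⟩)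
    h.ttQ.continuousOn hK (gt_cd ε) (half_pos hε) (gt_zero hε) ?_
  rw [uIcc_of_le hx, uIcc_of_le hy]
  exact fun ζ hζ => I0_ann (I0_ord hx0 hx1 hζ.1)

lemma Sol.dcont (h : Sol δ R u F G) {K : ℂ → ℂ} (hK : ContinuousOn K (tD δ R u)) {ε : ℝ} (hε : 0 < ε)
    {x0 x1 y0 y1 : ℝ} (hx0 : x0 ∈ I0 δ R) (hx1 : x1 ∈ I0 δ R)  :
    ContinuousOn (fun ζ => (((deriv (gt ε) (u (exp ζ)) : ℝ) : ℂ) * K ζ)) (Icc x0 x1 ×ℂ Icc y0 y1) := by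
  refine (cont_cut (S := exp ⁻¹' ann δ R) So h.tU hK ((gt_cd ε).continuous_deriv le_rfl) (half_pos hε)
    fun t ht => gt_d0 hε (.inl ht)).mono ?_
  exact fun ζ hζ => I0_ann (I0_ord hx0 hx1 hζ.1)

lemma Sol.gcont (h : Sol δ R u F G) {K : ℂ → ℂ} (hK : ContinuousOn K (tD δ R u)) {ε : ℝ} (hε : 0 < ε) :
    ContinuousOn (fun ζ => ((gt ε (u (exp ζ)) : ℂ) * K ζ)) (exp ⁻¹' ann δ R) :=
  cont_cut (S := exp ⁻¹' ann δ R) So h.tU hK (gt_cd ε).continuous (half_pos hε) (gt_zero hε)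

noncomputable def en (u : ℂ → ℝ) (ε : ℝ) (ζ : ℂ) : ℝ := deriv (gt ε) (u (exp ζ)) * ‖tQ u ζ‖ ^ 2

lemma Sol.en_cont (h : Sol δ R u F G) {ε : ℝ} (hε : 0 < ε)
    {x0 x1 y0 y1 : ℝ} (hx0 : x0 ∈ I0 δ R) (hx1 : x1 ∈ I0 δ R)  :
    ContinuousOn (en u ε) (Icc x0 x1 ×ℂ Icc y0 y1) := by
  have := h.dcont (y0 := y0) (y1 := y1) (h.ttQ.continuousOn.mul
    (continuous_conj.comp_continuousOn h.ttQ.continuousOn)) hε hx0 hx1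
  refine (continuous_re.comp_continuousOn this).congr fun ζ _ => ?_
  simp only [Function.comp, en, Pi.mul_apply]
  rw [mul_conj, ← ofReal_mul, ofReal_re, normSq_eq_norm_sq]

lemma Sol.green_en (h : Sol δ R u F G) {ε : ℝ} (hε : 0 < ε)
    {x0 x1 y0 y1 : ℝ} (hx0 : x0 ∈ I0 δ R) (hx1 : x1 ∈ I0 δ R) (hx : x0 ≤ x1) (hy : y0 ≤ y1) :
    bdI (fun ζ => gt ε (u (exp ζ)) * tQ u ζ) x0 x1 y0 y1 = I * (int2 (en u ε) x0 x1 y0 y1 : ℝ) := by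
  rw [h.green h.ttQ hε hx0 hx1 hx hy, int2_mul, ← int2_ofReal]
  congr 2
  ext ζ
  rw [mul_conj, en, normSq_eq_norm_sq]; push_cast; rfl

lemma Sol.gQ_le (h : Sol δ R u F G) {ε : ℝ} (hε : 0 < ε) {ζ : ℂ} (hζ : ζ.re ∈ I0 δ R) {C : ℝ} (hC : 0 ≤ C)
    (h1 : ζ ∈ tD δ R u → ‖qq u (exp ζ)‖ ≤ C) :
    ‖(gt ε (u (exp ζ)) : ℂ) * tQ u ζ‖ ≤ C * Real.exp ζ.re := by
  by_cases hD : ζ ∈ tD δ R u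
  · rw [norm_mul, norm_real, Real.norm_eq_abs, abs_of_nonneg (gt_01 _ _).1, tQ, norm_mul, norm_exp]
    have h1 := h1 hD
    have h2 := (gt_01 ε (u (exp ζ))).2
    have h3 := (gt_01 ε (u (exp ζ))).1
    calc gt ε (u (exp ζ)) * (‖qq u (exp ζ)‖ * Real.exp ζ.re) ≤ 1 * (C * Real.exp ζ.re) := by gcongr
      _ = _ := one_mul _
  · rw [u_zero h.h (I0_ann hζ) hD, gt_zero hε 0 (by linarith)]
    simp; positivity

lemma Sol.en_le (h : Sol δ R u F G)
    {x0 x1 y0 y1 : ℝ} (hx0 : x0 ∈ I0 δ R) (hx1 : x1 ∈ I0 δ R) (hx : x0 ≤ x1) (hy : y0 ≤ y1) :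
    ∃ M ≥ 0, ∀ ε > 0, int2 (en u ε) x0 x1 y0 y1 ≤ M := by
  obtain ⟨C, hC, hb⟩ := h.tqc hx0 hx1
  have hM : 0 ≤ 2 * (C * Real.exp x1) * ((x1 - x0) + (y1 - y0)) := by
    have : 0 ≤ (x1 - x0) + (y1 - y0) := by linarith
    positivity
  refine ⟨_, hM, fun ε hε => ?_⟩
  have h1 := bdI_norm (C := C * Real.exp x1) (f := fun ζ => gt ε (u (exp ζ)) * tQ u ζ) hx hy fun ζ hζ => by
    have := I0_ord hx0 hx1 hζ.1
    refine (h.gQ_le hε this hC fun hD => hb _ hD hζ.1).trans ?_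
    have := hζ.1.2
    gcongr
  rw [h.green_en hε hx0 hx1 hx hy, norm_mul, norm_I, one_mul, norm_real] at h1
  exact (le_abs_self _).trans h1

lemma Sol.defect (h : Sol δ R u F G) {x0 x1 y0 y1 : ℝ} (hx0 : x0 ∈ I0 δ R) (hx1 : x1 ∈ I0 δ R)
    (hx : x0 ≤ x1) (hy : y0 ≤ y1) {η : ℝ} (hη : 0 < η) (hη2 : η ≤ 1 / 2) {M : ℝ}
    (hM : ∀ ε > 0, int2 (en u ε) x0 x1 y0 y1 ≤ M) : ∃ ε0 > 0, ∀ ε > 0, ε ≤ ε0 →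
    ‖bdI (fun ζ => gt ε (u (exp ζ)) * K1 u ζ) x0 x1 y0 y1 +
      conj (bdI (fun ζ => gt ε (u (exp ζ)) * exp ζ) x0 x1 y0 y1)‖ ≤
    6 * η * M := by
  have hsub : ∀ ζ ∈ Icc x0 x1 ×ℂ Icc y0 y1, exp ζ ∈ ann δ R := fun ζ hζ =>
    I0_ann (I0_ord hx0 hx1 hζ.1)
  obtain ⟨ε0, he0, hu⟩ := unif_one (ann_open _ _) h.h (C := exp '' (Icc x0 x1 ×ℂ Icc y0 y1))
    ((isCompact_Icc.reProdIm isCompact_Icc).image continuous_exp) (by rintro _ ⟨ζ, hζ, rfl⟩; exact hsub ζ hζ) hη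
  refine ⟨ε0, he0, fun ε hε hle => ?_⟩
  rw [h.green h.tK1 hε hx0 hx1 hx hy, h.green differentiable_exp.differentiableOn hε hx0 hx1 hx hy,
    int2_mul, int2_mul, map_mul, conj_I, neg_mul, ← sub_eq_add_neg, ← mul_sub, int2_conj, sub_eq_add_neg,
    ← neg_one_mul (int2 _ _ _ _ _), ← int2_mul, ← int2_add hx hy, norm_mul, norm_I, one_mul]
  rotate_left
  · exact h.dcont (h.tK1.continuousOn.mul (continuous_conj.comp_continuousOn h.ttQ.continuousOn)) hε hx0 hx1
  · refine continuousOn_const.mul (continuous_conj.comp_continuousOn ?_)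
    exact h.dcont (continuous_exp.continuousOn.mul (continuous_conj.comp_continuousOn h.ttQ.continuousOn)) hε hx0 hx1
  refine (int2_le hx hy (continuousOn_const.mul (h.en_cont hε hx0 hx1)) (h := fun ζ => (6 * η) * en u ε ζ)
    fun ζ hζ => ?_).trans ?_
  · by_cases hz : u (exp ζ) < ε / 2 ∨ ε < u (exp ζ)
    · simp [gt_d0 hε hz, en]
    push Not at hz
    have hq := hu (exp ζ) (mem_image_of_mem _ hζ) (by linarith) (by linarith)
    have hd := gt_d hε (u (exp ζ))
    rw [en]
    set q := qq u (exp ζ)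
    set d := deriv (gt ε) (u (exp ζ))
    set e := exp ζ
    have : (d : ℂ) * (K1 u ζ * conj (tQ u ζ)) + -1 * conj ((d : ℂ) * (e * conj (tQ u ζ))) =
      (d : ℂ) * (q * (e * conj e) * (q * conj q - 1)) := by
      simp only [K1, tQ, map_mul, conj_ofReal, conj_conj]; ring
    rw [this, mul_conj, mul_conj, normSq_eq_norm_sq, normSq_eq_norm_sq, ← ofReal_one, ← ofReal_sub]
    simp only [norm_mul, norm_real, Real.norm_eq_abs, abs_of_nonneg hd, abs_of_nonneg (sq_nonneg ‖e‖), tQ]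
    change _ ≤ 6 * η * (d * (‖q‖ * ‖e‖) ^ 2)
    rw [mul_left_comm (6 * η)]
    refine mul_le_mul_of_nonneg_left ?_ hd
    obtain ⟨h1, h2⟩ := abs_lt.1 hq
    have h3 : |‖q‖ ^ 2 - 1| ≤ 3 * η := by
      rw [abs_le]; constructor <;> nlinarith [norm_nonneg q]
    have h4 : |‖q‖ ^ 2 - 1| ≤ 6 * η * ‖q‖ := by nlinarith
    calc ‖q‖ * ‖e‖ ^ 2 * |‖q‖ ^ 2 - 1| ≤ ‖q‖ * ‖e‖ ^ 2 * (6 * η * ‖q‖) := by gcongr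
      _ = _ := by ring
  · rw [int2_rmul]
    have := hM ε hε
    gcongr
end

noncomputable def CM : ℝ := CL ^ 2 + 1

lemma CM_pos : 0 < CM := by unfold CM; positivity

section
variable {δ R : ℝ} {u : ℂ → ℝ} {F G : Set ℂ}

lemma Sol.lim (h : Sol δ R u F G) {γ : ℝ → ℂ} (hγ : Continuous γ) {a b C : ℝ}
    (hγI : ∀ t ∈ uIcc a b, (γ t).re ∈ I0 δ R) {k : ℂ → ℂ} (hk : ContinuousOn k (tD δ R u))
    (hC : 0 ≤ C) (hkC : ∀ t ∈ uIcc a b, γ t ∈ tD δ R u → ‖k (γ t)‖ ≤ C) :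
    Tendsto (fun n : ℕ => ∫ t in a..b, (gt (1 / ((n : ℝ) + 1)) (u (exp (γ t))) : ℂ) * k (γ t)) atTop
      (𝓝 (∫ t in a..b, if γ t ∈ tD δ R u then k (γ t) else 0)) ∧
    IntervalIntegrable (fun t => if γ t ∈ tD δ R u then k (γ t) else 0) volume a b := by
  have hpos : ∀ n : ℕ, 0 < 1 / ((n : ℝ) + 1) := fun n => by positivity
  have hmeas : ∀ n : ℕ, AEStronglyMeasurable
      (fun t => (gt (1 / ((n : ℝ) + 1)) (u (exp (γ t))) : ℂ) * k (γ t)) (volume.restrict (uIoc a b)) := fun n => by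
    have := ((h.gcont hk (hpos n)).comp hγ.continuousOn (s := uIcc a b)
      fun t ht => I0_ann (hγI t ht)).mono uIoc_subset_uIcc
    exact this.aestronglyMeasurable measurableSet_uIoc
  have hlim : ∀ t ∈ uIoc a b, Tendsto (fun n : ℕ => (gt (1 / ((n : ℝ) + 1)) (u (exp (γ t))) : ℂ) * k (γ t))
      atTop (𝓝 (if γ t ∈ tD δ R u then k (γ t) else 0)) := fun t ht => by
    by_cases hD : γ t ∈ tD δ R u
    · simp only [hD, if_true]
      have : 0 < u (exp (γ t)) := hD.2
      refine tendsto_const_nhds.congr' ?_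
      filter_upwards [(tendsto_one_div_add_atTop_nhds_zero_nat (𝕜 := ℝ)).eventually_le_const this] with n hn
      rw [gt_one (hpos n) hn]; simp
    · simp only [hD, if_false]
      refine tendsto_const_nhds.congr fun n => ?_
      rw [u_zero h.h (I0_ann (hγI t (uIoc_subset_uIcc ht))) hD, gt_zero (hpos n) 0 (half_pos (hpos n))]
      simp
  have hb : ∀ (n : ℕ), ∀ t ∈ uIoc a b, ‖(gt (1 / ((n : ℝ) + 1)) (u (exp (γ t))) : ℂ) * k (γ t)‖ ≤ C :=
    fun n t ht => by
    have h01 := gt_01 (1 / ((n : ℝ) + 1)) (u (exp (γ t)))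
    have hI := hγI t (uIoc_subset_uIcc ht)
    by_cases hD : γ t ∈ tD δ R u
    · rw [norm_mul, norm_real, Real.norm_eq_abs, abs_of_nonneg h01.1]
      have := hkC t (uIoc_subset_uIcc ht) hD
      calc _ ≤ 1 * C := by gcongr; exact h01.2
        _ = C := one_mul C
    · rw [u_zero h.h (I0_ann hI) hD, gt_zero (hpos n) 0 (half_pos (hpos n))]
      simpa
  refine ⟨intervalIntegral.tendsto_integral_filter_of_dominated_convergence (fun _ => C)
    (.of_forall hmeas) (.of_forall fun n => .of_forall (hb n)) intervalIntegrable_const (.of_forall hlim), ?_⟩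
  have hm : AEStronglyMeasurable (fun t => if γ t ∈ tD δ R u then k (γ t) else 0)
      (volume.restrict (uIoc a b)) :=
    aestronglyMeasurable_of_tendsto_ae atTop hmeas ((ae_restrict_mem measurableSet_uIoc).mono hlim)
  refine (intervalIntegrable_const (c := C)).mono_fun hm ?_
  filter_upwards [ae_restrict_mem measurableSet_uIoc] with t ht
  rw [Real.norm_eq_abs, abs_of_nonneg hC]
  split_ifs with hD
  · exact hkC t (uIoc_subset_uIcc ht) hD
  · simpa

lemma k_le {ζ : ℂ} {C : ℝ} (h1 : ‖qq u (exp ζ)‖ ≤ C) :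
    ‖K1 u ζ + conj (exp ζ)‖ ≤ (C ^ 2 + 1) * Real.exp ζ.re ∧
    ‖I * K1 u ζ - I * conj (exp ζ)‖ ≤ (C ^ 2 + 1) * Real.exp ζ.re := by
  have h2 : ‖K1 u ζ‖ ≤ C ^ 2 * Real.exp ζ.re := by
    rw [K1, norm_mul, norm_pow, norm_exp]; gcongr
  have h3 : ‖conj (exp ζ)‖ = Real.exp ζ.re := by rw [RCLike.norm_conj, norm_exp]
  constructor
  · refine (norm_add_le _ _).trans ?_; rw [h3]; linarith
  · refine (norm_sub_le _ _).trans ?_; rw [norm_mul, norm_mul, norm_I, one_mul, one_mul, h3]; linarith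

lemma I0_uIcc {x0 x1 x : ℝ} (h0 : x0 ∈ I0 δ R) (h1 : x1 ∈ I0 δ R) (hx : x ∈ uIcc x0 x1) : x ∈ I0 δ R := by
  rcases le_total x0 x1 with hh | hh
  · exact I0_ord h0 h1 (by rwa [uIcc_of_le hh] at hx)
  · exact I0_ord h1 h0 (by rwa [uIcc_of_ge hh] at hx)

lemma Sol.kc (h : Sol δ R u F G) {x0 x1 : ℝ} (hx0 : x0 ∈ I0 δ R) (hx1 : x1 ∈ I0 δ R) :
    ∃ C ≥ 0, ∀ ζ ∈ tD δ R u, ζ.re ∈ uIcc x0 x1 → ‖K1 u ζ + conj (exp ζ)‖ ≤ C ∧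
    ‖I * K1 u ζ - I * conj (exp ζ)‖ ≤ C := by
  have a0 : min x0 x1 ∈ I0 δ R := by rcases min_choice x0 x1 with e | e <;> rwa [e]
  have a1 : max x0 x1 ∈ I0 δ R := by rcases max_choice x0 x1 with e | e <;> rwa [e]
  obtain ⟨C, hC, hb⟩ := h.tqc a0 a1
  refine ⟨(C ^ 2 + 1) * Real.exp (max x0 x1), by positivity, fun ζ hD hI => ?_⟩
  have := k_le (hb ζ hD hI)
  have h3 : (C ^ 2 + 1) * Real.exp ζ.re ≤ (C ^ 2 + 1) * Real.exp (max x0 x1) := by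
    have := hI.2; gcongr
  exact ⟨this.1.trans h3, this.2.trans h3⟩

lemma Sol.kA_c (h : Sol δ R u F G) : ContinuousOn (fun ζ => K1 u ζ + conj (exp ζ)) (tD δ R u) :=
  h.tK1.continuousOn.add (continuous_conj.comp continuous_exp).continuousOn

lemma Sol.kB_c (h : Sol δ R u F G) : ContinuousOn (fun ζ => I * K1 u ζ - I * conj (exp ζ)) (tD δ R u) :=
  (continuousOn_const.mul h.tK1.continuousOn).sub
    (continuousOn_const.mul (continuous_conj.comp continuous_exp).continuousOn)

lemma Sol.aA_le (h : Sol δ R u F G) {x0 x1 : ℝ} (hx0 : x0 ∈ I0 δ R) (hx1 : x1 ∈ I0 δ R) :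
    ∃ C ≥ 0, ∀ ζ : ℂ, ζ.re ∈ uIcc x0 x1 → ‖aA δ R u ζ‖ ≤ C ∧ ‖aB δ R u ζ‖ ≤ C := by
  obtain ⟨C, hC, hb⟩ := h.kc hx0 hx1
  refine ⟨C, hC, fun ζ hI => ?_⟩
  unfold aA aB
  split_ifs with hD
  · exact hb ζ hD hI
  · simpa

lemma Sol.lh (h : Sol δ R u F G) {x0 x1 : ℝ} (hx0 : x0 ∈ I0 δ R) (hx1 : x1 ∈ I0 δ R) (y : ℝ) :
    Tendsto (fun n : ℕ => ∫ x in x0..x1, (gt (1 / ((n : ℝ) + 1)) (u (exp (x + y * I))) : ℂ) *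
      (K1 u (x + y * I) + conj (exp (x + y * I)))) atTop
      (𝓝 (∫ x in x0..x1, aA δ R u (x + y * I))) ∧
    IntervalIntegrable (fun x : ℝ => aA δ R u (x + y * I)) volume x0 x1 := by
  obtain ⟨C, hC, hb⟩ := h.kc hx0 hx1
  exact h.lim (γ := fun x : ℝ => (x + y * I : ℂ)) (by fun_prop) (fun t ht => by
    simpa using I0_uIcc hx0 hx1 ht) h.kA_c hC fun t ht hD => (hb _ hD (by simpa using ht)).1

lemma Sol.lv (h : Sol δ R u F G) {x : ℝ} (hx : x ∈ I0 δ R) (y0 y1 : ℝ) :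
    Tendsto (fun n : ℕ => ∫ y in y0..y1, (gt (1 / ((n : ℝ) + 1)) (u (exp (x + y * I))) : ℂ) *
      (I * K1 u (x + y * I) - I * conj (exp (x + y * I)))) atTop
      (𝓝 (∫ y in y0..y1, aB δ R u (x + y * I))) ∧
    IntervalIntegrable (fun y : ℝ => aB δ R u (x + y * I)) volume y0 y1 := by
  obtain ⟨C, hC, hb⟩ := h.kc hx hx
  exact h.lim (γ := fun y : ℝ => (x + y * I : ℂ)) (by fun_prop) (fun t ht => by
    simpa using hx) h.kB_c hC fun t ht hD => (hb _ hD (by simp)).2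

lemma Sol.int_h (h : Sol δ R u F G) {x0 x1 : ℝ} (hx0 : x0 ∈ I0 δ R) (hx1 : x1 ∈ I0 δ R) (y : ℝ) :
    IntervalIntegrable (fun x : ℝ => aA δ R u (x + y * I)) volume x0 x1 := (h.lh hx0 hx1 y).2

lemma Sol.int_v (h : Sol δ R u F G) {x : ℝ} (hx : x ∈ I0 δ R) (y0 y1 : ℝ) :
    IntervalIntegrable (fun y : ℝ => aB δ R u (x + y * I)) volume y0 y1 := (h.lv hx y0 y1).2

lemma Sol.closed_aux (h : Sol δ R u F G) {x0 x1 y0 y1 : ℝ} (hx0 : x0 ∈ I0 δ R) (hx1 : x1 ∈ I0 δ R)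
    (hx : x0 ≤ x1) (hy : y0 ≤ y1) : bd1 (aA δ R u) (aB δ R u) x0 x1 y0 y1 = 0 := by
  have hCM := CM_pos
  let ε : ℕ → ℝ := fun n => 1 / ((n : ℝ) + 1)
  have hpos : ∀ n : ℕ, 0 < ε n := fun n => by simp only [ε]; positivity
  let E : ℕ → ℂ := fun n => bd1 (fun ζ => (gt (ε n) (u (exp ζ)) : ℂ) * (K1 u ζ + conj (exp ζ)))
    (fun ζ => (gt (ε n) (u (exp ζ)) : ℂ) * (I * K1 u ζ - I * conj (exp ζ))) x0 x1 y0 y1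
  have h1 : Tendsto E atTop (𝓝 (bd1 (aA δ R u) (aB δ R u) x0 x1 y0 y1)) :=
    (((h.lh hx0 hx1 y0).1.sub (h.lh hx0 hx1 y1).1).add (h.lv hx1 y0 y1).1).sub (h.lv hx0 y0 y1).1
  have hE : ∀ n, E n = bdI (fun ζ => gt (ε n) (u (exp ζ)) * K1 u ζ) x0 x1 y0 y1 +
      conj (bdI (fun ζ => gt (ε n) (u (exp ζ)) * exp ζ) x0 x1 y0 y1) := fun n => by
    rw [← bd1_split (h.gcont h.tK1.continuousOn (hpos n)) (h.gcont continuous_exp.continuousOn (hpos n)) hx hy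
      fun ζ hζ => I0_ann (I0_ord hx0 hx1 hζ.1)]
    simp only [E]
    congr 1 <;> ext ζ <;> rw [map_mul, conj_ofReal] <;> ring
  have h2 : Tendsto E atTop (𝓝 0) := by
    rw [Metric.tendsto_atTop]
    intro e he
    obtain ⟨M, hp, hM⟩ := h.en_le hx0 hx1 hx hy
    let η := min (1/2) (e / (6 * M + 6) / 2)
    have hη : 0 < η := by positivity
    have hη2 : 6 * η * M < e := by
      have h3 : η ≤ e / (6 * M + 6) / 2 := min_le_right _ _
      rw [div_div, le_div_iff₀ (by positivity)] at h3
      nlinarith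
    obtain ⟨ε0, h0, hd⟩ := h.defect hx0 hx1 hx hy hη (min_le_left _ _) hM
    obtain ⟨N, hN⟩ := eventually_atTop.1
      ((tendsto_one_div_add_atTop_nhds_zero_nat (𝕜 := ℝ)).eventually_le_const h0)
    refine ⟨N, fun n hn => ?_⟩
    rw [dist_zero_right, hE]
    exact (hd (ε n) (hpos n) (hN n hn)).trans_lt hη2
  exact tendsto_nhds_unique h1 h2

lemma bd1_swap_x (A B : ℂ → ℂ) (x0 x1 y0 y1 : ℝ) : bd1 A B x1 x0 y0 y1 = - bd1 A B x0 x1 y0 y1 := by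
  unfold bd1
  rw [intervalIntegral.integral_symm x0 x1, intervalIntegral.integral_symm x0 x1]; ring

lemma bd1_swap_y (A B : ℂ → ℂ) (x0 x1 y0 y1 : ℝ) : bd1 A B x0 x1 y1 y0 = - bd1 A B x0 x1 y0 y1 := by
  unfold bd1
  rw [intervalIntegral.integral_symm y0 y1, intervalIntegral.integral_symm y0 y1]; ring

lemma Sol.closed (h : Sol δ R u F G) {x0 x1 : ℝ} (y0 y1 : ℝ) (hx0 : x0 ∈ I0 δ R) (hx1 : x1 ∈ I0 δ R) :
    bd1 (aA δ R u) (aB δ R u) x0 x1 y0 y1 = 0 := by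
  rcases le_total x0 x1 with hx | hx <;> rcases le_total y0 y1 with hy | hy
  · exact h.closed_aux hx0 hx1 hx hy
  · rw [bd1_swap_y, h.closed_aux hx0 hx1 hx hy, neg_zero]
  · rw [bd1_swap_x, h.closed_aux hx1 hx0 hx hy, neg_zero]
  · rw [bd1_swap_x, bd1_swap_y, h.closed_aux hx1 hx0 hx hy, neg_zero, neg_zero]

noncomputable def tPhi (δ R : ℝ) (u : ℂ → ℝ) (xb : ℝ) (ζ : ℂ) : ℂ :=
  (∫ t in xb..ζ.re, aA δ R u (t + (0 : ℝ) * I)) + ∫ s in (0 : ℝ)..ζ.im, aB δ R u (ζ.re + s * I)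

lemma Sol.diff (h : Sol δ R u F G) {xb : ℝ} (hb : xb ∈ I0 δ R) {ζ ζ' : ℂ} (h1 : ζ.re ∈ I0 δ R)
    (h2 : ζ'.re ∈ I0 δ R) : tPhi δ R u xb ζ' - tPhi δ R u xb ζ =
      (∫ t in ζ.re..ζ'.re, aA δ R u (t + ζ.im * I)) + ∫ s in ζ.im..ζ'.im, aB δ R u (ζ'.re + s * I) := by
  have hc := h.closed 0 ζ.im h1 h2
  have e1 := intervalIntegral.integral_add_adjacent_intervals (h.int_h hb h1 0) (h.int_h h1 h2 0)
  have e2 := intervalIntegral.integral_add_adjacent_intervals (h.int_v h2 0 ζ.im) (h.int_v h2 ζ.im ζ'.im)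
  unfold tPhi
  unfold bd1 at hc
  rw [← e1, ← e2]
  linear_combination hc

lemma Sol.vert (h : Sol δ R u F G) {xb : ℝ} (hb : xb ∈ I0 δ R) {x : ℝ} (h1 : 2 * δ ≤ Real.exp x)
    (h2 : Real.exp x ≤ R / 2) (y y' : ℝ) :
    ‖tPhi δ R u xb (x + y' * I) - tPhi δ R u xb (x + y * I)‖ ≤ CM * Real.exp x * |y' - y| := by
  have hδ := h.hδ
  have hx : x ∈ I0 δ R := ⟨by linarith, by linarith⟩
  rw [h.diff hb (by simpa) (by simpa)]
  simp only [add_re, ofReal_re, mul_re, I_re, mul_zero, ofReal_im, I_im, mul_one, sub_self, add_zero,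
    add_im, mul_im, zero_add, intervalIntegral.integral_same]
  refine intervalIntegral.norm_integral_le_of_norm_le_const fun s _ => ?_
  unfold aB
  split_ifs with hD
  · have := (k_le (h.tqb (by simpa) (by simpa) hD)).2
    simpa [CM] using this
  · have := CM_pos; simp; positivity

lemma I0_nhds {x : ℝ} (hx : x ∈ I0 δ R) : I0 δ R ∈ 𝓝 x := by
  have hcont : ContinuousAt (fun w : ℝ => Real.exp w) x := by fun_prop
  filter_upwards [hcont (Ioo_mem_nhds hx.1 hx.2)] with w hw using ⟨hw.1, hw.2⟩

lemma Sol.tcont (h : Sol δ R u F G) {xb : ℝ} (hb : xb ∈ I0 δ R) :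
    ContinuousOn (tPhi δ R u xb) {ζ | ζ.re ∈ I0 δ R} := by
  intro ζ0 h0
  obtain ⟨e, he, hsub⟩ := Metric.nhds_basis_closedBall.mem_iff.1 (I0_nhds h0)
  rw [Real.closedBall_eq_Icc] at hsub
  obtain ⟨M, hM, hle⟩ := h.aA_le (hsub (left_mem_Icc.2 (by linarith))) (hsub (right_mem_Icc.2 (by linarith)))
  rw [uIcc_of_le (by linarith)] at hle
  have : LipschitzOnWith (Real.toNNReal (2 * M)) (tPhi δ R u xb) {ζ | ζ.re ∈ Icc (ζ0.re - e) (ζ0.re + e)} := by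
    refine LipschitzOnWith.of_dist_le_mul fun ζ' h' ζ hζ => ?_
    rw [dist_eq_norm, h.diff hb (hsub hζ) (hsub h'), Real.coe_toNNReal _ (by linarith), dist_eq_norm]
    refine (norm_add_le _ _).trans ?_
    have a1 := intervalIntegral.norm_integral_le_of_norm_le_const (a := ζ.re) (b := ζ'.re) (C := M)
      (f := fun t : ℝ => aA δ R u (t + ζ.im * I)) fun t ht =>
      (hle _ (by simpa using uIcc_subset_Icc hζ h' (uIoc_subset_uIcc ht))).1
    have a2 := intervalIntegral.norm_integral_le_of_norm_le_const (a := ζ.im) (b := ζ'.im) (C := M)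
      (f := fun t : ℝ => aB δ R u (ζ'.re + t * I)) fun t ht => (hle _ (by simpa using h')).2
    have a3 := abs_re_le_norm (ζ' - ζ)
    have a4 := abs_im_le_norm (ζ' - ζ)
    rw [sub_re] at a3; rw [sub_im] at a4
    nlinarith
  refine (this.continuousOn.continuousAt ?_).continuousWithinAt
  exact continuous_re.continuousAt (Icc_mem_nhds (by linarith) (by linarith))

lemma Sol.tper (h : Sol δ R u F G) {xb : ℝ} (hb : xb ∈ I0 δ R) {ζ ζ' : ℂ} (h1 : ζ.re ∈ I0 δ R)
    (h2 : ζ'.re ∈ I0 δ R) : tPhi δ R u xb (ζ' + 2 * Real.pi * I) - tPhi δ R u xb ζ' =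
      tPhi δ R u xb (ζ + 2 * Real.pi * I) - tPhi δ R u xb ζ := by
  have hre : ∀ ζ : ℂ, (ζ + 2 * Real.pi * I).re = ζ.re := fun ζ => by simp
  have him : ∀ ζ : ℂ, (ζ + 2 * Real.pi * I).im = ζ.im + 2 * Real.pi := fun ζ => by simp
  have pe : ∀ ζ : ℂ, exp (ζ + 2 * Real.pi * I) = exp ζ := fun ζ => by
    rw [Complex.exp_add, exp_two_pi_mul_I, mul_one]
  have pA : ∀ ζ : ℂ, aA δ R u (ζ + 2 * Real.pi * I) = aA δ R u ζ := fun ζ => by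
    simp only [aA, tD, mem_preimage, K1, pe]
  have pB : ∀ ζ : ℂ, aB δ R u (ζ + 2 * Real.pi * I) = aB δ R u ζ := fun ζ => by
    simp only [aB, tD, mem_preimage, K1, pe]
  have e1 := h.diff hb h1 h2
  have e2 := h.diff hb (ζ := ζ + 2 * Real.pi * I) (ζ' := ζ' + 2 * Real.pi * I) (by rwa [hre]) (by rwa [hre])
  rw [hre, hre, him, him, ← intervalIntegral.integral_comp_add_right (fun s => aB δ R u (ζ'.re + s * I))] at e2
  have e3 : tPhi δ R u xb (ζ' + 2 * Real.pi * I) - tPhi δ R u xb (ζ + 2 * Real.pi * I) =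
    tPhi δ R u xb ζ' - tPhi δ R u xb ζ := by
    rw [e1, e2]
    congr 1
    · refine intervalIntegral.integral_congr fun t _ => ?_
      beta_reduce
      rw [← pA (t + ζ.im * I)]; congr 1; push_cast; ring
    · refine intervalIntegral.integral_congr fun t _ => ?_
      beta_reduce
      rw [← pB (ζ'.re + t * I)]; congr 1; push_cast; ring
  linear_combination e3

lemma Sol.tder (h : Sol δ R u F G) {xb : ℝ} (hb : xb ∈ I0 δ R) {ζ : ℂ} (h1 : ζ.re ∈ I0 δ R)
    (hA : ContinuousAt (aA δ R u) ζ) (hB : ContinuousAt (aB δ R u) ζ)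
    {L : ℂ →L[ℝ] ℂ} (hL : ∀ x, L x = x.re * aA δ R u ζ + x.im * aB δ R u ζ) :
    HasFDerivAt (tPhi δ R u xb) L ζ := by
  rw [hasFDerivAt_iff_isLittleO, Asymptotics.isLittleO_iff]
  intro c hc
  have hI : ∀ᶠ w : ℂ in 𝓝 ζ, w.re ∈ I0 δ R := continuous_re.continuousAt (I0_nhds h1)
  have eA := hA (Metric.ball_mem_nhds _ (half_pos hc))
  have eB := hB (Metric.ball_mem_nhds _ (half_pos hc))
  obtain ⟨ρ, hρ, hev⟩ := Metric.eventually_nhds_iff.1 (hI.and (Filter.Eventually.and eA eB))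
  filter_upwards [Metric.ball_mem_nhds ζ (half_pos hρ)] with w hw
  have hnear : ∀ s t : ℝ, |s| ≤ |w.re - ζ.re| → |t| ≤ |w.im - ζ.im| →
      dist ((ζ.re + s : ℝ) + (ζ.im + t : ℝ) * I : ℂ) ζ < ρ := fun s t hs ht => by
    rw [dist_eq_norm, show ((ζ.re + s : ℝ) + (ζ.im + t : ℝ) * I : ℂ) - ζ = (s : ℂ) + t * I by
      apply Complex.ext <;> simp]
    refine (norm_add_le _ _).trans_lt ?_
    rw [norm_mul, norm_I, mul_one, norm_real, norm_real, Real.norm_eq_abs, Real.norm_eq_abs]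
    have a3 := abs_re_le_norm (w - ζ)
    have a4 := abs_im_le_norm (w - ζ)
    rw [sub_re] at a3; rw [sub_im] at a4
    rw [mem_ball, dist_eq_norm] at hw
    linarith
  have hζI := (hev (y := ζ) (by simpa using hρ)).1
  have hwI := (hev (y := w) (by rw [mem_ball] at hw; linarith)).1
  have key : ∀ a b t : ℝ, t ∈ uIoc a b → |t - a| ≤ |b - a| := fun a b t ht =>
    abs_sub_left_of_mem_uIcc (uIoc_subset_uIcc ht)
  rw [h.diff hb hζI hwI, hL]
  have e1 : (∫ t in ζ.re..w.re, aA δ R u (t + ζ.im * I)) - ((w - ζ).re : ℂ) * aA δ R u ζ =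
      ∫ t in ζ.re..w.re, (aA δ R u (t + ζ.im * I) - aA δ R u ζ) := by
    rw [intervalIntegral.integral_sub (h.int_h hζI hwI _) intervalIntegrable_const,
      intervalIntegral.integral_const]; simp
  have e2 : (∫ t in ζ.im..w.im, aB δ R u (w.re + t * I)) - ((w - ζ).im : ℂ) * aB δ R u ζ =
      ∫ t in ζ.im..w.im, (aB δ R u (w.re + t * I) - aB δ R u ζ) := by
    rw [intervalIntegral.integral_sub (h.int_v hwI _ _) intervalIntegrable_const,
      intervalIntegral.integral_const]; simp
  have a1 := intervalIntegral.norm_integral_le_of_norm_le_const (a := ζ.re) (b := w.re) (C := c / 2)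
      (f := fun t : ℝ => aA δ R u (t + ζ.im * I) - aA δ R u ζ) fun t ht => by
      have := (hev (hnear (t - ζ.re) 0 (key _ _ _ ht) (by simp))).2.1
      simp only [add_sub_cancel, add_zero] at this
      rw [mem_ball, dist_eq_norm] at this; exact this.le
  have a2 := intervalIntegral.norm_integral_le_of_norm_le_const (a := ζ.im) (b := w.im) (C := c / 2)
      (f := fun t : ℝ => aB δ R u (w.re + t * I) - aB δ R u ζ) fun t ht => by
      have := (hev (hnear (w.re - ζ.re) (t - ζ.im) le_rfl (key _ _ _ ht))).2.2
      simp only [add_sub_cancel] at this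
      rw [mem_ball, dist_eq_norm] at this; exact this.le
  have a3 := abs_re_le_norm (w - ζ)
  have a4 := abs_im_le_norm (w - ζ)
  rw [add_sub_add_comm, e1, e2]
  refine (norm_add_le _ _).trans ?_
  rw [sub_re] at a3; rw [sub_im] at a4
  nlinarith

noncomputable def LL (u : ℂ → ℝ) (ζ : ℂ) : ℂ →L[ℝ] ℂ :=
  (phL (qq u (exp ζ))).comp
    ((ContinuousLinearMap.toSpanSingleton ℂ (exp ζ)).restrictScalars ℝ)

lemma LL_apply (u : ℂ → ℝ) (ζ x : ℂ) : LL u ζ x = K1 u ζ * x + conj (exp ζ * x) := by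
  simp [LL, K1]; ring

lemma Sol.pot (h : Sol δ R u F G) (hδR : δ < R) : ∃ (Φ : ℂ → ℂ) (P : ℂ),
    ContinuousOn Φ {ζ | ζ.re ∈ I0 δ R} ∧
    (∀ ζ : ℂ, ζ.re ∈ I0 δ R → ζ ∈ tD δ R u → HasFDerivAt Φ (LL u ζ) ζ) ∧
    (∀ ζ : ℂ, ζ.re ∈ I0 δ R → exp ζ ∉ closure (posSet (ann δ R) u) →
      HasFDerivAt Φ (0 : ℂ →L[ℝ] ℂ) ζ) ∧
    (∀ ζ : ℂ, ζ.re ∈ I0 δ R → Φ (ζ + 2 * Real.pi * I) = Φ ζ + P) ∧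
    (∀ x : ℝ, 2 * δ ≤ Real.exp x → Real.exp x ≤ R / 2 → ∀ y y' : ℝ, ‖Φ (x + y' * I) - Φ (x + y * I)‖ ≤ CM * Real.exp x * |y' - y|) := by
  have hδ := h.hδ
  obtain ⟨r, hr1, hr2⟩ := exists_between hδR
  have hb : Real.log r ∈ I0 δ R := by
    constructor <;> rwa [Real.exp_log (by linarith)]
  set xb := Real.log r
  refine ⟨tPhi δ R u xb, tPhi δ R u xb (xb + 2 * Real.pi * I) - tPhi δ R u xb xb, h.tcont hb,
    fun ζ h1 hD => ?_, fun ζ h1 hD => ?_, fun ζ hζ => ?_, fun x hx hx' y y' => h.vert hb hx hx' y y'⟩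
  · have hn := h.tDo.mem_nhds hD
    refine h.tder hb h1 ?_ ?_ fun x => ?_
    · refine (h.kA_c.continuousAt hn).congr ?_
      filter_upwards [hn] with w hw using by simp [aA, hw]
    · refine (h.kB_c.continuousAt hn).congr ?_
      filter_upwards [hn] with w hw using by simp [aB, hw]
    · rw [LL_apply]; simp only [aA, aB, hD, if_true]
      conv_lhs => rw [← re_add_im x]
      simp only [map_mul, map_add, conj_ofReal, conj_I]; ring
  · have hn : {w | exp w ∉ closure (posSet (ann δ R) u)} ∈ 𝓝 ζ :=
      (isClosed_closure.isOpen_compl.preimage continuous_exp).mem_nhds hD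
    have hn' : ∀ w, exp w ∉ closure (posSet (ann δ R) u) → w ∉ tD δ R u := fun w hw hh =>
      hw (subset_closure hh)
    refine h.tder hb h1 ?_ ?_ fun x => ?_
    · refine (continuousAt_const (y := (0:ℂ))).congr ?_
      filter_upwards [hn] with w hw using by simp [aA, hn' w hw]
    · refine (continuousAt_const (y := (0:ℂ))).congr ?_
      filter_upwards [hn] with w hw using by simp [aB, hn' w hw]
    · simp [aA, aB, hn' ζ hD]
  · have := h.tper hb (ζ := xb) (ζ' := ζ) (by simpa) hζ
    linear_combination this
end

def lgT (X : Set ℂ) (p : ℂ) : Prop := ∃ ℓ : ℂ → ℂ, ContinuousOn ℓ X ∧ ∀ z ∈ X, exp (ℓ z) = z - p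

lemma lg_step {X : Set ℂ} {p p' : ℂ} {d : ℝ} (hd : ∀ z ∈ X, d ≤ ‖z - p‖) (hp : ‖p - p'‖ < d)
    (h : lgT X p) : lgT X p' := by
  obtain ⟨ℓ, hc, hl⟩ := h
  have hne : ∀ z ∈ X, z - p ≠ 0 := fun z hz => norm_pos_iff.1 (by linarith [hd z hz, norm_nonneg (p - p')])
  have hs : ∀ z ∈ X, 1 + (p - p') / (z - p) ∈ slitPlane := fun z hz => by
    refine mem_slitPlane_of_norm_lt_one ?_
    rw [norm_div, div_lt_one (norm_pos_iff.2 (hne z hz))]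
    linarith [hd z hz]
  refine ⟨fun z => ℓ z + log (1 + (p - p') / (z - p)), hc.add (ContinuousOn.clog ?_ hs), fun z hz => ?_⟩
  · exact continuousOn_const.add (continuousOn_const.div (by fun_prop) hne)
  · rw [exp_add, hl z hz, exp_log (slitPlane_ne_zero (hs z hz))]
    field_simp [hne z hz]
    ring

lemma lg_prec {X C : Set ℂ} (hX : IsClosed X) (hC : IsPreconnected C) (hCX : Disjoint C X) {p p' : ℂ} (hp : p ∈ C)
    (hp' : p' ∈ C) (h : lgT X p) : lgT X p' := by
  rcases X.eq_empty_or_nonempty with rfl | hne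
  · exact ⟨0, by simp, by simp⟩
  have key : ∀ w, w ∉ X → ∃ e > 0, ∀ v ∈ ball w e, v ∉ X ∧ (lgT X w ↔ lgT X v) := fun w hw => by
    have hd := (hX.notMem_iff_infDist_pos hne).1 hw
    have h1 : ∀ z ∈ X, infDist w X ≤ ‖z - w‖ := fun z hz => by
      rw [norm_sub_rev, ← dist_eq_norm]; exact infDist_le_dist_of_mem hz
    refine ⟨infDist w X / 2, by positivity, fun v hv => ?_⟩
    rw [mem_ball, dist_eq_norm] at hv
    have h2 : ∀ z ∈ X, infDist w X / 2 ≤ ‖z - v‖ := fun z hz => by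
      have := h1 z hz
      have := norm_sub_le_norm_sub_add_norm_sub z v w
      linarith
    refine ⟨fun hvX => ?_, lg_step h1 (by rw [norm_sub_rev]; linarith), lg_step h2 hv⟩
    have := h2 v hvX; simp at this; linarith
  have hU : IsOpen {w | w ∉ X ∧ lgT X w} := Metric.isOpen_iff.2 fun w hw => by
    obtain ⟨e, he, hb⟩ := key w hw.1
    exact ⟨e, he, fun v hv => ⟨(hb v hv).1, (hb v hv).2.1 hw.2⟩⟩
  have hV : IsOpen {w | w ∉ X ∧ ¬ lgT X w} := Metric.isOpen_iff.2 fun w hw => by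
    obtain ⟨e, he, hb⟩ := key w hw.1
    exact ⟨e, he, fun v hv => ⟨(hb v hv).1, fun hh => hw.2 ((hb v hv).2.2 hh)⟩⟩
  have hn : ∀ w ∈ C, w ∉ X := fun w hw => Set.disjoint_left.1 hCX hw
  have := hC.subset_left_of_subset_union hU hV (Set.disjoint_left.2 fun w h1 h2 => h2.2 h1.2)
    (fun w hw => by by_cases hh : lgT X w
                    · exact Or.inl ⟨hn w hw, hh⟩
                    · exact Or.inr ⟨hn w hw, hh⟩) ⟨p, hp, hn p hp, h⟩
  exact (this hp').2

lemma log_unique {Y : Type*} [TopologicalSpace Y] {S : Set Y} (hS : IsPreconnected S) {f g : Y → ℂ} (hf : ContinuousOn f S)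
    (hg : ContinuousOn g S) (h : ∀ z ∈ S, exp (f z) = exp (g z)) :
    ∃ k : ℤ, ∀ z ∈ S, f z = g z + k * (2 * Real.pi * I) := by
  rcases S.eq_empty_or_nonempty with rfl | ⟨p, hp⟩
  · exact ⟨0, by simp⟩
  have h1 : ∀ z ∈ S, ∃ k : ℤ, f z = g z + k * (2 * Real.pi * I) := fun z hz => exp_eq_exp_iff_exists_int.1 (h z hz)
  choose! k hk using h1
  have h2 : ∀ z ∈ S, ((f z - g z) / (2 * Real.pi * I)).re = k z := fun z hz => by
    rw [hk z hz, add_sub_cancel_left, mul_div_cancel_right₀ _ two_pi_I_ne_zero]; simp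
  have hc : ContinuousOn (fun z => ((f z - g z) / (2 * Real.pi * I)).re) S :=
    continuous_re.comp_continuousOn ((hf.sub hg).div_const _)
  have h3 := (hS.image _ hc).ordConnected
  have h4 : ∀ z ∈ S, ∀ w ∈ S, k z ≤ k w := fun z hz w hw => by
    by_contra! hlt
    have hlt' : (k w : ℝ) + 1 ≤ k z := by exact_mod_cast hlt
    have hm : (k w : ℝ) + 1 / 2 ∈ (fun z => ((f z - g z) / (2 * Real.pi * I)).re) '' S :=
      h3.out (mem_image_of_mem _ hw) (mem_image_of_mem _ hz) (by
        simp only [h2 w hw, h2 z hz]; constructor <;> linarith)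
    obtain ⟨v, hv, hv'⟩ := hm
    simp only [h2 v hv] at hv'
    have : (2 * (k v - k w) : ℤ) = 1 := by
      have : (2 * (k v - k w) : ℝ) = 1 := by rw [hv']; ring
      exact_mod_cast this
    omega
  refine ⟨k p, fun z hz => ?_⟩
  rw [le_antisymm (h4 p hp z hz) (h4 z hz p hp)]
  exact hk z hz

section
variable {δ R : ℝ} {u : ℂ → ℝ} {F G : Set ℂ}

lemma Sol.swap (h : Sol δ R u F G) : Sol δ R u G F where
  hδ := h.hδ
  h := h.h
  FG := by rw [union_comm]; exact h.FG
  pF := h.pG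
  pG := h.pF
  dj := h.dj.symm
  cF := h.cG
  cG := h.cF
  F1 := h.G1
  F2 := h.G2
  G1 := h.F1
  G2 := h.F2

lemma Sol.Fs (h : Sol δ R u F G) : F ⊆ FB (ann δ R) u := h.FG ▸ subset_union_left

lemma Sol.near1 (h : Sol δ R u F G) {a : ℝ} (ha : δ < a) : ∃ p ∈ F, ‖p‖ < a := by
  obtain ⟨z, hz, hz'⟩ := h.F1
  have : {w : ℂ | ‖w‖ < a} ∈ 𝓝 z := (isOpen_lt continuous_norm continuous_const).mem_nhds (by
    rw [mem_sphere_zero_iff_norm] at hz'; simpa [hz'])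
  obtain ⟨p, hp, hpF⟩ := mem_closure_iff_nhds.1 hz _ this
  exact ⟨p, hpF, hp⟩

lemma Sol.near2 (h : Sol δ R u F G) {b : ℝ} (hb : b < R) : ∃ p ∈ F, b < ‖p‖ := by
  obtain ⟨z, hz, hz'⟩ := h.F2
  have : {w : ℂ | b < ‖w‖} ∈ 𝓝 z := (isOpen_lt continuous_const continuous_norm).mem_nhds (by
    rw [mem_sphere_zero_iff_norm] at hz'; simpa [hz'])
  obtain ⟨p, hp, hpF⟩ := mem_closure_iff_nhds.1 hz _ this
  exact ⟨p, hpF, hp⟩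

lemma Sol.clog (h : Sol δ R u F G) {a b : ℝ} (ha : δ < a) (hb : b < R) : ∃ ℓ : ℂ → ℂ,
    ContinuousOn ℓ (closure (posSet (ann δ R) u) ∩ {z | a ≤ ‖z‖ ∧ ‖z‖ ≤ b}) ∧
    ∀ z ∈ closure (posSet (ann δ R) u) ∩ {z | a ≤ ‖z‖ ∧ ‖z‖ ≤ b}, exp (ℓ z) = z := by
  set D := posSet (ann δ R) u
  set X := closure D ∩ {z | a ≤ ‖z‖ ∧ ‖z‖ ≤ b} with hX
  have hδ := h.hδ
  have hXc : IsClosed X := isClosed_closure.inter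
    ((isClosed_le continuous_const continuous_norm).inter (isClosed_le continuous_norm continuous_const))
  suffices lgT X 0 by
    obtain ⟨ℓ, h1, h2⟩ := this
    exact ⟨ℓ, h1, fun z hz => by simpa using h2 z hz⟩
  have hout : ∀ p : ℂ, b < ‖p‖ → 0 < ‖p‖ → lgT X p := fun p hp hp0 => by
    have hne : p ≠ 0 := norm_pos_iff.1 hp0
    have hs : ∀ z ∈ X, 1 + (-z / p) ∈ slitPlane := fun z hz => by
      refine mem_slitPlane_of_norm_lt_one ?_
      rw [norm_div, norm_neg, div_lt_one hp0]; linarith [hz.2.2]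
    refine ⟨fun z => log (-p) + log (1 + (-z / p)), continuousOn_const.add (ContinuousOn.clog (by fun_prop) hs),
      fun z hz => ?_⟩
    rw [exp_add, exp_log (neg_ne_zero.2 hne), exp_log (slitPlane_ne_zero (hs z hz))]
    field_simp
    ring
  let U : Set ℂ := {p | ∃ N, IsOpen N ∧ p ∈ N ∧ ∀ w ∈ N \ closure D, lgT X w}
  let V : Set ℂ := {p | ∃ N, IsOpen N ∧ p ∈ N ∧ ∀ w ∈ N \ closure D, ¬ lgT X w}
  have hU : IsOpen U := isOpen_iff_mem_nhds.2 fun p ⟨N, h1, h2, h3⟩ =>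
    mem_of_superset (h1.mem_nhds h2) fun w hw => ⟨N, h1, hw, h3⟩
  have hV : IsOpen V := isOpen_iff_mem_nhds.2 fun p ⟨N, h1, h2, h3⟩ =>
    mem_of_superset (h1.mem_nhds h2) fun w hw => ⟨N, h1, hw, h3⟩
  have hcl : ∀ p ∈ F, p ∈ closure (closure D)ᶜ := fun p hp => by
    obtain ⟨N, -, h2, -, -, -, -, -, h8⟩ := loc (ann_open δ R) h.h (h.Fs hp) univ_mem
    exact closure_mono (fun w hw => hw.2) (h8 ⟨h2, h.Fs hp⟩)
  have hUV : F ⊆ U ∪ V := fun p hp => by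
    obtain ⟨N, h1, h2, -, -, -, -, h7, h8⟩ := loc (ann_open δ R) h.h (h.Fs hp) univ_mem
    have hdis : Disjoint (N \ closure D) X := Set.disjoint_left.2 fun w hw hw' => hw.2 hw'.1
    by_cases hh : ∃ w ∈ N \ closure D, lgT X w
    · obtain ⟨w, hw, hw'⟩ := hh
      exact Or.inl ⟨N, h1, h2, fun v hv => lg_prec hXc h7 hdis hw hv hw'⟩
    · push Not at hh
      exact Or.inr ⟨N, h1, h2, hh⟩
  have hdisj : F ∩ (U ∩ V) = ∅ := by
    by_contra hne
    obtain ⟨p, hp, ⟨N, h1, h2, h3⟩, ⟨N', h1', h2', h3'⟩⟩ := Set.nonempty_iff_ne_empty.2 hne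
    obtain ⟨w, hw, hw'⟩ := mem_closure_iff.1 (hcl p hp) _ (h1.inter h1') ⟨h2, h2'⟩
    exact h3' w ⟨hw.2, hw'⟩ (h3 w ⟨hw.1, hw'⟩)
  have hFU : F ⊆ U := by
    obtain ⟨p, hp, hpb⟩ := h.near2 (b := max b δ) (max_lt hb (by
      obtain ⟨p, hp⟩ := h.near1 ha
      exact (h.Fs hp.1).1.1.trans (h.Fs hp.1).1.2))
    have hpU : p ∈ U := ⟨{w | max b δ < ‖w‖}, isOpen_lt continuous_const continuous_norm, hpb, fun w hw =>
      hout w ((le_max_left _ _).trans_lt hw.1) (hδ.trans ((le_max_right _ _).trans_lt hw.1))⟩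
    by_contra hn
    obtain ⟨p', hp', hn⟩ := Set.not_subset.1 hn
    have : p' ∈ V := (hUV hp').resolve_left hn
    obtain ⟨w, hw⟩ := h.pF U V hU hV hUV ⟨p, hp, hpU⟩ ⟨p', hp', this⟩
    rw [hdisj] at hw; exact hw
  obtain ⟨p, hp, hpa⟩ := h.near1 ha
  obtain ⟨N, h1, h2, h3⟩ := hFU hp
  obtain ⟨w, hw, hw'⟩ := mem_closure_iff.1 (hcl p hp) _ (h1.inter (isOpen_ball (x := (0:ℂ)) (ε := a)))
    ⟨h2, by simpa using hpa⟩
  refine lg_prec hXc (convex_ball (0:ℂ) a).isPreconnected (Set.disjoint_left.2 fun v hv hv' => ?_) hw.2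
    (mem_ball_self (by linarith)) (h3 w ⟨hw.1, hw'⟩)
  have := hv'.2.1; simp at hv; linarith
end

structure Pot (δ R : ℝ) (u : ℂ → ℝ) (Φ : ℂ → ℂ) (P : ℂ) : Prop where
  c : ContinuousOn Φ {ζ | ζ.re ∈ I0 δ R}
  d1 : ∀ ζ : ℂ, ζ.re ∈ I0 δ R → ζ ∈ tD δ R u → HasFDerivAt Φ (LL u ζ) ζ
  d0 : ∀ ζ : ℂ, ζ.re ∈ I0 δ R → exp ζ ∉ closure (posSet (ann δ R) u) → HasFDerivAt Φ (0 : ℂ →L[ℝ] ℂ) ζ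
  per : ∀ ζ : ℂ, ζ.re ∈ I0 δ R → Φ (ζ + 2 * Real.pi * I) = Φ ζ + P
  v : ∀ x : ℝ, 2 * δ ≤ Real.exp x → Real.exp x ≤ R / 2 → ∀ y y' : ℝ,
    ‖Φ (x + y' * I) - Φ (x + y * I)‖ ≤ CM * Real.exp x * |y' - y|

section
variable {δ R : ℝ} {u : ℂ → ℝ} {F G : Set ℂ} {Φ : ℂ → ℂ} {P : ℂ}

lemma Pot.perk (hP : Pot δ R u Φ P) {ζ : ℂ} (hζ : ζ.re ∈ I0 δ R) (k : ℤ) :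
    Φ (ζ + k * (2 * Real.pi * I)) = Φ ζ + k * P := by
  have hre : ∀ k : ℤ, (ζ + k * (2 * Real.pi * I)).re ∈ I0 δ R := fun k => by
    convert hζ using 1; simp
  induction k using Int.induction_on with
  | zero => simp
  | succ n ih =>
    have := hP.per _ (hre n)
    rw [ih] at this
    rw [show ζ + ((n + 1 : ℤ) : ℂ) * (2 * Real.pi * I) = ζ + (n : ℤ) * (2 * Real.pi * I) + 2 * Real.pi * I by
      push_cast; ring, this]
    push_cast; ring
  | pred n ih =>
    have := hP.per _ (hre (-n - 1))
    rw [show ζ + ((-n - 1 : ℤ) : ℂ) * (2 * Real.pi * I) + 2 * Real.pi * I = ζ + ((-n : ℤ) : ℂ) * (2 * Real.pi * I) by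
      push_cast; ring, ih] at this
    push_cast at this ⊢
    linear_combination -this

lemma I0_of {ζ : ℂ} (h : exp ζ ∈ ann δ R) : ζ.re ∈ I0 δ R := by
  have := h.1; have h2 := h.2; rw [norm_exp] at this h2; exact ⟨this, h2⟩

lemma Pot.lc (hP : Pot δ R u Φ P) (h : Sol δ R u F G) {ζ : ℂ} (hζ : exp ζ ∈ FB (ann δ R) u) {W : Set ℂ}
    (hW : W ∈ 𝓝 (exp ζ)) : ∃ N, IsOpen N ∧ exp ζ ∈ N ∧ N ⊆ W ∧ IsPreconnected (N ∩ FB (ann δ R) u) ∧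
      (∀ z ∈ N, z / exp ζ ∈ slitPlane) ∧ ∀ z ∈ N ∩ FB (ann δ R) u, Φ (ζ + log (z / exp ζ)) = Φ ζ := by
  set p := exp ζ with hp
  have hp0 : p ≠ 0 := exp_ne_zero ζ
  have hcd : ContinuousAt (fun z => z / p) p := by fun_prop
  have hs : {z | z / p ∈ slitPlane} ∈ 𝓝 p := hcd (isOpen_slitPlane.mem_nhds (by simp [hp0]))
  obtain ⟨N, h1, h2, h3, h4, h5, -, h7, h8⟩ := loc (ann_open δ R) h.h hζ (inter_mem hW hs)
  refine ⟨N, h1, h2, fun z hz => (h3 hz).1, h5, fun z hz => (h3 hz).2, ?_⟩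
  let g : ℂ → ℂ := fun z => ζ + log (z / p)
  have hg : ∀ z ∈ N, exp (g z) = z := fun z hz => by
    simp only [g]
    rw [exp_add, exp_log (slitPlane_ne_zero (h3 hz).2), ← hp]
    field_simp
  have hgI : ∀ z ∈ N, (g z).re ∈ I0 δ R := fun z hz => I0_of (by rw [hg z hz]; exact h4 hz)
  have hgd : ∀ z ∈ N, DifferentiableAt ℝ g z := fun z hz => by
    have : DifferentiableAt ℂ g z := by
      refine (differentiableAt_const _).add (DifferentiableAt.clog (by fun_prop) (h3 hz).2)
    exact this.restrictScalars ℝ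
  have hcont : ContinuousOn (fun z => Φ (g z)) N :=
    hP.c.comp (fun z hz => (hgd z hz).continuousAt.continuousWithinAt) hgI
  have hO : IsOpen (N \ closure (posSet (ann δ R) u)) := h1.sdiff isClosed_closure
  have hd : ∀ z ∈ N \ closure (posSet (ann δ R) u), HasFDerivAt (fun z => Φ (g z)) (0 : ℂ →L[ℝ] ℂ) z := fun z hz => by
    have := (hP.d0 (g z) (hgI z hz.1) (by rw [hg z hz.1]; exact hz.2)).comp z (hgd z hz.1).hasFDerivAt
    rw [ContinuousLinearMap.zero_comp] at this; exact this
  have hconst : ∀ z ∈ N \ closure (posSet (ann δ R) u), ∀ w ∈ N \ closure (posSet (ann δ R) u),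
      Φ (g z) = Φ (g w) := fun z hz w hw =>
    hO.is_const_of_fderiv_eq_zero (𝕜 := ℝ) h7 (fun z hz => (hd z hz).differentiableAt.differentiableWithinAt)
      (fun z hz => (hd z hz).fderiv) hz hw
  obtain ⟨w0, hw0⟩ : (N \ closure (posSet (ann δ R) u)).Nonempty := by
    rw [← closure_nonempty_iff]; exact ⟨p, h8 ⟨h2, hζ⟩⟩
  have key : ∀ z ∈ N ∩ FB (ann δ R) u, Φ (g z) = Φ (g w0) := fun z hz => by
    have hz' := h8 hz
    rw [mem_closure_iff_nhdsWithin_neBot] at hz'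
    have t1 := (hcont z hz.1).mono_left (nhdsWithin_mono z (diff_subset (t := closure (posSet (ann δ R) u))))
    refine tendsto_nhds_unique t1 (tendsto_const_nhds.congr' ?_)
    filter_upwards [self_mem_nhdsWithin] with w hw using hconst _ hw0 _ hw
  intro z hz
  have e1 := key z hz
  have e2 := key p ⟨h2, hζ⟩
  have e3 : g p = ζ := by simp [g, hp0]
  rw [e3] at e2
  exact e1.trans e2.symm

lemma Sol.Fcl (h : Sol δ R u F G) {p : ℂ} (hp : p ∈ FB (ann δ R) u) (hc : p ∈ closure F) : p ∈ F := by
  obtain ⟨q, hq⟩ := closure_nonempty_iff.1 ⟨p, hc⟩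
  have : IsPreconnected (insert p F) := h.pF.subset_closure (subset_insert _ _) (insert_subset hc subset_closure)
  exact h.cF q hq _ (insert_subset hp h.Fs) this (mem_insert_of_mem _ hq) (mem_insert _ _)

lemma Sol.Fcpt (h : Sol δ R u F G) {a b : ℝ} (ha : δ < a) (hb : b < R) :
    IsCompact (F ∩ {z | a ≤ ‖z‖ ∧ ‖z‖ ≤ b}) := by
  have hcl : IsClosed {z : ℂ | a ≤ ‖z‖ ∧ ‖z‖ ≤ b} :=
    (isClosed_le continuous_const continuous_norm).inter (isClosed_le continuous_norm continuous_const)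
  refine Metric.isCompact_of_isClosed_isBounded ?_ ((isBounded_closedBall (x := (0:ℂ)) (r := b)).subset
    fun z hz => by simpa using hz.2.2)
  refine isClosed_of_closure_subset fun z hz => ?_
  have h2 : z ∈ {z : ℂ | a ≤ ‖z‖ ∧ ‖z‖ ≤ b} := hcl.closure_subset (closure_mono inter_subset_right hz)
  have h3 : z ∈ closure F := closure_mono inter_subset_left hz
  refine ⟨h.Fcl ⟨⟨ha.trans_le h2.1, h2.2.trans_lt hb⟩, ?_⟩ h3, h2⟩
  exact isClosed_frontier.closure_subset (closure_mono (h.Fs.trans inter_subset_right) h3)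

lemma Sol.sv1 (h : Sol δ R u F G) (hP : Pot δ R u Φ P) {a b : ℝ} (ha : δ < a) (hb : b < R)
    {ℓ : ℝ → ℂ → ℂ} (hc : ∀ η > 0, ContinuousOn (ℓ η) (closure (posSet (ann δ R) u) ∩ {z | δ + η ≤ ‖z‖ ∧ ‖z‖ ≤ R - η}))
    (hl : ∀ η > 0, ∀ z ∈ closure (posSet (ann δ R) u) ∩ {z | δ + η ≤ ‖z‖ ∧ ‖z‖ ≤ R - η}, exp (ℓ η z) = z) :
    ∀ᶠ η in 𝓝[>] (0:ℝ), ∃ c, ∀ p ∈ F ∩ {z | a ≤ ‖z‖ ∧ ‖z‖ ≤ b}, Φ (ℓ η p) = c := by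
  have hA : ∀ p ∈ FB (ann δ R) u, ∃ N, IsOpen N ∧ p ∈ N ∧ ∀ᶠ η in 𝓝[>] (0:ℝ), ∀ p' ∈ N ∩ FB (ann δ R) u,
      Φ (ℓ η p') = Φ (ℓ η p) := fun p hp => by
    have hpa := hp.1
    have hp0 : p ≠ 0 := norm_pos_iff.1 (h.hδ.trans hpa.1)
    obtain ⟨e, he, he'⟩ := exists_between (lt_min (sub_pos.2 hpa.1) (sub_pos.2 hpa.2))
    rw [lt_min_iff] at he'
    have hW : {z : ℂ | δ + e < ‖z‖ ∧ ‖z‖ < R - e} ∈ 𝓝 p := by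
      refine ((isOpen_lt continuous_const continuous_norm).inter (isOpen_lt continuous_norm continuous_const)).mem_nhds ?_
      have e1 := he'.1
      have e2 := he'.2
      exact ⟨show δ + e < ‖p‖ by linarith, show ‖p‖ < R - e by linarith⟩
    have hlp := exp_log hp0
    obtain ⟨N, h1, h2, h3, h4, h5, h6⟩ := hP.lc h (ζ := log p) (by rwa [hlp]) (by rwa [hlp])
    rw [hlp] at h2 h5 h6
    refine ⟨N, h1, h2, ?_⟩
    filter_upwards [Ioo_mem_nhdsGT he] with η hη p' hp'
    have hsub : N ∩ FB (ann δ R) u ⊆ closure (posSet (ann δ R) u) ∩ {z | δ + η ≤ ‖z‖ ∧ ‖z‖ ≤ R - η} := fun z hz =>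
      ⟨frontier_subset_closure hz.2.2, by linarith [hη.2, (h3 hz.1).1], by linarith [hη.2, (h3 hz.1).2]⟩
    have hg : ContinuousOn (fun z => log p + log (z / p)) (N ∩ FB (ann δ R) u) :=
      continuousOn_const.add (ContinuousOn.clog (by fun_prop) fun z hz => h5 z hz.1)
    have hge : ∀ z ∈ N, exp (log p + log (z / p)) = z := fun z hz => by
      rw [exp_add, exp_log (slitPlane_ne_zero (h5 z hz)), hlp]; field_simp
    obtain ⟨k, hk⟩ := log_unique h4 ((hc η hη.1).mono hsub) hg fun z hz => by
      rw [hl η hη.1 z (hsub hz), hge z hz.1]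
    rw [hk p' hp', hk p ⟨h2, hp⟩, hP.perk, hP.perk, h6 p' hp', h6 p ⟨h2, hp⟩]
    · exact I0_of (by rw [hge p h2]; exact hp.1)
    · exact I0_of (by rw [hge p' hp'.1]; exact hp'.2.1)
  have hB : ∀ p ∈ F, ∀ p' ∈ F, ∀ᶠ η in 𝓝[>] (0:ℝ), Φ (ℓ η p) = Φ (ℓ η p') := fun p hp p' hp' => by
    refine h.pF.induction₂ (fun p p' => ∀ᶠ η in 𝓝[>] (0:ℝ), Φ (ℓ η p) = Φ (ℓ η p')) ?_ ?_ ?_ hp hp'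
    · intro x hx
      obtain ⟨N, h1, h2, h3⟩ := hA x (h.Fs hx)
      filter_upwards [mem_nhdsWithin_of_mem_nhds (h1.mem_nhds h2), self_mem_nhdsWithin] with y hy hyF
      filter_upwards [h3] with η hη using (hη y ⟨hy, h.Fs hyF⟩).symm
    · intro x y z _ _ _ h1 h2
      filter_upwards [h1, h2] with η a b using a.trans b
    · intro x y _ _ h1
      filter_upwards [h1] with η a using a.symm
  rcases (F ∩ {z | a ≤ ‖z‖ ∧ ‖z‖ ≤ b}).eq_empty_or_nonempty with he | ⟨p0, hp0⟩
  · rw [he]; exact .of_forall fun η => ⟨0, by simp⟩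
  have hC : ∀ᶠ η in 𝓝[>] (0:ℝ), ∀ p ∈ (F ∩ {z | a ≤ ‖z‖ ∧ ‖z‖ ≤ b}), p ∈ F → Φ (ℓ η p) = Φ (ℓ η p0) := by
    refine (h.Fcpt ha hb).induction_on (p := fun S => ∀ᶠ η in 𝓝[>] (0:ℝ), ∀ p ∈ S, p ∈ F → Φ (ℓ η p) = Φ (ℓ η p0))
      (by simp) ?_ ?_ ?_
    · intro s t hst ht
      filter_upwards [ht] with η hη p hp using hη p (hst hp)
    · intro s t hs ht
      filter_upwards [hs, ht] with η h1 h2 p hp using hp.elim (h1 p) (h2 p)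
    · intro x hx
      obtain ⟨N, h1, h2, h3⟩ := hA x (h.Fs hx.1)
      refine ⟨N, mem_nhdsWithin_of_mem_nhds (h1.mem_nhds h2), ?_⟩
      filter_upwards [h3, hB x hx.1 p0 hp0.1] with η e1 e2 p hp hpF
      rw [e1 p ⟨hp, h.Fs hpF⟩, e2]
  filter_upwards [hC] with η hη using ⟨_, fun p hp => hη p hp hp.1⟩

lemma Sol.sv (h : Sol δ R u F G) (hP : Pot δ R u Φ P) {a b : ℝ} (ha : δ < a) (hb : b < R) :
    ∃ (ℓ : ℂ → ℂ) (c1 c2 : ℂ), ContinuousOn ℓ (closure (posSet (ann δ R) u) ∩ {z | a ≤ ‖z‖ ∧ ‖z‖ ≤ b}) ∧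
      (∀ z ∈ closure (posSet (ann δ R) u) ∩ {z | a ≤ ‖z‖ ∧ ‖z‖ ≤ b}, exp (ℓ z) = z) ∧
      (∀ p ∈ F, a ≤ ‖p‖ → ‖p‖ ≤ b → Φ (ℓ p) = c1) ∧ (∀ p ∈ G, a ≤ ‖p‖ → ‖p‖ ≤ b → Φ (ℓ p) = c2) := by
  have := fun (η : ℝ) (hη : 0 < η) => h.clog (a := δ + η) (b := R - η) (by linarith) (by linarith)
  choose! ℓ hc hl using this
  obtain ⟨η, ⟨c1, h1⟩, ⟨c2, h2⟩, h3⟩ := ((h.sv1 hP ha hb hc hl).and ((h.swap.sv1 hP ha hb hc hl).and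
    (Ioo_mem_nhdsGT (lt_min (sub_pos.2 ha) (sub_pos.2 hb))))).exists
  have h4 := lt_min_iff.1 h3.2
  have hsub : closure (posSet (ann δ R) u) ∩ {z | a ≤ ‖z‖ ∧ ‖z‖ ≤ b} ⊆
      closure (posSet (ann δ R) u) ∩ {z | δ + η ≤ ‖z‖ ∧ ‖z‖ ≤ R - η} := fun z hz =>
    ⟨hz.1, by linarith [hz.2.1], by linarith [hz.2.2]⟩
  exact ⟨ℓ η, c1, c2, (hc η h3.1).mono hsub, fun z hz => hl η h3.1 z (hsub hz),
    fun p hp x y => h1 p ⟨hp, x, y⟩, fun p hp x y => h2 p ⟨hp, x, y⟩⟩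
end

structure SV (δ R : ℝ) (u : ℂ → ℝ) (F G : Set ℂ) (Φ : ℂ → ℂ) (P : ℂ) (a b : ℝ) (ℓ : ℂ → ℂ) (c1 c2 : ℂ) : Prop where
  s : Sol δ R u F G
  p : Pot δ R u Φ P
  c : ContinuousOn ℓ (closure (posSet (ann δ R) u) ∩ {z | a ≤ ‖z‖ ∧ ‖z‖ ≤ b})
  e : ∀ z ∈ closure (posSet (ann δ R) u) ∩ {z | a ≤ ‖z‖ ∧ ‖z‖ ≤ b}, exp (ℓ z) = z
  f : ∀ p ∈ F, a ≤ ‖p‖ → ‖p‖ ≤ b → Φ (ℓ p) = c1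
  g : ∀ p ∈ G, a ≤ ‖p‖ → ‖p‖ ≤ b → Φ (ℓ p) = c2

noncomputable def ga (x t : ℝ) : ℂ := exp (x + t * I)

lemma ga_norm (x t : ℝ) : ‖ga x t‖ = Real.exp x := by simp [ga, norm_exp]

lemma ga_cont (x : ℝ) : Continuous (ga x) := by unfold ga; fun_prop

lemma ga_per (x t : ℝ) (k : ℤ) : ga x (t + k • (2 * Real.pi)) = ga x t := by
  unfold ga
  refine exp_eq_exp_iff_exists_int.2 ⟨k, ?_⟩
  push_cast [zsmul_eq_mul]; ring

lemma ga_surj {x : ℝ} {z : ℂ} (hz : ‖z‖ = Real.exp x) : ∃ t, ga x t = z := by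
  have hz0 : z ≠ 0 := norm_pos_iff.1 (by rw [hz]; positivity)
  refine ⟨(log z).im, ?_⟩
  rw [ga, show (x : ℂ) + (log z).im * I = log z from ?_, exp_log hz0]
  have : (log z).re = x := by rw [log_re, hz, Real.log_exp]
  rw [← this]; exact re_add_im _

section
variable {δ R : ℝ} {u : ℂ → ℝ} {F G : Set ℂ}

lemma Sol.alt (h : Sol δ R u F G) {x : ℝ} (hx : x ∈ I0 δ R) {S : Set ℝ} (hS : IsPreconnected S)
    (hF : ∀ t ∈ S, ga x t ∉ FB (ann δ R) u) : (∀ t ∈ S, ga x t ∈ posSet (ann δ R) u) ∨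
      ∀ t ∈ S, ga x t ∉ closure (posSet (ann δ R) u) := by
  set D := posSet (ann δ R) u
  have hA : ∀ t, ga x t ∈ ann δ R := fun t => by
    constructor <;> rw [ga_norm]; exacts [hx.1, hx.2]
  have hcov : S ⊆ ga x ⁻¹' D ∪ ga x ⁻¹' (closure D)ᶜ := fun t ht => by
    by_contra hn
    simp only [mem_union, mem_preimage, mem_compl_iff, not_or, not_not] at hn
    exact hF t ht ((FB_iff (ann_open δ R) h.h).2 ⟨hA t, hn.2, hn.1⟩)
  have hd : Disjoint (ga x ⁻¹' D) (ga x ⁻¹' (closure D)ᶜ) := Set.disjoint_left.2 fun t h1 h2 => h2 (subset_closure h1)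
  by_cases hh : (S ∩ ga x ⁻¹' D).Nonempty
  · exact Or.inl (hS.subset_left_of_subset_union (h.o.preimage (ga_cont x))
      (isClosed_closure.isOpen_compl.preimage (ga_cont x)) hd hcov hh)
  · exact Or.inr fun t ht => (hcov ht).resolve_left fun h' => hh ⟨t, ht, h'⟩

lemma Sol.Tc (h : Sol δ R u F G) {x : ℝ} (hx : x ∈ I0 δ R) : IsClosed {t | ga x t ∈ FB (ann δ R) u} := by
  have : {t | ga x t ∈ FB (ann δ R) u} = ga x ⁻¹' frontier (posSet (ann δ R) u) := by
    ext t
    refine ⟨fun h => h.2, fun h => ⟨?_, h⟩⟩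
    constructor <;> rw [ga_norm]; exacts [hx.1, hx.2]
  rw [this]; exact isClosed_frontier.preimage (ga_cont x)

lemma Sol.circF (h : Sol δ R u F G) {x : ℝ} (hx : x ∈ I0 δ R) : ∃ t, ga x t ∈ F := by
  obtain ⟨z, hz, hz'⟩ := circ_of h.pF h.F1 h.F2 hx.1 hx.2
  obtain ⟨t, rfl⟩ := ga_surj hz'
  exact ⟨t, hz⟩

lemma Sol.last (h : Sol δ R u F G) {x : ℝ} (hx : x ∈ I0 δ R) (t : ℝ) : ∃ s, ga x s ∈ FB (ann δ R) u ∧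
    s ≤ t ∧ t - s ≤ 2 * Real.pi ∧ (∀ r ∈ Ioc s t, ga x r ∉ FB (ann δ R) u) ∧
    s = sSup ({t | ga x t ∈ FB (ann δ R) u} ∩ Iic t) := by
  obtain ⟨t0, ht0⟩ := h.circF hx
  obtain ⟨k, hk, -⟩ := existsUnique_add_zsmul_mem_Ioc Real.two_pi_pos t0 (t - 2 * Real.pi)
  have hm : t0 + k • (2 * Real.pi) ∈ {t | ga x t ∈ FB (ann δ R) u} ∩ Iic t :=
    ⟨by rw [mem_setOf_eq, ga_per]; exact h.Fs ht0, by simpa using hk.2⟩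
  have hbd : BddAbove ({t | ga x t ∈ FB (ann δ R) u} ∩ Iic t) := ⟨t, fun s hs => hs.2⟩
  have hmem := ((h.Tc hx).inter isClosed_Iic).csSup_mem ⟨_, hm⟩ hbd
  have := le_csSup hbd hm
  exact ⟨_, hmem.1, hmem.2, by linarith [hk.1], fun r hr hr' => not_le.2 hr.1 (le_csSup hbd ⟨hr', hr.2⟩), rfl⟩

variable {Φ ℓ : ℂ → ℂ} {P c1 c2 : ℂ} {a b : ℝ}

lemma SV.val (h : SV δ R u F G Φ P a b ℓ c1 c2) {p : ℂ} (hp : p ∈ FB (ann δ R) u) (h1 : a ≤ ‖p‖) (h2 : ‖p‖ ≤ b) :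
    Φ (ℓ p) = c1 ∨ Φ (ℓ p) = c2 := by
  rw [← h.s.FG] at hp
  exact hp.imp (fun h' => h.f p h' h1 h2) fun h' => h.g p h' h1 h2

lemma SV.gapD (h : SV δ R u F G Φ P a b ℓ c1 c2) {x : ℝ} (hx : x ∈ I0 δ R) (h1 : a ≤ Real.exp x)
    (h2 : Real.exp x ≤ b) {s t : ℝ} (hst : s ≤ t) (hD : ∀ r ∈ Icc s t, ga x r ∈ closure (posSet (ann δ R) u)) :
    ∃ k : ℤ, Φ (ℓ (ga x t)) = Φ (x + t * I) + k * P ∧ Φ (ℓ (ga x s)) = Φ (x + s * I) + k * P := by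
  have hm : ∀ r ∈ Icc s t, ga x r ∈ closure (posSet (ann δ R) u) ∩ {z | a ≤ ‖z‖ ∧ ‖z‖ ≤ b} := fun r hr =>
    ⟨hD r hr, by rw [ga_norm]; exact h1, by rw [ga_norm]; exact h2⟩
  obtain ⟨k, hk⟩ := log_unique (f := fun r => ℓ (ga x r)) (g := fun r : ℝ => (x : ℂ) + r * I) isPreconnected_Icc
    (h.c.comp (ga_cont x).continuousOn hm) (by fun_prop) (fun r hr => by rw [h.e _ (hm r hr)]; rfl)
  refine ⟨k, ?_, ?_⟩
  · rw [hk t (right_mem_Icc.2 hst), h.p.perk (by simpa using hx)]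
  · rw [hk s (left_mem_Icc.2 hst), h.p.perk (by simpa using hx)]

lemma ioc_cl {x s t : ℝ} {D : Set ℂ} (hst : s < t) (hD : ∀ r ∈ Ioo s t, ga x r ∈ D) : ∀ r ∈ Icc s t, ga x r ∈ closure D := by
  rw [← closure_Ioo hst.ne]
  have hm : MapsTo (ga x) (Ioo s t) D := hD
  exact fun r hr => (hm.closure (ga_cont x)) hr

lemma SV.arc (h : SV δ R u F G Φ P a b ℓ c1 c2) {x : ℝ} (h1 : a ≤ Real.exp x) (h2 : Real.exp x ≤ b)
    (h3 : 2 * δ ≤ Real.exp x) (h4 : Real.exp x ≤ R / 2) {z : ℂ} (hz : z ∈ posSet (ann δ R) u)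
    (hzx : ‖z‖ = Real.exp x) : ‖Φ (ℓ z) - c1‖ ≤ 2 * Real.pi * CM * Real.exp x + ‖c1 - c2‖ := by
  have hδ := h.s.hδ
  have hx : x ∈ I0 δ R := ⟨by linarith, by linarith⟩
  obtain ⟨t, rfl⟩ := ga_surj hzx
  obtain ⟨s, hs, hst, hd, hno, -⟩ := h.s.last hx t
  have hst' : s < t := lt_of_le_of_ne hst fun he => ((FB_iff (ann_open δ R) h.s.h).1 hs).2.2 (he ▸ hz)
  have hD : ∀ r ∈ Ioc s t, ga x r ∈ posSet (ann δ R) u := by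
    refine (h.s.alt hx isPreconnected_Ioc hno).resolve_right fun hh => ?_
    exact hh t (right_mem_Ioc.2 hst') (subset_closure hz)
  obtain ⟨k, e1, e2⟩ := h.gapD hx h1 h2 hst (ioc_cl hst' fun r hr => hD r (Ioo_subset_Ioc_self hr))
  have hb := h.p.v x h3 h4 s t
  have e3 : Φ (ℓ (ga x t)) - Φ (ℓ (ga x s)) = Φ (x + t * I) - Φ (x + s * I) := by rw [e1, e2]; ring
  rw [← e3, abs_of_nonneg (by linarith)] at hb
  have hCM := CM_pos
  have hb' : ‖Φ (ℓ (ga x t)) - Φ (ℓ (ga x s))‖ ≤ 2 * Real.pi * CM * Real.exp x := by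
    refine hb.trans ?_
    have : 0 < CM * Real.exp x := by positivity
    nlinarith
  rcases h.val hs (by rw [ga_norm]; exact h1) (by rw [ga_norm]; exact h2) with hc | hc <;> rw [hc] at hb'
  · have := norm_nonneg (c1 - c2); linarith
  · have := norm_sub_le_norm_sub_add_norm_sub (Φ (ℓ (ga x t))) c2 c1
    rw [norm_sub_rev c2 c1] at this; linarith

lemma SV.cc (h : SV δ R u F G Φ P a b ℓ c1 c2) {x : ℝ} (h1 : a ≤ Real.exp x) (h2 : Real.exp x ≤ b)
    (h3 : 2 * δ ≤ Real.exp x) (h4 : Real.exp x ≤ R / 2) : ‖c1 - c2‖ ≤ 2 * Real.pi * CM * Real.exp x := by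
  have hδ := h.s.hδ
  have hx : x ∈ I0 δ R := ⟨by linarith, by linarith⟩
  have hCM := CM_pos
  by_contra! hbig
  set A : ℝ → ℂ := fun t => Φ (x + t * I) with hA
  have hAc : Continuous A := by
    rw [← continuousOn_univ]
    exact h.p.c.comp (by fun_prop) fun t _ => by simpa using hx
  set T := {t | ga x t ∈ FB (ann δ R) u} with hT
  have hv : ∀ t ∈ T, Φ (ℓ (ga x t)) = c1 ∨ Φ (ℓ (ga x t)) = c2 := fun t ht =>
    h.val ht (by rw [ga_norm]; exact h1) (by rw [ga_norm]; exact h2)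
  have hgap : ∀ s ∈ T, ∀ t ∈ T, s < t → (∀ r ∈ Ioo s t, r ∉ T) → A s = A t := fun s hs t ht hst hno => by
    rcases h.s.alt hx isPreconnected_Ioo hno with hD | hO
    · have hlen : t - s ≤ 2 * Real.pi := by
        by_contra! hl
        refine hno (s + (1 : ℤ) • (2 * Real.pi)) ⟨?_, ?_⟩ ?_
        · have := Real.pi_pos; simp; positivity
        · simp; linarith
        · rw [hT, mem_setOf_eq, ga_per]; exact hs
      obtain ⟨k, e1, e2⟩ := h.gapD hx h1 h2 hst.le (ioc_cl hst hD)
      have hb := h.p.v x h3 h4 s t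
      rw [abs_of_nonneg (by linarith)] at hb
      have hb' : ‖A t - A s‖ ≤ 2 * Real.pi * CM * Real.exp x := by
        refine hb.trans ?_
        have : 0 < CM * Real.exp x := by positivity
        nlinarith
      have e3 : A t - A s = Φ (ℓ (ga x t)) - Φ (ℓ (ga x s)) := by rw [e1, e2]; ring
      rcases hv s hs with q1 | q1 <;> rcases hv t ht with q2 | q2 <;> rw [q1, q2] at e3
      · rw [sub_self, sub_eq_zero] at e3; exact e3.symm
      · rw [e3, norm_sub_rev] at hb'; linarith
      · rw [e3] at hb'; linarith
      · rw [sub_self, sub_eq_zero] at e3; exact e3.symm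
    · have hd : ∀ r ∈ Ioo s t, HasDerivAt A 0 r := fun r hr => by
        have e1 := h.p.d0 (x + r * I) (by simpa using hx) (hO r hr)
        have e2 : HasDerivAt (fun r : ℝ => (x : ℂ) + r * I) I r := by
          have := ((hasDerivAt_id r).ofReal_comp.mul_const I).const_add (x : ℂ)
          simpa using this
        exact e1.comp_hasDerivAt r e2
      have hc : ∀ r ∈ Ioo s t, A r = A t := fun r hr => by
        have := constant_of_has_deriv_right_zero (f := A) (a := r) (b := t) hAc.continuousOn
          (fun y hy => (hd y ⟨hr.1.trans_le hy.1, hy.2⟩).hasDerivWithinAt) t (right_mem_Icc.2 hr.2.le)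
        exact this.symm
      have t1 : Tendsto A (𝓝[>] s) (𝓝 (A s)) := hAc.continuousAt.tendsto.mono_left nhdsWithin_le_nhds
      refine tendsto_nhds_unique t1 (tendsto_const_nhds.congr' ?_)
      filter_upwards [Ioo_mem_nhdsGT hst] with r hr using (hc r hr).symm
  have hloc : ∀ t0 ∈ T, ∃ e > 0, ∀ t ∈ T, |t - t0| < e → A t = A t0 := fun t0 ht0 => by
    obtain ⟨N, n1, n2, -, -, n5, n6⟩ := h.p.lc h.s (ζ := x + t0 * I) ht0 univ_mem
    obtain ⟨e, he, hN⟩ := Metric.mem_nhds_iff.1 ((ga_cont x).continuousAt (n1.mem_nhds n2))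
    refine ⟨min e Real.pi, lt_min he Real.pi_pos, fun t ht htt => ?_⟩
    rw [lt_min_iff] at htt
    have := n6 (ga x t) ⟨hN (by rw [mem_ball, Real.dist_eq]; exact htt.1), ht⟩
    have e1 : ga x t / exp (x + t0 * I) = exp ((t - t0 : ℝ) * I) := by
      rw [ga, ← exp_sub]; congr 1; push_cast; ring
    have hab := abs_lt.1 htt.2
    rw [e1, log_exp (by simp; linarith) (by simp; linarith)] at this
    rw [hA]; simp only
    rw [← this]; congr 1; push_cast; ring
  set S : ℝ → ℝ := fun t => sSup (T ∩ Iic t) with hS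
  have hS1 : ∀ t, S t ∈ T ∧ S t ≤ t ∧ (∀ r ∈ Ioc (S t) t, r ∉ T) := fun t => by
    obtain ⟨s, q1, q2, -, q4, q5⟩ := h.s.last hx t
    have : S t = s := q5.symm
    rw [this]; exact ⟨q1, q2, q4⟩
  have hS2 : ∀ t, ∀ s ∈ T, s ≤ t → s ≤ S t := fun t s hs hst => by
    by_contra! hlt
    exact (hS1 t).2.2 s ⟨hlt, hst⟩ hs
  have hST : ∀ t ∈ T, S t = t := fun t ht => le_antisymm (hS1 t).2.1 (hS2 t t ht le_rfl)
  have hlc : IsLocallyConstant (fun t => A (S t)) := by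
    refine IsLocallyConstant.iff_eventually_eq _ |>.2 fun t0 => ?_
    by_cases ht0 : t0 ∈ T
    · rw [hST t0 ht0]
      obtain ⟨e, he, hle⟩ := hloc t0 ht0
      by_cases hacc : ∃ s ∈ T, s < t0 ∧ t0 - e < s
      · obtain ⟨s, hs, hst, hse⟩ := hacc
        filter_upwards [Ioo_mem_nhds hst (show t0 < t0 + e by linarith)] with t ht
        refine hle _ (hS1 t).1 ?_
        have := hS2 t s hs ht.1.le
        have := (hS1 t).2.1
        have := ht.2
        rw [abs_lt]; constructor <;> linarith
      · push Not at hacc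
        filter_upwards [Ioo_mem_nhds (show t0 - e < t0 by linarith) (show t0 < t0 + e by linarith)] with t ht
        rcases le_or_gt t0 t with hlt | hlt
        · refine hle _ (hS1 t).1 ?_
          have := hS2 t t0 ht0 hlt
          have := (hS1 t).2.1
          have := ht.2
          rw [abs_lt]; constructor <;> linarith
        · have q := (hS1 t).2.1
          refine hgap _ (hS1 t).1 _ ht0 (by linarith) fun r hr hrT => ?_
          rcases le_or_gt r t with hrt | hrt
          · exact (hS1 t).2.2 r ⟨hr.1, hrt⟩ hrT
          · have := hacc r hrT hr.2; linarith [ht.1]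
    · have hTc : IsOpen Tᶜ := (h.s.Tc hx).isOpen_compl
      obtain ⟨e, he, hN⟩ := Metric.isOpen_iff.1 hTc t0 ht0
      filter_upwards [ball_mem_nhds t0 he] with t ht
      have hno : ∀ r ∈ T, ¬ (|r - t0| < e) := fun r hr hr' => hN (by rwa [mem_ball, Real.dist_eq]) hr
      rw [mem_ball, Real.dist_eq, abs_lt] at ht
      have : S t = S t0 := by
        refine le_antisymm (hS2 _ _ (hS1 t).1 ?_) (hS2 _ _ (hS1 t0).1 ?_)
        · by_contra! hh
          refine hno _ (hS1 t).1 (abs_lt.2 ⟨by linarith, by linarith [(hS1 t).2.1]⟩)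
        · by_contra! hh
          refine hno _ (hS1 t0).1 (abs_lt.2 ⟨by linarith, by linarith [(hS1 t0).2.1]⟩)
      rw [this]
  have hconst : ∀ s ∈ T, ∀ t ∈ T, A s = A t := fun s hs t ht => by
    have := hlc.apply_eq_of_isPreconnected isPreconnected_univ (mem_univ s) (mem_univ t)
    simpa only [hST s hs, hST t ht] using this
  obtain ⟨t1, ht1⟩ := h.s.circF hx
  obtain ⟨t2, ht2⟩ := h.s.swap.circF hx
  have hP0 : P = 0 := by
    have e1 := hconst t1 (h.s.Fs ht1) (t1 + (1 : ℤ) • (2 * Real.pi)) (by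
      rw [hT, mem_setOf_eq, ga_per]; exact h.s.Fs ht1)
    have e2 := h.p.per (x + t1 * I) (by simpa using hx)
    have e3 : A (t1 + (1 : ℤ) • (2 * Real.pi)) = Φ (x + t1 * I + 2 * Real.pi * I) := by
      rw [hA]; simp only; congr 1; push_cast [one_zsmul]; ring
    rw [e3, e2] at e1
    simpa [hA] using e1
  have hfin : ∀ t ∈ T, Φ (ℓ (ga x t)) = A t := fun t ht => by
    obtain ⟨k, e1, -⟩ := h.gapD hx h1 h2 (le_refl t) (fun r hr => by
      rw [Icc_self, mem_singleton_iff] at hr; rw [hr]; exact frontier_subset_closure ht.2)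
    rw [e1, hP0]; simp [hA]
  have f1 := h.f _ ht1 (by rw [ga_norm]; exact h1) (by rw [ga_norm]; exact h2)
  have f2 := h.g _ ht2 (by rw [ga_norm]; exact h1) (by rw [ga_norm]; exact h2)
  rw [hfin _ (h.s.Fs ht1)] at f1
  rw [hfin _ (h.s.swap.Fs ht2)] at f2
  have : c1 = c2 := by rw [← f1, ← f2]; exact hconst _ (h.s.Fs ht1) _ (h.s.swap.Fs ht2)
  rw [this, sub_self, norm_zero] at hbig
  have : 0 < 2 * Real.pi * CM * Real.exp x := by have := Real.pi_pos; positivity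
  linarith
end

section
variable {E : Type*} [NormedAddCommGroup E] [NormedSpace ℝ E]

lemma lipA {f : ℂ → E} {f' : ℂ → ℂ →L[ℝ] E} {Z : Set ℂ} {L ε ρ : ℝ} (hL : 0 ≤ L) (hε : 0 ≤ ε) (hZ : IsClosed Z)
    (h0 : ∀ z ∈ Z, f z = 0) (hd : ∀ z ∈ ball (0:ℂ) ρ, z ∉ Z → HasFDerivAt f (f' z) z ∧ ‖f' z‖ ≤ L)
    (hb : ∀ p ∈ Z, p ∈ ball (0:ℂ) ρ → ∀ᶠ z in 𝓝 p, ‖f z‖ ≤ ε) {z p : ℂ} (hz : z ∈ ball (0:ℂ) ρ) (hp : p ∈ Z)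
    (hpB : p ∈ ball (0:ℂ) ρ) : ‖f z‖ ≤ L * ‖p - z‖ + ε := by
  by_cases hzZ : z ∈ Z
  · rw [h0 z hzZ, norm_zero]; positivity
  let γ : ℝ → ℂ := fun t => z + t • (p - z)
  have hγc : Continuous γ := by fun_prop
  have hγB : ∀ t ∈ Icc (0:ℝ) 1, γ t ∈ ball (0:ℂ) ρ := fun t ht =>
    (convex_ball (0:ℂ) ρ).add_smul_sub_mem hz hpB ht
  let T : Set ℝ := Icc 0 1 ∩ γ ⁻¹' Z
  have hT : IsCompact T := isCompact_Icc.inter_right (hZ.preimage hγc)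
  have hTne : T.Nonempty := ⟨1, by simp, by simpa [γ] using hp⟩
  set s := sInf T
  have hs : s ∈ T := hT.sInf_mem hTne
  have hs0 : 0 < s := lt_of_le_of_ne hs.1.1 fun he => hzZ (by
    have := hs.2; rw [← he] at this; simpa [γ] using this)
  have hlt : ∀ t, 0 ≤ t → t < s → γ t ∉ Z := fun t h1 h2 h3 =>
    not_le.2 h2 (csInf_le hT.bddBelow ⟨⟨h1, h2.le.trans hs.1.2⟩, h3⟩)
  have hev := hγc.continuousAt.tendsto.eventually (hb (γ s) hs.2 (hγB s hs.1))
  obtain ⟨t, ht, ht'⟩ := ((hev.filter_mono nhdsWithin_le_nhds).and (Ioo_mem_nhdsLT hs0)).exists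
  have hseg : ∀ w ∈ segment ℝ z (γ t), w ∈ ball (0:ℂ) ρ ∧ w ∉ Z := fun w hw => by
    rw [segment_eq_image'] at hw
    obtain ⟨c, hc, rfl⟩ := hw
    have : z + c • (γ t - z) = γ (c * t) := by simp [γ, mul_assoc]
    change z + c • (γ t - z) ∈ _ ∧ z + c • (γ t - z) ∉ _
    rw [this]
    have h1 : 0 ≤ c * t := mul_nonneg hc.1 ht'.1.le
    have h2 : c * t < s := by nlinarith [hc.1, hc.2, ht'.1, ht'.2]
    exact ⟨hγB _ ⟨h1, by linarith [hs.1.2]⟩, hlt _ h1 h2⟩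
  have := (convex_segment z (γ t)).norm_image_sub_le_of_norm_hasFDerivWithin_le (f := f) (f' := f') (C := L)
    (fun w hw => (hd w (hseg w hw).1 (hseg w hw).2).1.hasFDerivWithinAt) (fun w hw => (hd w (hseg w hw).1 (hseg w hw).2).2)
    (right_mem_segment ℝ z (γ t)) (left_mem_segment ℝ z (γ t))
  have e1 : ‖z - γ t‖ ≤ ‖p - z‖ := by
    simp only [γ, sub_add_cancel_left, norm_neg, norm_smul, Real.norm_eq_abs, abs_of_pos ht'.1]
    have := ht'.2; have := hs.1.2
    have := norm_nonneg (p - z)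
    nlinarith
  have e2 := mul_le_mul_of_nonneg_left e1 hL
  have e3 := norm_le_norm_sub_add (f z) (f (γ t))
  linarith

lemma lipB {f : ℂ → E} {f' : ℂ → ℂ →L[ℝ] E} {Z : Set ℂ} {L ε ρ : ℝ} (hL : 0 ≤ L) (hε : 0 ≤ ε) (hZ : IsClosed Z)
    (h0 : ∀ z ∈ Z, f z = 0) (hd : ∀ z ∈ ball (0:ℂ) ρ, z ∉ Z → HasFDerivAt f (f' z) z ∧ ‖f' z‖ ≤ L)
    (hb : ∀ p ∈ Z, p ∈ ball (0:ℂ) ρ → ∀ᶠ z in 𝓝 p, ‖f z‖ ≤ ε) {z w : ℂ} (hz : z ∈ ball (0:ℂ) ρ)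
    (hw : w ∈ ball (0:ℂ) ρ) : dist (f z) (f w) ≤ L * dist z w + 2 * ε := by
  have hsB : segment ℝ z w ⊆ ball (0:ℂ) ρ := (convex_ball (0:ℂ) ρ).segment_subset hz hw
  rw [dist_eq_norm, dist_eq_norm]
  by_cases hh : ∃ p ∈ segment ℝ z w, p ∈ Z
  · obtain ⟨p, hp, hpZ⟩ := hh
    have a1 := lipA hL hε hZ h0 hd hb hz hpZ (hsB hp)
    have a2 := lipA hL hε hZ h0 hd hb hw hpZ (hsB hp)
    have a3 : ‖p - z‖ + ‖p - w‖ = ‖z - w‖ := by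
      have := dist_add_dist_of_mem_segment hp
      rw [dist_eq_norm, dist_eq_norm, dist_eq_norm, norm_sub_rev z p] at this; exact this
    rw [← a3]
    have := norm_sub_le (f z) (f w)
    linarith
  · push Not at hh
    have := (convex_segment z w).norm_image_sub_le_of_norm_hasFDerivWithin_le (f := f) (f' := f') (C := L)
      (fun v hv => (hd v (hsB hv) (hh v hv)).1.hasFDerivWithinAt) (fun v hv => (hd v (hsB hv) (hh v hv)).2)
      (right_mem_segment ℝ z w) (left_mem_segment ℝ z w)
    linarith
end

lemma reL_norm (q : ℂ) : ‖reL q‖ ≤ ‖q‖ := by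
  refine ContinuousLinearMap.opNorm_le_bound _ (norm_nonneg _) fun x => ?_
  rw [reL_apply, ← norm_mul]; exact abs_re_le_norm _

lemma phL_norm (q : ℂ) : ‖phL q‖ ≤ ‖q‖ ^ 2 + 1 := by
  refine ContinuousLinearMap.opNorm_le_bound _ (by positivity) fun x => ?_
  rw [phL_apply]
  refine (norm_add_le _ _).trans ?_
  rw [norm_mul, norm_pow, norm_conj]; linarith

noncomputable def uu (δ : ℝ) (u : ℂ → ℝ) (z : ℂ) : ℝ := if ‖z‖ ≤ 4 * δ then 0 else u z
def ZZ (δ R : ℝ) (u : ℂ → ℝ) : Set ℂ := {z | ‖z‖ ≤ 4 * δ ∨ (4 * δ ≤ ‖z‖ ∧ ‖z‖ ≤ R / 4) ∧ u z = 0}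
noncomputable def KK : ℝ := 8 * (CL + 20 * CM + 1)

section
variable {δ R : ℝ} {u : ℂ → ℝ} {F G : Set ℂ}

lemma Sol.ZZc (h : Sol δ R u F G) (hR : 32 * δ < R) : IsClosed (ZZ δ R u) := by
  have hδ := h.hδ
  refine (isClosed_le continuous_norm continuous_const).union ?_
  have hc : ContinuousOn u {z | 4 * δ ≤ ‖z‖ ∧ ‖z‖ ≤ R / 4} := h.h.contOn.mono fun z hz => by
    have h1 := hz.1; have h2 := hz.2
    exact ⟨by linarith, by linarith⟩
  exact hc.preimage_isClosed_of_isClosed ((isClosed_le continuous_const continuous_norm).inter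
    (isClosed_le continuous_norm continuous_const)) isClosed_singleton

lemma Sol.offZ (h : Sol δ R u F G) {z : ℂ} (hz : ‖z‖ < R / 4) (hZ : z ∉ ZZ δ R u) :
    4 * δ < ‖z‖ ∧ z ∈ posSet (ann δ R) u := by
  have hδ := h.hδ
  simp only [ZZ, mem_setOf_eq, not_or, not_le, not_and] at hZ
  refine ⟨hZ.1, ?_⟩
  by_contra hn
  have hA : z ∈ ann δ R := ⟨by linarith [hZ.1], by linarith [norm_nonneg z]⟩
  exact hZ.2 ⟨hZ.1.le, hz.le⟩ (u_zero h.h hA hn)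

lemma Sol.circ1 (h : Sol δ R u F G) {z p : ℂ} {t : ℝ} (ht : ‖z‖ + t < R / 4)
    (hn : ∀ w, ‖w - z‖ = t → w ∉ ZZ δ R u) (hp : p ∈ F) (hpz : ‖p - z‖ ≤ t) : False := by
  have hδ := h.hδ
  obtain ⟨w, hw, hw'⟩ := h.near2 (b := R / 4) (by linarith [norm_nonneg z, (norm_nonneg (p - z)).trans hpz])
  have h1 : t ≤ ‖w - z‖ := by have := norm_sub_norm_le w z; linarith
  obtain ⟨v, hv, hv'⟩ := (h.pF.image (fun w => ‖w - z‖) (by fun_prop)).ordConnected.out (mem_image_of_mem _ hp)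
    (mem_image_of_mem _ hw) ⟨hpz, h1⟩
  have hv4 : ‖v‖ < R / 4 := by
    have := norm_le_norm_sub_add v z; simp only at hv'; linarith
  exact ((FB_iff (ann_open δ R) h.h).1 (h.Fs hv)).2.2 (h.offZ hv4 (hn v hv')).2

lemma Sol.circ (h : Sol δ R u F G) (hR : 32 * δ < R) {z : ℂ} (hz : z ∈ ZZ δ R u) {t : ℝ} (ht0 : 0 < t)
    (ht : ‖z‖ + t < R / 4) : ∃ w ∈ ZZ δ R u, ‖w - z‖ = t := by
  by_contra hno
  have hδ := h.hδ
  have hn : ∀ w, ‖w - z‖ = t → w ∉ ZZ δ R u := fun w hw hwZ => hno ⟨w, hwZ, hw⟩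
  have hkey : ∀ p ∈ FB (ann δ R) u, ‖p - z‖ ≤ t → False := fun p hp hpz => by
    rw [← h.FG] at hp
    rcases hp with hp | hp
    · exact h.circ1 ht hn hp hpz
    · exact h.swap.circ1 ht hn hp hpz
  have hball : ∀ v, ‖v‖ ≤ 4 * δ → ‖v - z‖ ≤ t → False := fun v hv hvt => by
    obtain ⟨p, hp, hp'⟩ := circ_of h.pF h.F1 h.F2 (r := 4 * δ) (by linarith) (by linarith)
    rcases le_or_gt ‖p - z‖ t with h1 | h1
    · exact hkey p (h.Fs hp) h1
    · obtain ⟨y, hy, hy'⟩ := ((convex_closedBall (0:ℂ) (4 * δ)).isPreconnected.image (fun w => ‖w - z‖) (by fun_prop)).ordConnected.out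
        (mem_image_of_mem _ (show v ∈ closedBall (0:ℂ) (4 * δ) by simpa using hv))
        (mem_image_of_mem _ (show p ∈ closedBall (0:ℂ) (4 * δ) by simp [hp'])) ⟨hvt, h1.le⟩
      exact hn y hy' (Or.inl (by simpa using hy))
  rcases hz with hz | ⟨hz, hz0⟩
  · exact hball z hz (by simpa using ht0.le)
  let w : ℂ := z + t
  have hw : ‖w - z‖ = t := by simp [w, abs_of_pos ht0]
  have hwD : w ∈ posSet (ann δ R) u := (h.offZ (by have := norm_le_norm_sub_add w z; linarith) (hn w hw)).2
  have hs : ∀ v ∈ segment ℝ z w, ‖v - z‖ ≤ t := fun v hv => by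
    have := dist_add_dist_of_mem_segment hv
    rw [dist_eq_norm, dist_eq_norm z w, norm_sub_rev z v, norm_sub_rev z w] at this
    have := dist_nonneg (x := v) (y := w); linarith
  obtain ⟨v, hvf, hv⟩ : ∃ v ∈ frontier (posSet (ann δ R) u), v ∈ segment ℝ z w := by
    by_contra! hcon
    have := sub_of_front h.o (convex_segment z w).isPreconnected ⟨w, right_mem_segment ℝ z w, hwD⟩ hcon
    exact (this (left_mem_segment ℝ z w)).2.ne' hz0
  refine hkey v ⟨⟨?_, ?_⟩, hvf⟩ (hs v hv)
  · by_contra! hh; exact hball v (by linarith) (hs v hv)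
  · have := norm_le_norm_sub_add v z; have := hs v hv; linarith [norm_nonneg z]

lemma SV.der {Φ ℓ : ℂ → ℂ} {P c1 c2 : ℂ} {a b : ℝ} (h : SV δ R u F G Φ P a b ℓ c1 c2) {z : ℂ}
    (hz : z ∈ posSet (ann δ R) u) (ha : a < ‖z‖) (hb : ‖z‖ < b) :
    HasFDerivAt (fun z => Φ (ℓ z) - c1) (phL (qq u z)) z := by
  have hn : closure (posSet (ann δ R) u) ∩ {z | a ≤ ‖z‖ ∧ ‖z‖ ≤ b} ∈ 𝓝 z := by
    filter_upwards [h.s.o.mem_nhds hz, (isOpen_lt continuous_const continuous_norm).mem_nhds ha,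
      (isOpen_lt continuous_norm continuous_const).mem_nhds hb] with w h1 h2 h3
    exact ⟨subset_closure h1, le_of_lt h2, le_of_lt h3⟩
  have he := h.e z (mem_of_mem_nhds hn)
  have hz0 : z ≠ 0 := norm_pos_iff.1 (h.s.hδ.trans hz.1.1)
  have hd : HasDerivAt ℓ z⁻¹ z := by
    have := (hasDerivAt_exp (ℓ z)).of_local_left_inverse (h.c.continuousAt hn) (exp_ne_zero _)
      (by filter_upwards [hn] with w hw using h.e w hw)
    rwa [he] at this
  have h1 := h.p.d1 (ℓ z) (I0_of (by rw [he]; exact hz.1)) (by rw [tD, mem_preimage, he]; exact hz)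
  have h2 := h1.comp z hd.complexToReal_fderiv
  refine (h2.sub_const c1).congr_fderiv ?_
  ext x
  have e : z * (z⁻¹ * x) = x := by field_simp
  simp only [LL, he, ContinuousLinearMap.comp_apply, ContinuousLinearMap.smul_apply, ContinuousLinearMap.one_apply,
    ContinuousLinearMap.coe_restrictScalars', ContinuousLinearMap.toSpanSingleton_apply, smul_eq_mul]
  rw [mul_comm, e]

lemma Sol.pkg (h : Sol δ R u F G) (hR : 32 * δ < R) : ∃ Φ : ℂ → ℂ,
    AE (CL + CM) (KK * δ) (R / 4) (uu δ u) Φ (qq u) (ZZ δ R u) := by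
  have hδ := h.hδ
  have hCM := CM_pos
  have hCL := CL_ge
  obtain ⟨Φ, P, a1, a2, a3, a4, a5⟩ := h.pot (by linarith)
  have hP : Pot δ R u Φ P := ⟨a1, a2, a3, a4, a5⟩
  obtain ⟨ℓ, c1, c2, b1, b2, b3, b4⟩ := h.sv hP (a := 2 * δ) (b := R / 2) (by linarith) (by linarith)
  have hs : SV δ R u F G Φ P (2 * δ) (R / 2) ℓ c1 c2 := ⟨h, hP, b1, b2, b3, b4⟩
  have hcc : ‖c1 - c2‖ ≤ 2 * Real.pi * CM * (4 * δ) := by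
    have he : Real.exp (Real.log (4 * δ)) = 4 * δ := Real.exp_log (by linarith)
    have := hs.cc (x := Real.log (4 * δ)) (by rw [he]; linarith) (by rw [he]; linarith) (by rw [he]; linarith)
      (by rw [he]; linarith)
    rwa [he] at this
  have hpi : 2 * Real.pi * CM ≤ 6.3 * CM := by have := Real.pi_lt_d2; nlinarith
  have hcc' : ‖c1 - c2‖ ≤ 25.2 * CM * δ := by nlinarith
  set Z := ZZ δ R u
  have hZc := h.ZZc hR
  set ε := 4 * (CL + 20 * CM + 1) * δ with hε
  have hε0 : 0 < ε := by positivity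
  have hεK : KK * δ = 2 * ε := by rw [hε, KK]; ring
  have hK1 : CL * δ ≤ ε := by rw [hε]; nlinarith
  have hK2 : 80 * CM * δ < ε := by rw [hε]; nlinarith
  have nb : ∀ p : ℂ, ∀ c : ℝ, c < ‖p‖ → ∀ᶠ z in 𝓝 p, c < ‖z‖ := fun p c hc =>
    (isOpen_lt continuous_const continuous_norm).mem_nhds hc
  have nb' : ∀ p : ℂ, ∀ c : ℝ, ‖p‖ < c → ∀ᶠ z in 𝓝 p, ‖z‖ < c := fun p c hc =>
    (isOpen_lt continuous_norm continuous_const).mem_nhds hc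
  let Ψ : ℂ → ℂ := fun z => if z ∈ Z then 0 else Φ (ℓ z) - c1
  have hbR : ∀ z : ℂ, z ∈ ball (0:ℂ) (R / 4) → ‖z‖ < R / 4 := fun z hz => by simpa using hz
  have hq : ∀ z ∈ ball (0:ℂ) (R / 4), z ∉ Z → ‖qq u z‖ ≤ CL := fun z hz hzZ => by
    have h1 := h.offZ (hbR z hz) hzZ
    exact h.qb (by linarith [h1.1]) (by linarith [hbR z hz]) h1.2
  have hdu : ∀ z ∈ ball (0:ℂ) (R / 4), z ∉ Z → HasFDerivAt (uu δ u) (reL (qq u z)) z := fun z hz hzZ => by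
    have h1 := h.offZ (hbR z hz) hzZ
    refine (qq_du (ann_open δ R) h.h h1.2).congr_of_eventuallyEq ?_
    filter_upwards [nb z _ h1.1] with w hw
    simp [uu, not_le.2 hw]
  have hdΨ : ∀ z ∈ ball (0:ℂ) (R / 4), z ∉ Z → HasFDerivAt Ψ (phL (qq u z)) z := fun z hz hzZ => by
    have h1 := h.offZ (hbR z hz) hzZ
    refine (hs.der h1.2 (by linarith [h1.1]) (by linarith [hbR z hz])).congr_of_eventuallyEq ?_
    filter_upwards [hZc.isOpen_compl.mem_nhds hzZ] with w hw
    simp only [Ψ]; rw [if_neg hw]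
  have hzu : ∀ z ∈ Z, uu δ u z = 0 := fun z hz => by
    rcases hz with hz | hz
    · simp [uu, hz]
    · simp [uu, hz.2]
  have hzΨ : ∀ z ∈ Z, Ψ z = 0 := fun z hz => if_pos hz
  have hbu : ∀ p ∈ Z, p ∈ ball (0:ℂ) (R / 4) → ∀ᶠ z in 𝓝 p, ‖uu δ u z‖ ≤ ε := fun p hp hpB => by
    have hpR := hbR p hpB
    rcases le_or_gt ‖p‖ (4 * δ) with hp4 | hp4
    · filter_upwards [nb' p (8 * δ) (by linarith)] with z hz
      unfold uu
      split_ifs with h1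
      · simpa using hε0.le
      · push Not at h1
        have hub := h.ub (x := z) (by linarith) (by linarith)
        have hnn := h.h.nonneg z ⟨by linarith, by linarith⟩
        rw [Real.norm_eq_abs, abs_of_nonneg hnn]
        refine hub.trans (le_trans ?_ hK1)
        rw [CL]
        have : (0:ℝ) < 3 ^ 64 := by positivity
        nlinarith
    · have hp0 : u p = 0 := by
        rcases hp with hp | hp
        · linarith
        · exact hp.2
      have hpA : p ∈ ann δ R := ⟨by linarith, by linarith⟩
      have hc := h.h.contOn.continuousAt ((ann_open δ R).mem_nhds hpA)
      have h1 : ∀ᶠ z in 𝓝 p, ‖u z‖ < ε := hc.norm.eventually (gt_mem_nhds (by simpa [hp0] using hε0))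
      filter_upwards [nb p _ hp4, h1] with z hz hz1
      simpa [uu, not_le.2 hz] using hz1.le
  have hbΨ : ∀ p ∈ Z, p ∈ ball (0:ℂ) (R / 4) → ∀ᶠ z in 𝓝 p, ‖Ψ z‖ ≤ ε := fun p hp hpB => by
    have hpR := hbR p hpB
    rcases le_or_gt ‖p‖ (4 * δ) with hp4 | hp4
    · filter_upwards [nb' p (8 * δ) (by linarith)] with z hz
      simp only [Ψ]
      split_ifs with h1
      · simpa using hε0.le
      · have h2 := h.offZ (by linarith) h1
        have he : ‖z‖ = Real.exp (Real.log ‖z‖) := (Real.exp_log (by linarith)).symm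
        have := hs.arc (x := Real.log ‖z‖) (by rw [← he]; linarith) (by rw [← he]; linarith) (by rw [← he]; linarith)
          (by rw [← he]; linarith) h2.2 he
        rw [← he] at this
        have e2 : 2 * Real.pi * CM * ‖z‖ ≤ 6.3 * CM * (8 * δ) := by gcongr
        nlinarith
    · have hp0 : u p = 0 := by
        rcases hp with hp | hp
        · linarith
        · exact hp.2
      have hpA : p ∈ ann δ R := ⟨by linarith, by linarith⟩
      by_cases hpc : p ∈ closure (posSet (ann δ R) u)
      · have hpF : p ∈ FB (ann δ R) u := (FB_iff (ann_open δ R) h.h).2 ⟨hpA, hpc, fun hh => hh.2.ne' hp0⟩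
        have hm : p ∈ closure (posSet (ann δ R) u) ∩ {z | 2 * δ ≤ ‖z‖ ∧ ‖z‖ ≤ R / 2} :=
          ⟨hpc, by linarith, by linarith⟩
        have hc1 : ContinuousWithinAt (fun z => Φ (ℓ z)) (closure (posSet (ann δ R) u) ∩ {z | 2 * δ ≤ ‖z‖ ∧ ‖z‖ ≤ R / 2}) p := by
          refine (hP.c.comp b1 fun z hz => ?_) p hm
          refine I0_of ?_
          rw [b2 z hz]
          have q1 := hz.2.1; have q2 := hz.2.2
          exact ⟨by linarith, by linarith⟩
        have hv : ‖Φ (ℓ p) - c1‖ < ε := by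
          rcases hs.val hpF hm.2.1 hm.2.2 with hv | hv <;> rw [hv]
          · simpa using hε0
          · rw [norm_sub_rev]; nlinarith
        have h1 := (hc1.sub_const c1).norm.eventually (gt_mem_nhds hv)
        rw [eventually_nhdsWithin_iff] at h1
        filter_upwards [h1, nb' p _ hpR] with z hz hz4
        simp only [Ψ]
        split_ifs with hzZ
        · simpa using hε0.le
        · have h2 := h.offZ hz4 hzZ
          exact (hz ⟨subset_closure h2.2, by linarith [h2.1], by linarith⟩).le
      · filter_upwards [isClosed_closure.isOpen_compl.mem_nhds hpc, nb' p _ hpR] with z hz hz4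
        have : z ∈ Z := by
          by_contra hzZ
          exact hz (subset_closure (h.offZ hz4 hzZ).2)
        rw [hzΨ z this]; simpa using hε0.le
  refine ⟨Ψ, hZc, ⟨0, Or.inl (by simp; linarith)⟩, fun z hz r hr hzr => h.circ hR hz hr hzr, fun z hz => ?_,
    fun z hz _ => hzu z hz, fun z hz _ => hzΨ z hz, fun z hz w hw => ?_, fun z hz w hw => ?_, ?_, hdu, hdΨ⟩
  · unfold uu
    split_ifs with h1
    · exact le_rfl
    · have := hbR z hz
      exact h.h.nonneg z ⟨by linarith, by linarith⟩
  · rw [hεK]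
    refine lipB (f' := fun z => reL (qq u z)) (by positivity) hε0.le hZc hzu (fun v hv hvZ => ⟨hdu v hv hvZ, ?_⟩) hbu hz hw
    linarith [reL_norm (qq u v), hq v hv hvZ]
  · rw [hεK]
    refine lipB (f' := fun z => phL (qq u z)) (by positivity) hε0.le hZc hzΨ (fun v hv hvZ => ⟨hdΨ v hv hvZ, ?_⟩) hbΨ hz hw
    have e1 := phL_norm (qq u v)
    have e2 : ‖qq u v‖ ^ 2 ≤ CL ^ 2 := by gcongr; exact hq v hv hvZ
    have : CM = CL ^ 2 + 1 := rfl
    linarith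
  · exact (qq_hol (ann_open δ R) h.h).mono fun z hz => (h.offZ (hbR z hz.1) hz.2).2
end

section
variable {δ R : ℝ} {u : ℂ → ℝ} {F G : Set ℂ}

lemma Sol.circD (h : Sol δ R u F G) {r : ℝ} (h1 : δ < r) (h2 : r < R) :
    ∃ z ∈ posSet (ann δ R) u, ‖z‖ = r := by
  by_contra! hc
  set D := posSet (ann δ R) u
  set A := D ∩ {z | ‖z‖ < r}
  set B := D ∩ {z | r < ‖z‖}
  have hAB : D ⊆ A ∪ B := fun z hz => by
    rcases lt_trichotomy ‖z‖ r with h | h | h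
    exacts [.inl ⟨hz, h⟩, absurd h (hc z hz), .inr ⟨hz, h⟩]
  have hAo : IsOpen A := h.o.inter (isOpen_lt continuous_norm continuous_const)
  have hBo : IsOpen B := h.o.inter (isOpen_lt continuous_const continuous_norm)
  have hFD : F ⊆ closure A ∪ closure B := fun p hp => by
    rw [← closure_union]
    exact closure_mono hAB ((FB_iff (ann_open _ _) h.h).1 (h.Fs hp)).2.1
  have hA1 : closure A ⊆ {z | ‖z‖ ≤ r} :=
    closure_minimal (fun z hz => (show ‖z‖ ≤ r from le_of_lt hz.2)) (isClosed_le continuous_norm continuous_const)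
  have hB1 : closure B ⊆ {z | r ≤ ‖z‖} :=
    closure_minimal (fun z hz => (show r ≤ ‖z‖ from le_of_lt hz.2)) (isClosed_le continuous_const continuous_norm)
  obtain ⟨p1, hp1, hp1'⟩ := h.near1 h1
  obtain ⟨p2, hp2, hp2'⟩ := h.near2 h2
  obtain ⟨p, hp, hpA, hpB⟩ := isPreconnected_closed_iff.1 h.pF _ _ isClosed_closure isClosed_closure hFD
    ⟨p1, hp1, (hFD hp1).resolve_right fun hh => absurd (hB1 hh) (not_le.2 hp1')⟩
    ⟨p2, hp2, (hFD hp2).resolve_left fun hh => absurd (hA1 hh) (not_le.2 hp2')⟩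
  obtain ⟨N, hN, hpN, -, -, -, hND, -⟩ := loc (ann_open _ _) h.h (h.Fs hp) (univ_mem : univ ∈ 𝓝 p)
  obtain ⟨z1, hz1, hz1'⟩ := mem_closure_iff.1 hpA N hN hpN
  obtain ⟨z2, hz2, hz2'⟩ := mem_closure_iff.1 hpB N hN hpN
  obtain ⟨z, -, hz, hz'⟩ := hND A B hAo hBo (inter_subset_right.trans hAB)
    ⟨z1, ⟨hz1, hz1'.1⟩, hz1'⟩ ⟨z2, ⟨hz2, hz2'.1⟩, hz2'⟩
  exact lt_asymm (show ‖z‖ < r from hz.2) hz'.2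

lemma ga_surj' {x : ℝ} {z : ℂ} (hz : ‖z‖ = Real.exp x) : ∃ t ∈ Icc 0 (2 * Real.pi), ga x t = z := by
  obtain ⟨t, ht⟩ := ga_surj hz
  have hp : (0:ℝ) < 2 * Real.pi := by positivity
  refine ⟨toIcoMod hp 0 t, ?_, ?_⟩
  · have := toIcoMod_mem_Ico hp 0 t
    rw [zero_add] at this; exact ⟨this.1, this.2.le⟩
  · rw [← ht, toIcoMod, sub_eq_add_neg, ← neg_zsmul, ga_per]

lemma Sol.epsD (h : Sol δ R u F G) {a b : ℝ} (ha : a ∈ I0 δ R) (hb : b ∈ I0 δ R) :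
    ∃ ε0 > 0, ∀ x ∈ Icc a b, ∃ t ∈ Icc 0 (2 * Real.pi), ε0 ≤ u (ga x t) := by
  refine isCompact_Icc.induction_on
    (p := fun s => ∃ ε0 > 0, ∀ x ∈ s, ∃ t ∈ Icc 0 (2 * Real.pi), ε0 ≤ u (ga x t))
    ⟨1, one_pos, by simp⟩
    (fun s t hst ⟨e, he, h⟩ => ⟨e, he, fun z hz => h z (hst hz)⟩)
    (fun s t ⟨e, he, h⟩ ⟨e', he', h'⟩ => ⟨min e e', lt_min he he', fun x hx => by
      rcases hx with hh | hh
      · obtain ⟨t, ht, h⟩ := h x hh; exact ⟨t, ht, (min_le_left _ _).trans h⟩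
      · obtain ⟨t, ht, h⟩ := h' x hh; exact ⟨t, ht, (min_le_right _ _).trans h⟩⟩) fun x hx => ?_
  have hxI := I0_ord ha hb hx
  obtain ⟨z, hz, hz'⟩ := h.circD hxI.1 hxI.2
  obtain ⟨t, ht, rfl⟩ := ga_surj' hz'
  have hc : ContinuousAt (fun x => u (ga x t)) x :=
    ContinuousAt.comp (g := u) (f := fun x => ga x t) (h.h.contOn.continuousAt ((ann_open _ _).mem_nhds hz.1))
      (by unfold ga; fun_prop)
  refine ⟨_, mem_nhdsWithin_of_mem_nhds (hc.eventually (lt_mem_nhds (half_lt_self hz.2))),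
    u (ga x t) / 2, half_pos hz.2, fun y hy => ⟨t, ht, le_of_lt hy⟩⟩

lemma Sol.inner (h : Sol δ R u F G) {x ε : ℝ} (hε : 0 < ε) (hx : x ∈ I0 δ R)
    (hq : ∀ t : ℝ, 0 < u (ga x t) → u (ga x t) ≤ ε → 1 / 2 ≤ ‖qq u (ga x t)‖)
    (hD : ∃ t ∈ Icc 0 (2 * Real.pi), ε ≤ u (ga x t)) :
    Real.exp x / 2 ≤ ∫ y : ℝ in 0..2 * Real.pi, en u ε (x + y * I) := by
  obtain ⟨t1, ht1, hu1⟩ := hD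
  obtain ⟨p, hp⟩ := h.circF hx
  obtain ⟨t0, ht0, hu0⟩ := ga_surj' (ga_norm x p)
  have hz0 : u (ga x t0) = 0 := by
    rw [hu0]
    have := (FB_iff (ann_open _ _) h.h).1 (h.Fs hp)
    exact u_zero h.h this.1 this.2.2
  have hp : (0:ℝ) ≤ 2 * Real.pi := by positivity
  have hann : ∀ y : ℝ, exp (x + y * I) ∈ ann δ R := fun y => I0_ann (by simpa using hx)
  let f' : ℝ → ℝ := fun y => deriv (gt ε) (u (ga x y)) * (tQ u (x + y * I) * I).re
  have hf : ∀ y, HasDerivAt (fun y => gt ε (u (ga x y))) (f' y) y := fun y => by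
    by_cases hy : 0 < u (ga x y)
    · have h1 := h.tdU (ζ := x + y * I) ⟨hann y, hy⟩
      have h2 : HasDerivAt (fun y : ℝ => (x + y * I : ℂ)) I y := by
        simpa using ((ofRealCLM.hasDerivAt (x := y)).mul_const I).const_add (x : ℂ)
      have h3 := h1.comp_hasDerivAt y h2
      have h4 := ((gt_cd ε).differentiable one_ne_zero (u (ga x y))).hasDerivAt
      exact HasDerivAt.comp (h₂ := gt ε) (h := fun y => u (ga x y)) y h4 h3
    · have hc : ContinuousAt (fun y => u (ga x y)) y :=
        ContinuousAt.comp (g := u) (h.h.contOn.continuousAt ((ann_open _ _).mem_nhds (hann y)))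
          (ga_cont x).continuousAt
      have hy' : u (ga x y) < ε / 2 := by linarith
      have e : f' y = 0 := by simp [f', gt_d0 hε (.inl hy')]
      rw [e]
      refine (hasDerivAt_const y (0:ℝ)).congr_of_eventuallyEq ?_
      filter_upwards [hc.eventually (gt_mem_nhds hy')] with s hs using gt_zero hε _ hs
  have hf'c : Continuous f' := by
    have h1 := cont_cut (S := exp ⁻¹' ann δ R) So h.tU (h.ttQ.continuousOn.mul (continuousOn_const (c := I)))
      ((gt_cd ε).continuous_deriv le_rfl) (half_pos hε) fun t ht => gt_d0 hε (.inl ht)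
    have h2 := continuous_re.comp (h1.comp_continuous (f := fun y : ℝ => (x + y * I : ℂ)) (by fun_prop) hann)
    refine h2.congr fun y => ?_
    simp only [Function.comp, f', re_ofReal_mul, Pi.mul_apply]; rfl
  have hE : Continuous fun y : ℝ => en u ε (x + y * I) := by
    have h1 := cont_cut (S := exp ⁻¹' ann δ R) So h.tU (h.ttQ.continuousOn.mul
      (continuous_conj.comp_continuousOn h.ttQ.continuousOn))
      ((gt_cd ε).continuous_deriv le_rfl) (half_pos hε) fun t ht => gt_d0 hε (.inl ht)
    have h2 := continuous_re.comp (h1.comp_continuous (f := fun y : ℝ => (x + y * I : ℂ)) (by fun_prop) hann)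
    refine h2.congr fun y => ?_
    simp only [Function.comp, en, Pi.mul_apply]
    rw [mul_conj, ← ofReal_mul, ofReal_re, normSq_eq_norm_sq]
  have hle : ∀ y : ℝ, Real.exp x / 2 * |f' y| ≤ en u ε (x + y * I) := fun y => by
    have hg := gt_d hε (u (ga x y))
    have e1 : |f' y| ≤ deriv (gt ε) (u (ga x y)) * ‖tQ u (x + y * I)‖ := by
      simp only [f', abs_mul, abs_of_nonneg hg]
      gcongr
      refine (abs_re_le_norm _).trans ?_
      simp
    by_cases hy : 0 < u (ga x y) ∧ u (ga x y) ≤ ε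
    · have h3 : Real.exp x / 2 ≤ ‖tQ u (x + y * I)‖ := by
        rw [tQ, norm_mul, norm_exp]
        have := hq y hy.1 hy.2
        simp only [ga] at this
        have := mul_le_mul_of_nonneg_right this (Real.exp_pos x).le
        simp; linarith
      calc _ ≤ ‖tQ u (x + y * I)‖ * (deriv (gt ε) (u (ga x y)) * ‖tQ u (x + y * I)‖) := by gcongr
        _ = _ := by rw [en]; simp only [ga]; ring
    · have : deriv (gt ε) (u (ga x y)) = 0 := gt_d0 hε (by
        rw [not_and_or, not_lt, not_le] at hy
        exact hy.imp (fun h => by linarith) id)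
      have e : f' y = 0 := by simp [f', this]
      rw [e]; simp only [en]
      have := gt_d hε (u (exp (x + y * I)))
      simp; positivity
  have hint := intervalIntegral.integral_eq_sub_of_hasDerivAt (fun y _ => hf y) (hf'c.intervalIntegrable (μ := volume) t0 t1)
  rw [hz0, gt_zero hε 0 (by linarith), gt_one hε hu1] at hint
  have h5 : |∫ y in t0..t1, f' y| ≤ |∫ y in t0..t1, abs (f' y)| := by
    simpa using intervalIntegral.norm_integral_le_abs_integral_norm (f := f') (a := t0) (b := t1) (μ := volume)
  have h6 : |∫ y in t0..t1, abs (f' y)| ≤ |∫ y in 0..2 * Real.pi, abs (f' y)| := by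
    refine intervalIntegral.abs_integral_mono_interval ?_ (.of_forall fun _ => abs_nonneg _)
      (hf'c.abs.intervalIntegrable _ _)
    rw [uIoc_of_le hp]
    exact fun y hy => ⟨(le_min ht0.1 ht1.1).trans_lt hy.1, hy.2.trans (max_le ht0.2 ht1.2)⟩
  rw [abs_of_nonneg (intervalIntegral.integral_nonneg hp fun _ _ => abs_nonneg _)] at h6
  rw [hint] at h5
  have h7 := intervalIntegral.integral_mono (μ := volume) hp ((hf'c.abs.const_mul (Real.exp x / 2)).intervalIntegrable _ _)
    (hE.intervalIntegrable 0 (2 * Real.pi)) hle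
  rw [intervalIntegral.integral_const_mul] at h7
  have h8 : 1 ≤ ∫ y in 0..2 * Real.pi, |f' y| := by
    have := h5.trans h6; simpa using this
  have := mul_le_mul_of_nonneg_left h8 (show 0 ≤ Real.exp x / 2 by positivity)
  linarith

noncomputable def GG (ε t : ℝ) : ℝ := ∫ s in 0..t, gt ε s

lemma GG_d (ε t : ℝ) : HasDerivAt (GG ε) (gt ε t) t :=
  intervalIntegral.integral_hasDerivAt_right ((gt_cd ε).continuous.intervalIntegrable _ _)
    ((gt_cd ε).continuous.stronglyMeasurableAtFilter _ _) (gt_cd ε).continuous.continuousAt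

lemma GG_cd (ε : ℝ) : ContDiff ℝ 1 (GG ε) := by
  rw [contDiff_one_iff_deriv]
  refine ⟨fun t => (GG_d ε t).differentiableAt, ?_⟩
  rw [show deriv (GG ε) = gt ε from funext fun t => (GG_d ε t).deriv]
  exact (gt_cd ε).continuous

lemma GG_zero {ε : ℝ} (hε : 0 < ε) : ∀ t < ε / 2, GG ε t = 0 := fun t ht => by
  refine intervalIntegral.integral_zero_ae (.of_forall fun s hs => gt_zero hε s ?_)
  have := hs.2
  rcases max_cases 0 t with h | h <;> linarith

lemma GG_bd {ε t S : ℝ} (ht : 0 ≤ t) (hS : t ≤ S) : 0 ≤ GG ε t ∧ GG ε t ≤ S := by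
  refine ⟨intervalIntegral.integral_nonneg ht fun s _ => (gt_01 ε s).1, ?_⟩
  have := intervalIntegral.integral_mono (μ := volume) ht ((gt_cd ε).continuous.intervalIntegrable 0 t)
    (intervalIntegrable_const (c := (1:ℝ))) (fun s => (gt_01 ε s).2)
  simp at this
  exact this.trans hS

lemma per_exp (x : ℝ) : exp (x + ((2 * Real.pi : ℝ) : ℂ) * I) = exp (x + ((0:ℝ) : ℂ) * I) := by
  have := ga_per x 0 1
  simpa [ga] using this

noncomputable def JJ (u : ℂ → ℝ) (ε x : ℝ) : ℝ :=
  ∫ y : ℝ in 0..2 * Real.pi, ((gt ε (u (exp (x + y * I))) : ℂ) * tQ u (x + y * I)).re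

noncomputable def mm (u : ℂ → ℝ) (ε x : ℝ) : ℝ := ∫ y : ℝ in 0..2 * Real.pi, GG ε (u (exp (x + y * I)))

lemma bdI_per {f : ℂ → ℂ} {x0 x1 : ℝ} (hf : ∀ x : ℝ, f (x + ((2 * Real.pi : ℝ) : ℂ) * I) = f (x + ((0:ℝ) : ℂ) * I)) :
    bdI f x0 x1 0 (2 * Real.pi) = I * ((∫ y : ℝ in 0..2 * Real.pi, f (x1 + y * I)) -
      ∫ y : ℝ in 0..2 * Real.pi, f (x0 + y * I)) := by
  simp only [bdI, hf, sub_self, smul_eq_mul]; ring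

lemma Sol.Jd (h : Sol δ R u F G) {ε : ℝ} (hε : 0 < ε) {x0 x1 : ℝ} (hx0 : x0 ∈ I0 δ R) (hx1 : x1 ∈ I0 δ R)
    (hx : x0 ≤ x1) : JJ u ε x1 - JJ u ε x0 = int2 (en u ε) x0 x1 0 (2 * Real.pi) := by
  have hp : (0:ℝ) ≤ 2 * Real.pi := by positivity
  have h1 := h.green_en hε hx0 hx1 hx hp
  rw [bdI_per fun x => by simp only [tQ, per_exp]] at h1
  have h2 := congrArg re (mul_left_cancel₀ I_ne_zero h1)
  have key : ∀ x ∈ I0 δ R, JJ u ε x =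
      (∫ y : ℝ in 0..2 * Real.pi, (gt ε (u (exp (x + y * I))) : ℂ) * tQ u (x + y * I)).re := fun x hx => by
    have hc := cont_in (x := x) (x0 := x) (x1 := x) (y0 := 0) (y1 := 2 * Real.pi)
      ((h.gcont h.ttQ.continuousOn hε).mono fun ζ hζ => I0_ann (I0_ord hx hx hζ.1)) hp ⟨le_rfl, le_rfl⟩
    exact reCLM.intervalIntegral_comp_comm hc
  rw [key x0 hx0, key x1 hx1, ← sub_re, h2, ofReal_re]

lemma Sol.md (h : Sol δ R u F G) {ε : ℝ} (hε : 0 < ε) {x0 x1 : ℝ} (hx0 : x0 ∈ I0 δ R) (hx1 : x1 ∈ I0 δ R)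
    (hx : x0 ≤ x1) : mm u ε x1 - mm u ε x0 = ∫ x in x0..x1, JJ u ε x := by
  have hp : (0:ℝ) ≤ 2 * Real.pi := by positivity
  have h1 := _root_.green (S := exp ⁻¹' ann δ R) (K := fun _ => 1) (x0 := x0) (x1 := x1) (y0 := 0) (y1 := 2 * Real.pi)
    So h.tU (fun ζ hζ hp => h.tdU ⟨hζ, hp⟩)
    h.ttQ.continuousOn (differentiableOn_const _) (GG_cd ε) (half_pos hε) (GG_zero hε) (by
      rw [uIcc_of_le hx, uIcc_of_le hp]
      exact fun ζ hζ => I0_ann (I0_ord hx0 hx1 hζ.1))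
  rw [bdI_per fun x => by simp only [per_exp]] at h1
  have hS : ∀ x ∈ Icc x0 x1, x ∈ I0 δ R := fun x hx => I0_ord hx0 hx1 hx
  have hJc : ContinuousOn (fun ζ => ((gt ε (u (exp ζ)) : ℂ) * conj (tQ u ζ))) (Icc x0 x1 ×ℂ Icc 0 (2 * Real.pi)) :=
    (h.gcont (continuous_conj.comp_continuousOn h.ttQ.continuousOn) hε).mono fun ζ hζ => I0_ann (hS _ hζ.1)
  have e : ∀ x : ℝ, deriv (GG ε) x = gt ε x := fun x => (GG_d ε x).deriv
  simp only [e, one_mul, mul_one, intervalIntegral.integral_const_mul] at h1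
  have h2 := congrArg re (mul_left_cancel₀ I_ne_zero h1)
  have h3 : (∫ x : ℝ in x0..x1, ∫ y : ℝ in 0..2 * Real.pi, (gt ε (u (exp (x + y * I))) : ℂ) * conj (tQ u (x + y * I))).re
      = ∫ x in x0..x1, JJ u ε x := by
    have := (reCLM.intervalIntegral_comp_comm (cont_par hJc hx hp)).symm
    refine this.trans (intervalIntegral.integral_congr fun x hx' => ?_)
    rw [uIcc_of_le hx] at hx'
    refine (reCLM.intervalIntegral_comp_comm (cont_in hJc hp hx')).symm.trans ?_
    refine intervalIntegral.integral_congr fun y _ => ?_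
    simp
  rw [h3] at h2
  rw [← h2]
  simp only [intervalIntegral.integral_ofReal, ← ofReal_sub, ofReal_re, mm]

lemma Sol.nondeg (h : Sol δ R u F G) {a : ℝ} (ha : a ∈ I0 δ R) (ha2 : a + 2 ∈ I0 δ R) :
    ∃ z, Real.exp a ≤ ‖z‖ ∧ ‖z‖ ≤ Real.exp (a + 2) ∧ Real.exp a / 30 ≤ u z := by
  by_contra! hc
  have hp : (0:ℝ) ≤ 2 * Real.pi := by positivity
  have hI : ∀ x ∈ Icc a (a + 2), x ∈ I0 δ R := fun x hx => I0_ord ha ha2 hx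
  obtain ⟨e1, he1, h1⟩ := h.epsD ha ha2
  obtain ⟨e2, he2, h2⟩ := unif_one (ann_open _ _) h.h
    (C := closedBall 0 (Real.exp (a + 2)) ∩ {z | Real.exp a ≤ ‖z‖})
    ((isCompact_closedBall _ _).inter_right (isClosed_le continuous_const continuous_norm))
    (fun z hz => ⟨ha.1.trans_le hz.2, lt_of_le_of_lt (by simpa using hz.1) ha2.2⟩) (η := 1 / 2) (by norm_num)
  have hε : 0 < min e1 e2 := lt_min he1 he2
  set ε := min e1 e2
  have hin : ∀ x ∈ Icc a (a + 2), Real.exp a / 2 ≤ ∫ y : ℝ in 0..2 * Real.pi, en u ε (x + y * I) := fun x hx => by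
    refine le_trans ?_ (h.inner hε (hI x hx) (fun t ht ht' => ?_) ?_)
    · have := Real.exp_le_exp.2 hx.1; linarith
    · have := h2 (ga x t) ⟨by simpa [ga_norm] using hx.2, by simpa [ga_norm] using hx.1⟩ ht (ht'.trans (min_le_right _ _))
      have := (abs_lt.1 this).1; linarith
    · obtain ⟨t, ht, hu⟩ := h1 x hx
      exact ⟨t, ht, (min_le_left _ _).trans hu⟩
  have hJ : ∀ x ∈ Icc a (a + 1), Real.exp a / 2 ≤ JJ u ε (x + 1) - JJ u ε x := fun x hx => by
    have hx0 : x ∈ Icc a (a + 2) := ⟨hx.1, by linarith [hx.2]⟩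
    have hx1 : x + 1 ∈ Icc a (a + 2) := ⟨by linarith [hx.1], by linarith [hx.2]⟩
    rw [h.Jd hε (hI _ hx0) (hI _ hx1) (by linarith)]
    have := intervalIntegral.integral_mono_on (show x ≤ x + 1 by linarith) (intervalIntegrable_const (c := Real.exp a / 2))
      (cont_par (h.en_cont (y0 := 0) (y1 := 2 * Real.pi) hε (hI _ hx0) (hI _ hx1)) (by linarith) hp)
      (fun y hy => hin y ⟨by linarith [hy.1, hx.1], by linarith [hy.2, hx.2]⟩)
    rw [int2]; simpa using this
  have hJi : ∀ x0 x1, x0 ∈ Icc a (a + 2) → x1 ∈ Icc a (a + 2) → x0 ≤ x1 →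
      IntervalIntegrable (JJ u ε) volume x0 x1 := fun x0 x1 hx0 hx1 hx => by
    refine cont_par (H := fun ζ => ((gt ε (u (exp ζ)) : ℂ) * tQ u ζ).re) (continuous_re.comp_continuousOn
      ((h.gcont h.ttQ.continuousOn hε).mono fun ζ hζ => I0_ann (I0_ord (hI _ hx0) (hI _ hx1) hζ.1))) hx hp
  have i0 : a ∈ Icc a (a + 2) := ⟨le_rfl, by linarith⟩
  have i1 : a + 1 ∈ Icc a (a + 2) := ⟨by linarith, by linarith⟩
  have i2 : a + 1 + 1 ∈ Icc a (a + 2) := ⟨by linarith, by linarith⟩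
  have j1 := h.md hε (hI _ i0) (hI _ i1) (by linarith)
  have j2 := h.md hε (hI _ i1) (hI _ i2) (by linarith)
  rw [← intervalIntegral.integral_comp_add_right (fun x => JJ u ε x) 1] at j2
  have k0 := hJi _ _ i0 i1 (by linarith)
  have k1 : IntervalIntegrable (fun x => JJ u ε (x + 1)) volume a (a + 1) := by
    have := (hJi _ _ i1 i2 (by linarith)).comp_add_right 1
    simpa using this
  have k2 := intervalIntegral.integral_mono_on (show a ≤ a + 1 by linarith)
    (intervalIntegrable_const (c := Real.exp a / 2)) (k1.sub k0) hJ
  rw [intervalIntegral.integral_sub k1 k0] at k2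
  have hm : ∀ x ∈ Icc a (a + 2), 0 ≤ mm u ε x ∧ mm u ε x ≤ 2 * Real.pi * (Real.exp a / 30) := fun x hx => by
    have hb : ∀ y : ℝ, 0 ≤ GG ε (u (exp (x + y * I))) ∧ GG ε (u (exp (x + y * I))) ≤ Real.exp a / 30 := fun y => by
      have e := ga_norm x y
      have hz := hc (ga x y) (by rw [e]; exact Real.exp_le_exp.2 hx.1) (by rw [e]; exact Real.exp_le_exp.2 hx.2)
      exact GG_bd (h.h.nonneg _ (I0_ann (by simpa using hI x hx))) hz.le
    refine ⟨intervalIntegral.integral_nonneg hp fun y _ => (hb y).1, ?_⟩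
    have := intervalIntegral.norm_integral_le_of_norm_le_const (a := 0) (b := 2 * Real.pi) (C := Real.exp a / 30)
      (f := fun y : ℝ => GG ε (u (exp (x + y * I)))) fun y _ => by
        rw [Real.norm_eq_abs, abs_of_nonneg (hb y).1]; exact (hb y).2
    rw [sub_zero, abs_of_nonneg hp, mul_comm (Real.exp a / 30)] at this
    exact (le_abs_self _).trans this
  have m0 := hm _ i0
  have m1 := hm _ i1
  have m2 := hm _ i2
  have hpi := Real.pi_lt_d2
  have hea := Real.exp_pos a
  rw [intervalIntegral.integral_const, add_sub_cancel_left, one_smul, ← j1, ← j2] at k2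
  nlinarith [mul_lt_mul_of_pos_left hpi hea, m0.1, m0.2, m1.1, m2.2]
end

theorem limits_in_degenerating_annuli (R : ℕ → ℝ) (δ : ℕ → ℝ)
    (hδpos : ∀ k, 0 < δ k) (hδ : Filter.Tendsto δ atTop (nhds 0))
    (hR : Filter.Tendsto R atTop atTop)
    (u : ℕ → ℂ → ℝ)
    (hsol : ∀ k, IsClassicalSolution (ann (δ k) (R k)) (u k))
    (hA : ∀ k, ConditionA (δ k) (R k) (u k)) :
    ∃ (φ : ℕ → ℕ) (v : ℂ → ℝ), StrictMono φ ∧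
      TendstoLocallyUniformlyOn (fun k => u (φ k)) v atTop {(0 : ℂ)}ᶜ ∧
      ∃ θ : ℝ, ((fun z => v (rot θ z)) = Pfun ∨
        (∃ a : ℝ, 0 < a ∧ (fun z => v (rot θ z)) = TPfun a) ∨
        (fun z => v (rot θ z)) = Wfun 1) := by
  have hCM := CM_pos
  have hCL := CL_ge
  obtain ⟨N, hN⟩ := eventually_atTop.1 ((hδ.eventually (gt_mem_nhds one_pos)).and (hR.eventually_gt_atTop 32))
  have hSol : ∀ k, ∃ F G, Sol (δ k) (R k) (u k) F G := fun k => Sol.mk' (hδpos k) (hsol k) (hA k)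
  choose F G hS using hSol
  have hp : ∀ k, 32 * δ (k + N) < R (k + N) := fun k => by
    have := hN (k + N) (by lia); linarith [this.1, this.2]
  choose Φ hΦ using fun k => (hS (k + N)).pkg (hp k)
  have hs : Tendsto (fun k => k + N) atTop atTop := tendsto_add_atTop_nat N
  have h0Z : ∀ k, (0:ℂ) ∈ ZZ (δ (k + N)) (R (k + N)) (u (k + N)) := fun k =>
    Or.inl (by simpa using (hδpos (k + N)).le)
  have hi0 : ∀ k, infDist (0:ℂ) (ZZ (δ (k + N)) (R (k + N)) (u (k + N))) = 0 := fun k => infDist_zero_of_mem (h0Z k)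
  obtain ⟨φ, hφ, ui, Φi, qi, Zi, hcl, hlu, -, hinf⟩ := cpt (M := 0) (L := CL + CM) (by linarith)
    (by simpa using (hδ.comp hs).const_mul KK) ((hR.comp hs).atTop_div_const (show (0:ℝ) < 4 by norm_num)) hΦ
    (fun k => (hi0 k).le) (fun k => by have := hp k; have := hδpos (k + N); simp; linarith)
  have hφN : Tendsto (fun k => φ k + N) atTop atTop := hs.comp hφ.tendsto_atTop
  have h0 : (0:ℂ) ∈ Zi := by
    have h1 := hinf 0
    simp only [hi0] at h1
    have h2 := tendsto_nhds_unique h1 tendsto_const_nhds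
    exact ((hcl 1).cl.mem_iff_infDist_zero (hcl 1).ne).2 h2
  have hδφ : ∀ c > 0, ∀ᶠ k in atTop, 4 * δ (φ k + N) < c := fun c hc => by
    filter_upwards [(hδ.comp hφN).eventually (gt_mem_nhds (show (0:ℝ) < c / 4 by positivity))] with k hk
    simp only [Function.comp] at hk; linarith
  have huu : ∀ k z, 4 * δ (φ k + N) < ‖z‖ → uu (δ (φ k + N)) (u (φ k + N)) z = u (φ k + N) z := fun k z hz => by
    rw [uu, if_neg (not_le.2 hz)]
  have hc0 : (0:ℂ) ∈ closure Ziᶜ := by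
    rw [closure_compl, mem_compl_iff, mem_interior_iff_mem_nhds]
    intro hn
    obtain ⟨s, hs0, hsZ⟩ := Metric.mem_nhds_iff.1 hn
    set a := Real.log (s / 2) - 2
    have hea : Real.exp (a + 2) = s / 2 := by simp only [a, sub_add_cancel]; exact Real.exp_log (by positivity)
    have he := Real.exp_pos a
    have hunif := (tendstoLocallyUniformly_iff_forall_isCompact.1 hlu) _ (isCompact_closedBall (0:ℂ) (s / 2))
    have hev := Metric.tendstoUniformlyOn_iff.1 hunif (Real.exp a / 30) (by positivity)
    obtain ⟨k, hk1, hk2, hk3⟩ := (hev.and ((hδφ _ he).and ((hR.comp hφN).eventually_gt_atTop (s / 2)))).exists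
    simp only [Function.comp] at hk3
    have hd := hδpos (φ k + N)
    have hle := Real.exp_le_exp.2 (show a ≤ a + 2 by linarith)
    obtain ⟨z, hz1, hz2, hz3⟩ := (hS (φ k + N)).nondeg (a := a) ⟨by linarith, by linarith⟩ ⟨by linarith, by linarith⟩
    rw [hea] at hz2
    have h1 := hk1 z (by simpa using hz2)
    rw [huu k z (by linarith), (hcl s).zu z (hsZ (by simp; linarith)) (by simp; linarith), dist_zero_left,
      Real.norm_eq_abs] at h1
    linarith [le_abs_self (u (φ k + N) z)]
  obtain ⟨θ, hθ⟩ := classify (by linarith) hcl h0 hc0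
  refine ⟨fun k => φ k + N, ui, fun i j hij => by have := hφ hij; simpa using this, ?_, θ, hθ⟩
  rw [Metric.tendstoLocallyUniformlyOn_iff]
  intro ε hε z hz
  have hz0 : 0 < ‖z‖ := norm_pos_iff.2 hz
  obtain ⟨t, ht, hev⟩ := Metric.tendstoLocallyUniformly_iff.1 hlu ε hε z
  refine ⟨t ∩ {w | ‖z‖ / 2 < ‖w‖}, mem_nhdsWithin_of_mem_nhds (inter_mem ht
    ((isOpen_lt continuous_const continuous_norm).mem_nhds (half_lt_self hz0))), ?_⟩
  filter_upwards [hev, hδφ _ (half_pos hz0)] with k hk hk' w hw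
  have := hk w hw.1
  rwa [huu k w (hk'.trans hw.2)] at this
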